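/- Let k ≥ 3 and n ≥ 2k+1 be integers, and let ℱ ⊆ ([n] choose k) be an intersecting family. Suppose ℱ is not a star, ℱ is not isomorphic to a subfamily of ℋℳ(n,k), and, in the case k = 3, ℱ is not isomorphic to a subfamily of 𝒢₂(n,3). Then |ℱ| ≤ C(n−1,k−1) − C(n−k−1,k−1) − C(n−k−2,k−2) + 2. Moreover, if k = 3 or k ≥ 5, equality holds if and only if ℱ is isomorphic to 𝒥₂(n,k); if k = 4, equality holds if and only if ℱ is isomorphic to 𝒥₂(n,4), 𝒢₂(n,4) or 𝒢₃(n,4). -/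

import Mathlib

open Finset

/-- `ℋℳ(n,k) = {F ∈ ([n] choose k) : 1 ∈ F, F ∩ [2,k+1] ≠ ∅} ∪ {[2,k+1]}`. -/
def HMfam (n k : ℕ) : Finset (Finset ℕ) :=
  insert (Icc 2 (k + 1))
    ((powersetCard k (Icc 1 n)).filter fun A => 1 ∈ A ∧ (A ∩ Icc 2 (k + 1)).Nonempty)

/-- `𝒥ᵢ(n,k)` with the canonical choice `x₀ = 1`, `E = [2,k]`, `Jᵢ = [k+1,k+i]`:
`{F ∈ ([n] choose k) : 1 ∈ F, F ∩ (E ∪ {j}) ≠ ∅ for each j ∈ Jᵢ} ∪ {E ∪ {j} : j ∈ Jᵢ}`. -/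
def Jfam (n k i : ℕ) : Finset (Finset ℕ) :=
  ((powersetCard k (Icc 1 n)).filter fun A =>
      1 ∈ A ∧ ∀ j ∈ Icc (k + 1) (k + i), (A ∩ insert j (Icc 2 k)).Nonempty)
    ∪ (Icc (k + 1) (k + i)).image fun j => insert j (Icc 2 k)

/-- `𝒢ᵢ(n,k)` with the canonical choice `E = [1,i]`, `x₀ = i+1`:
`{G ∈ ([n] choose k) : E ⊆ G} ∪ {G ∈ ([n] choose k) : x₀ ∈ G, G ∩ E ≠ ∅}`. -/
def Gfam (n k i : ℕ) : Finset (Finset ℕ) :=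
  ((powersetCard k (Icc 1 n)).filter fun A => Icc 1 i ⊆ A)
    ∪ ((powersetCard k (Icc 1 n)).filter fun A => i + 1 ∈ A ∧ (A ∩ Icc 1 i).Nonempty)

/-- `𝒜` is isomorphic to `ℬ`: some permutation of `[n]` maps `𝒜` onto `ℬ`. -/
def IsoTo (n : ℕ) (A B : Finset (Finset ℕ)) : Prop :=
  ∃ σ : Equiv.Perm ℕ, (∀ x ∈ Icc 1 n, σ x ∈ Icc 1 n) ∧
    A.image (fun s => s.image fun x => σ x) = B

/-- `𝒜` is isomorphic to a subfamily of `ℬ`. -/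
def SubIsoTo (n : ℕ) (A B : Finset (Finset ℕ)) : Prop :=
  ∃ σ : Equiv.Perm ℕ, (∀ x ∈ Icc 1 n, σ x ∈ Icc 1 n) ∧
    A.image (fun s => s.image fun x => σ x) ⊆ B

theorem card_filter_not_subset_pair (R C₁ C₂ : Finset ℕ) (r : ℕ) (h₁ : C₁ ⊆ R) (h₂ : C₂ ⊆ R) :
    #{T ∈ powersetCard r R | ¬ T ⊆ C₁ ∧ ¬ T ⊆ C₂} + (#C₁).choose r + (#C₂).choose r
      = (#R).choose r + (#(C₁ ∩ C₂)).choose r := by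
  have hsub : powersetCard r C₁ ∪ powersetCard r C₂ ⊆ powersetCard r R :=
    union_subset (powersetCard_mono h₁) (powersetCard_mono h₂)
  have e1 : (powersetCard r R).filter (fun T => ¬ T ⊆ C₁ ∧ ¬ T ⊆ C₂)
      = powersetCard r R \ (powersetCard r C₁ ∪ powersetCard r C₂) := by
    ext T
    simp only [mem_filter, mem_sdiff, mem_union, mem_powersetCard]
    tauto
  have e2 : powersetCard r C₁ ∩ powersetCard r C₂ = powersetCard r (C₁ ∩ C₂) := by
    ext T
    simp only [mem_inter, mem_powersetCard, subset_inter_iff]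
    tauto
  have e3 := card_union_add_card_inter (powersetCard r C₁) (powersetCard r C₂)
  have e4 := card_sdiff_add_card_eq_card hsub
  rw [e2] at e3
  rw [e1]
  simp only [card_powersetCard] at *
  omega

theorem card_star_meet_pair {V B₁ B₂ : Finset ℕ} {x k : ℕ} (hk : 1 ≤ k) (hx : x ∈ V)
    (hB₁ : B₁ ⊆ V) (hB₂ : B₂ ⊆ V) (hx₁ : x ∉ B₁) (hx₂ : x ∉ B₂) (hc₁ : #B₁ = k) (hc₂ : #B₂ = k) :
    #{A ∈ powersetCard k V | x ∈ A ∧ (A ∩ B₁).Nonempty ∧ (A ∩ B₂).Nonempty}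
        + 2 * (#V - 1 - k).choose (k - 1)
      = (#V - 1).choose (k - 1) + (#V - 1 - #(B₁ ∪ B₂)).choose (k - 1) := by
  have key := card_filter_not_subset_pair (V.erase x) (V.erase x \ B₁) (V.erase x \ B₂) (k - 1)
    sdiff_subset sdiff_subset
  have hE : ∀ B : Finset ℕ, B ⊆ V → x ∉ B → B ⊆ V.erase x := fun B h h' y hy =>
    mem_erase.2 ⟨fun e => h' (e ▸ hy), h hy⟩
  have hU : B₁ ∪ B₂ ⊆ V.erase x := union_subset (hE _ hB₁ hx₁) (hE _ hB₂ hx₂)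
  have e : (V.erase x \ B₁) ∩ (V.erase x \ B₂) = V.erase x \ (B₁ ∪ B₂) := by
    ext y; simp only [mem_inter, mem_sdiff, mem_union]; tauto
  rw [e, card_sdiff_of_subset hU, card_sdiff_of_subset (hE _ hB₁ hx₁),
    card_sdiff_of_subset (hE _ hB₂ hx₂), card_erase_of_mem hx, hc₁, hc₂] at key
  have bij : #{A ∈ powersetCard k V | x ∈ A ∧ (A ∩ B₁).Nonempty ∧ (A ∩ B₂).Nonempty}
      = #{T ∈ powersetCard (k - 1) (V.erase x) | ¬ T ⊆ V.erase x \ B₁ ∧ ¬ T ⊆ V.erase x \ B₂} := by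
    have aux : ∀ B : Finset ℕ, x ∉ B → ∀ A : Finset ℕ, A ⊆ V →
        ((A ∩ B).Nonempty ↔ ¬ A.erase x ⊆ V.erase x \ B) := by
      intro B hB A hA
      rw [not_subset]
      constructor
      · rintro ⟨y, hy⟩
        rw [mem_inter] at hy
        refine ⟨y, mem_erase.2 ⟨fun e => hB (e ▸ hy.2), hy.1⟩, ?_⟩
        simp [hy.2]
      · rintro ⟨y, hy, hy'⟩
        rw [mem_erase] at hy
        refine ⟨y, mem_inter.2 ⟨hy.2, ?_⟩⟩
        by_contra hyB
        exact hy' (mem_sdiff.2 ⟨mem_erase.2 ⟨hy.1, hA hy.2⟩, hyB⟩)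
    refine card_bij' (fun A _ => A.erase x) (fun T _ => insert x T) ?_ ?_ ?_ ?_
    · intro A hA
      simp only [mem_filter, mem_powersetCard] at hA ⊢
      obtain ⟨⟨hAV, hAk⟩, hxA, h1, h2⟩ := hA
      exact ⟨⟨erase_subset_erase _ hAV, by rw [card_erase_of_mem hxA, hAk]⟩,
        (aux _ hx₁ _ hAV).1 h1, (aux _ hx₂ _ hAV).1 h2⟩
    · intro T hT
      simp only [mem_filter, mem_powersetCard] at hT ⊢
      obtain ⟨⟨hTV, hTk⟩, h1, h2⟩ := hT
      have hxT : x ∉ T := fun h => by simpa using hTV h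
      have hIV : insert x T ⊆ V := insert_subset hx (hTV.trans (erase_subset _ _))
      refine ⟨⟨hIV, by rw [card_insert_of_notMem hxT]; omega⟩, mem_insert_self _ _, ?_, ?_⟩
      · rw [aux _ hx₁ _ hIV, erase_insert hxT]; exact h1
      · rw [aux _ hx₂ _ hIV, erase_insert hxT]; exact h2
    · intro A hA
      simp only [mem_filter] at hA
      exact insert_erase hA.2.1
    · intro T hT
      simp only [mem_filter, mem_powersetCard] at hT
      exact erase_insert fun h => by simpa using hT.1.1 h
  rw [bij]
  omega

theorem card_star_add_le {Y : Finset ℕ} {x i : ℕ} (hx : x ∈ Y)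
    {T U : Finset (Finset ℕ)} (hT : T ⊆ powersetCard i Y) (hTx : ∀ A ∈ T, x ∈ A)
    (hU : U ⊆ powersetCard (i - 1) (Y.erase x)) (hTU : ∀ A ∈ T, A.erase x ∉ U) :
    #T + #U ≤ (#Y - 1).choose (i - 1) := by
  have hinj : Set.InjOn (fun A : Finset ℕ => A.erase x) T := by
    intro A hA B hB h
    have h' : A.erase x = B.erase x := h
    rw [← insert_erase (hTx A hA), ← insert_erase (hTx B hB), h']
  have hd : Disjoint (T.image fun A => A.erase x) U := by
    rw [disjoint_left]
    intro A hA hAU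
    obtain ⟨B, hB, rfl⟩ := mem_image.1 hA
    exact hTU B hB hAU
  rw [← card_image_of_injOn hinj, ← card_union_of_disjoint hd, ← card_erase_of_mem hx,
    ← card_powersetCard]
  refine card_le_card (union_subset ?_ hU)
  intro A hA
  obtain ⟨B, hB, rfl⟩ := mem_image.1 hA
  have := mem_powersetCard.1 (hT hB)
  exact mem_powersetCard.2 ⟨erase_subset_erase _ this.1,
    by rw [card_erase_of_mem (hTx B hB), this.2]⟩

/-- The family of all `k`-subsets of `V` whose trace on `Z` is `S`. -/
theorem card_filter_inter_eq {V Z S : Finset ℕ} (hZ : Z ⊆ V) (hS : S ⊆ Z) {k : ℕ} (hk : #S ≤ k) :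
    #{A ∈ powersetCard k V | A ∩ Z = S} = (#V - #Z).choose (k - #S) := by
  rw [← card_sdiff_of_subset hZ, ← card_powersetCard]
  refine card_bij' (fun A _ => A \ Z) (fun B _ => B ∪ S) ?_ ?_ ?_ ?_
  · intro A hA
    simp only [mem_filter, mem_powersetCard] at hA ⊢
    obtain ⟨⟨hAV, hAk⟩, hAS⟩ := hA
    refine ⟨sdiff_subset_sdiff hAV le_rfl, ?_⟩
    have := card_sdiff_add_card_inter A Z
    rw [hAS] at this
    omega
  · intro B hB
    simp only [mem_filter, mem_powersetCard] at hB ⊢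
    obtain ⟨hBV, hBk⟩ := hB
    have hd : Disjoint B Z := disjoint_left.2 fun a ha => (mem_sdiff.1 (hBV ha)).2
    refine ⟨⟨union_subset (hBV.trans sdiff_subset) (hS.trans hZ), ?_⟩, ?_⟩
    · rw [card_union_of_disjoint (hd.mono_right hS)]; omega
    · rw [union_inter_distrib_right, disjoint_iff_inter_eq_empty.1 hd, empty_union,
        inter_eq_left.2 hS]
  · intro A hA
    simp only [mem_filter] at hA
    rw [← hA.2]; exact sdiff_union_inter A Z
  · intro B hB
    simp only [mem_powersetCard] at hB
    have hd : Disjoint B Z := disjoint_left.2 fun a ha => (mem_sdiff.1 (hB.1 ha)).2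
    ext a
    have h1 : a ∈ B → a ∉ Z := fun h => disjoint_left.1 hd h
    have h2 : a ∈ S → a ∈ Z := fun h => hS h
    simp only [mem_sdiff, mem_union]
    tauto

theorem card_filter_inter_mem {V Z : Finset ℕ} (hZ : Z ⊆ V) {k : ℕ} (S : Finset (Finset ℕ))
    (hS : S ⊆ Z.powerset) (hk : ∀ T ∈ S, #T ≤ k) :
    #{A ∈ powersetCard k V | A ∩ Z ∈ S} = ∑ T ∈ S, (#V - #Z).choose (k - #T) := by
  rw [card_eq_sum_card_fiberwise (f := fun A => A ∩ Z) (t := S)]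
  · refine sum_congr rfl fun T hT => ?_
    rw [← card_filter_inter_eq hZ (mem_powerset.1 (hS hT)) (hk T hT), filter_filter]
    congr 1
    ext A
    simp only [mem_filter]
    constructor
    · rintro ⟨h, _, h'⟩; exact ⟨h, h'⟩
    · rintro ⟨h, h'⟩; exact ⟨h, h' ▸ hT, h'⟩
  · intro A hA
    simpa using (mem_filter.1 hA).2

/-- An intersecting family of `2`-sets is a star or lies inside a triangle. -/
theorem star_or_triangle_of_intersecting {F : Finset (Finset ℕ)} (h2 : ∀ e ∈ F, #e = 2)
    (hF : ∀ e ∈ F, ∀ f ∈ F, (e ∩ f).Nonempty) :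
    (∃ u, ∀ e ∈ F, u ∈ e) ∨ ∃ T : Finset ℕ, #T = 3 ∧ ∀ e ∈ F, e ⊆ T := by
  by_cases hne : F.Nonempty
  swap
  · exact Or.inl ⟨0, fun e he => absurd ⟨e, he⟩ hne⟩
  obtain ⟨e, he⟩ := hne
  obtain ⟨a, b, hab, rfl⟩ := card_eq_two.1 (h2 e he)
  by_cases ha : ∀ f ∈ F, a ∈ f
  · exact Or.inl ⟨a, ha⟩
  by_cases hb : ∀ f ∈ F, b ∈ f
  · exact Or.inl ⟨b, hb⟩
  right
  push Not at ha hb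
  obtain ⟨f, hf, haf⟩ := ha
  obtain ⟨g, hg, hbg⟩ := hb
  have hbf : b ∈ f := by
    obtain ⟨y, hy⟩ := hF _ he f hf
    simp only [mem_inter, mem_insert, mem_singleton] at hy
    rcases hy with ⟨rfl | rfl, h⟩
    · exact absurd h haf
    · exact h
  obtain ⟨c, hc⟩ := hF f hf g hg
  rw [mem_inter] at hc
  have hbc : b ≠ c := fun h => hbg (h ▸ hc.2)
  have hac : a ≠ c := fun h => haf (h ▸ hc.1)
  have hag : a ∈ g := by
    obtain ⟨y, hy⟩ := hF _ he g hg
    simp only [mem_inter, mem_insert, mem_singleton] at hy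
    rcases hy with ⟨rfl | rfl, h⟩
    · exact h
    · exact absurd h hbg
  have hfe : f = {b, c} := by
    refine (eq_of_subset_of_card_le ?_ ?_).symm
    · intro y hy; simp only [mem_insert, mem_singleton] at hy; rcases hy with rfl | rfl
      exacts [hbf, hc.1]
    · rw [h2 f hf, card_pair hbc]
  have hge : g = {a, c} := by
    refine (eq_of_subset_of_card_le ?_ ?_).symm
    · intro y hy; simp only [mem_insert, mem_singleton] at hy; rcases hy with rfl | rfl
      exacts [hag, hc.2]
    · rw [h2 g hg, card_pair hac]
  refine ⟨{a, b, c}, by rw [card_eq_three]; exact ⟨a, b, c, hab, hac, hbc, rfl⟩, ?_⟩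
  intro h hh
  obtain ⟨x, y, hxy, rfl⟩ := card_eq_two.1 (h2 h hh)
  have h1 := hF _ hh _ he
  have h3 := hF _ hh _ hf
  have h4 := hF _ hh _ hg
  rw [hfe] at h3
  rw [hge] at h4
  simp only [Finset.Nonempty, mem_inter, mem_insert, mem_singleton] at h1 h3 h4
  intro z hz
  simp only [mem_insert, mem_singleton] at hz ⊢
  grind

theorem subset_union_of_meet_disjoint {e f h : Finset ℕ} (hef : Disjoint e f) (hh : #h = 2)
    (he : (h ∩ e).Nonempty) (hf : (h ∩ f).Nonempty) : h ⊆ e ∪ f := by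
  have h1 : #(h ∩ e) + #(h ∩ f) = #(h ∩ (e ∪ f)) := by
    rw [inter_union_distrib_left, card_union_of_disjoint]
    exact hef.mono inter_subset_right inter_subset_right
  have h2 := he.card_pos
  have h3 := hf.card_pos
  exact inter_eq_left.1 (eq_of_subset_of_card_le inter_subset_left (by omega))

theorem card_add_card_le_six_of_cross {A B : Finset (Finset ℕ)} {Q : Finset ℕ} (hQ : #Q = 4)
    (hA : A ⊆ powersetCard 2 Q) (hB : B ⊆ powersetCard 2 Q)
    (hAB : ∀ e ∈ A, ∀ f ∈ B, (e ∩ f).Nonempty) : #A + #B ≤ 6 := by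
  have hinj : Set.InjOn (fun f : Finset ℕ => Q \ f) B := by
    intro f hf g hg h
    have h' : Q \ f = Q \ g := h
    rw [← Finset.sdiff_sdiff_eq_self (mem_powersetCard.1 (hB hf)).1, h',
      Finset.sdiff_sdiff_eq_self (mem_powersetCard.1 (hB hg)).1]
  have hd : Disjoint A (B.image fun f => Q \ f) := by
    rw [disjoint_left]
    intro e he he'
    obtain ⟨f, hf, rfl⟩ := mem_image.1 he'
    obtain ⟨y, hy⟩ := hAB _ he f hf
    simp at hy
  rw [← card_image_of_injOn hinj, ← card_union_of_disjoint hd]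
  have : #(powersetCard 2 Q) = 6 := by rw [card_powersetCard, hQ]; rfl
  rw [← this]
  refine card_le_card (union_subset hA ?_)
  intro e he
  obtain ⟨f, hf, rfl⟩ := mem_image.1 he
  have := mem_powersetCard.1 (hB hf)
  exact mem_powersetCard.2 ⟨sdiff_subset, by rw [card_sdiff_of_subset this.1]; omega⟩

/-- Cross-intersecting families of `2`-sets, one of which has two disjoint members. -/
theorem card_add_card_le_six_of_disjoint {A B : Finset (Finset ℕ)} (hA2 : ∀ e ∈ A, #e = 2)
    (hB2 : ∀ e ∈ B, #e = 2) (hAB : ∀ e ∈ A, ∀ f ∈ B, (e ∩ f).Nonempty) (hA : 3 ≤ #A)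
    {e f : Finset ℕ} (he : e ∈ B) (hf : f ∈ B) (hef : Disjoint e f) : #A + #B ≤ 6 := by
  have hAQ : ∀ h ∈ A, h ⊆ e ∪ f := fun h hh =>
    subset_union_of_meet_disjoint hef (hA2 h hh) (hAB h hh e he) (hAB h hh f hf)
  have hQ : #(e ∪ f) = 4 := by rw [card_union_of_disjoint hef, hB2 e he, hB2 f hf]
  have hex : ∃ e' ∈ A, ∃ f' ∈ A, Disjoint e' f' := by
    by_contra hno
    push Not at hno
    obtain ⟨a, b, hab, rfl⟩ := card_eq_two.1 (hB2 e he)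
    obtain ⟨c, d, hcd, rfl⟩ := card_eq_two.1 (hB2 f hf)
    have hdis : a ≠ c ∧ a ≠ d ∧ b ≠ c ∧ b ≠ d := by
      rw [disjoint_left] at hef
      simp only [mem_insert, mem_singleton] at hef
      grind
    obtain ⟨hac, had, hbc, hbd⟩ := hdis
    have hsub : A ⊆ {{a, c}, {a, d}, {b, c}, {b, d}} := by
      intro h hh
      have h1 := hAB h hh _ he
      have h2 := hAB h hh _ hf
      have h3 := hA2 h hh
      obtain ⟨x, hx⟩ := h1
      obtain ⟨y, hy⟩ := h2
      simp only [mem_inter, mem_insert, mem_singleton] at hx hy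
      have hxy : x ≠ y := by grind
      have : h = {x, y} := by
        refine (eq_of_subset_of_card_le ?_ ?_).symm
        · intro z hz; simp only [mem_insert, mem_singleton] at hz; rcases hz with rfl | rfl
          exacts [hx.1, hy.1]
        · rw [h3, card_pair hxy]
      subst this
      simp only [mem_insert, mem_singleton]
      rcases hx.2 with rfl | rfl <;> rcases hy.2 with rfl | rfl <;> simp
    have d1 : Disjoint ({a, c} : Finset ℕ) {b, d} := by
      rw [disjoint_left]; simp only [mem_insert, mem_singleton]; grind
    have d2 : Disjoint ({a, d} : Finset ℕ) {b, c} := by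
      rw [disjoint_left]; simp only [mem_insert, mem_singleton]; grind
    have n1 : ({a, c} : Finset ℕ) ∉ A ∨ ({b, d} : Finset ℕ) ∉ A := by
      by_contra h; push Not at h; exact hno _ h.1 _ h.2 d1
    have n2 : ({a, d} : Finset ℕ) ∉ A ∨ ({b, c} : Finset ℕ) ∉ A := by
      by_contra h; push Not at h; exact hno _ h.1 _ h.2 d2
    have : ∃ p q : Finset ℕ, A ⊆ {p, q} := by
      rcases n1 with n1 | n1 <;> rcases n2 with n2 | n2
      · refine ⟨{b, d}, {b, c}, fun h hh => ?_⟩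
        have := hsub hh
        simp only [mem_insert, mem_singleton] at this ⊢
        rcases this with rfl | rfl | rfl | rfl <;> simp_all
      · refine ⟨{b, d}, {a, d}, fun h hh => ?_⟩
        have := hsub hh
        simp only [mem_insert, mem_singleton] at this ⊢
        rcases this with rfl | rfl | rfl | rfl <;> simp_all
      · refine ⟨{a, c}, {b, c}, fun h hh => ?_⟩
        have := hsub hh
        simp only [mem_insert, mem_singleton] at this ⊢
        rcases this with rfl | rfl | rfl | rfl <;> simp_all
      · refine ⟨{a, c}, {a, d}, fun h hh => ?_⟩
        have := hsub hh
        simp only [mem_insert, mem_singleton] at this ⊢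
        rcases this with rfl | rfl | rfl | rfl <;> simp_all
    obtain ⟨p, q, hpq⟩ := this
    have := (card_le_card hpq).trans card_le_two
    omega
  obtain ⟨e', he', f', hf', hd⟩ := hex
  have hQ' : e' ∪ f' = e ∪ f := by
    refine eq_of_subset_of_card_le (union_subset (hAQ _ he') (hAQ _ hf')) ?_
    rw [hQ, card_union_of_disjoint hd, hA2 e' he', hA2 f' hf']
  refine card_add_card_le_six_of_cross hQ (fun h hh => mem_powersetCard.2 ⟨hAQ h hh, hA2 h hh⟩)
    (fun h hh => mem_powersetCard.2 ⟨?_, hB2 h hh⟩) hAB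
  rw [← hQ']
  refine subset_union_of_meet_disjoint hd (hB2 h hh) ?_ ?_
  · rw [inter_comm]; exact hAB _ he' _ hh
  · rw [inter_comm]; exact hAB _ hf' _ hh

theorem mem_of_meet_star {B : Finset (Finset ℕ)} {u : ℕ} (hB2 : ∀ e ∈ B, #e = 2)
    (hB : 3 ≤ #B) (hu : ∀ e ∈ B, u ∈ e) {h : Finset ℕ} (hh : #h = 2)
    (hhB : ∀ e ∈ B, (h ∩ e).Nonempty) : u ∈ h := by
  by_contra hn
  have : B ⊆ h.image fun y => ({u, y} : Finset ℕ) := by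
    intro e he
    obtain ⟨y, hy⟩ := hhB e he
    rw [mem_inter] at hy
    refine mem_image.2 ⟨y, hy.1, eq_of_subset_of_card_le ?_ ?_⟩
    · intro z hz; simp only [mem_insert, mem_singleton] at hz; rcases hz with rfl | rfl
      exacts [hu e he, hy.2]
    · rw [hB2 e he, card_pair (by rintro rfl; exact hn hy.1)]
  have := (card_le_card this).trans card_image_le
  omega

theorem subset_of_meet_triangle {B : Finset (Finset ℕ)} {T : Finset ℕ} (hB2 : ∀ e ∈ B, #e = 2)
    (hB : 3 ≤ #B) (hT : #T = 3) (hBT : ∀ e ∈ B, e ⊆ T) {h : Finset ℕ} (hh : #h = 2)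
    (hhB : ∀ e ∈ B, (h ∩ e).Nonempty) : h ⊆ T := by
  have hsub : B ⊆ powersetCard 2 T := fun e he => mem_powersetCard.2 ⟨hBT e he, hB2 e he⟩
  have heq : B = powersetCard 2 T := eq_of_subset_of_card_le hsub (by
    rw [card_powersetCard, hT]; exact hB)
  by_contra hn
  have h1 : #(h ∩ T) ≤ 1 := by
    by_contra hlt
    exact hn (inter_eq_left.1 (eq_of_subset_of_card_le inter_subset_left (by omega)))
  have h2 : 2 ≤ #(T \ h) := by
    have := card_sdiff_add_card_inter T h
    rw [inter_comm] at h1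
    omega
  obtain ⟨e, heT, he⟩ := exists_subset_card_eq h2
  obtain ⟨y, hy⟩ := hhB e (heq ▸ mem_powersetCard.2 ⟨heT.trans sdiff_subset, he⟩)
  rw [mem_inter] at hy
  exact (mem_sdiff.1 (heT hy.2)).2 hy.1

theorem card_le_three_of_subset_triangle {B : Finset (Finset ℕ)} {T : Finset ℕ}
    (hB2 : ∀ e ∈ B, #e = 2) (hT : #T = 3) (hBT : ∀ e ∈ B, e ⊆ T) : #B ≤ 3 := by
  have hsub : B ⊆ powersetCard 2 T := fun e he => mem_powersetCard.2 ⟨hBT e he, hB2 e he⟩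
  simpa [card_powersetCard, hT] using card_le_card hsub

theorem card_add_card_le_six_or_star {A B : Finset (Finset ℕ)} (hA2 : ∀ e ∈ A, #e = 2)
    (hB2 : ∀ e ∈ B, #e = 2) (hAB : ∀ e ∈ A, ∀ f ∈ B, (e ∩ f).Nonempty) (hA : 3 ≤ #A)
    (hB : 3 ≤ #B) : #A + #B ≤ 6 ∨ ∃ u, (∀ e ∈ A, u ∈ e) ∧ ∀ e ∈ B, u ∈ e := by
  by_cases hd : ∃ e ∈ B, ∃ f ∈ B, Disjoint e f
  · obtain ⟨e, he, f, hf, hef⟩ := hd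
    exact Or.inl (card_add_card_le_six_of_disjoint hA2 hB2 hAB hA he hf hef)
  push Not at hd
  have hBi : ∀ e ∈ B, ∀ f ∈ B, (e ∩ f).Nonempty := fun e he f hf =>
    not_disjoint_iff_nonempty_inter.1 (hd e he f hf)
  rcases star_or_triangle_of_intersecting hB2 hBi with ⟨u, hu⟩ | ⟨T, hT, hBT⟩
  · exact Or.inr ⟨u, fun e he => mem_of_meet_star hB2 hB hu (hA2 e he) (hAB e he), hu⟩
  · left
    have h1 := card_le_three_of_subset_triangle hB2 hT hBT
    have h2 := card_le_three_of_subset_triangle hA2 hT fun e he =>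
      subset_of_meet_triangle hB2 hB hT hBT (hA2 e he) (hAB e he)
    omega

/-- The members of `F` containing `a` but not `b`, with `a` removed. -/
def halfLink (F : Finset (Finset ℕ)) (a b : ℕ) : Finset (Finset ℕ) :=
  {A ∈ F | a ∈ A ∧ b ∉ A}.image fun A => A.erase a

theorem card_halfLink (F : Finset (Finset ℕ)) (a b : ℕ) :
    #(halfLink F a b) = #{A ∈ F | a ∈ A ∧ b ∉ A} := by
  refine card_image_of_injOn ?_
  intro A hA B hB h
  have hA' := (mem_filter.1 hA).2.1
  have hB' := (mem_filter.1 hB).2.1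
  have h' : A.erase a = B.erase a := h
  rw [← insert_erase hA', ← insert_erase hB', h']

theorem mem_halfLink {F : Finset (Finset ℕ)} {a b : ℕ} {e : Finset ℕ} :
    e ∈ halfLink F a b ↔ ∃ A ∈ F, a ∈ A ∧ b ∉ A ∧ A.erase a = e := by
  simp only [halfLink, mem_image, mem_filter, and_assoc]

theorem halfLink_cross {F : Finset (Finset ℕ)} {a b : ℕ}
    (hF : ∀ A ∈ F, ∀ B ∈ F, (A ∩ B).Nonempty) :
    ∀ e ∈ halfLink F a b, ∀ f ∈ halfLink F b a, (e ∩ f).Nonempty := by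
  intro e he f hf
  obtain ⟨A, hA, haA, hbA, rfl⟩ := mem_halfLink.1 he
  obtain ⟨B, hB, hbB, haB, rfl⟩ := mem_halfLink.1 hf
  obtain ⟨y, hy⟩ := hF A hA B hB
  rw [mem_inter] at hy
  refine ⟨y, ?_⟩
  simp only [mem_inter, mem_erase]
  exact ⟨⟨fun h => haB (h ▸ hy.2), hy.1⟩, fun h => hbA (h ▸ hy.1), hy.2⟩

theorem card_eq_of_halfLink {F : Finset (Finset ℕ)} {a b k : ℕ} (hF : ∀ A ∈ F, #A = k + 1) :
    ∀ e ∈ halfLink F a b, #e = k := by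
  intro e he
  obtain ⟨A, hA, haA, hbA, rfl⟩ := mem_halfLink.1 he
  rw [card_erase_of_mem haA, hF A hA, Nat.add_sub_cancel]

theorem card_eq_pair_split (F : Finset (Finset ℕ)) (a b : ℕ) :
    #F = #{A ∈ F | a ∈ A ∧ b ∈ A} + #{A ∈ F | a ∉ A ∧ b ∉ A} + #(halfLink F a b)
      + #(halfLink F b a) := by
  rw [card_halfLink, card_halfLink]
  have h1 := card_filter_add_card_filter_not (s := F) (fun A => a ∈ A)
  have h2 := card_filter_add_card_filter_not (s := {A ∈ F | a ∈ A}) (fun A => b ∈ A)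
  have h3 := card_filter_add_card_filter_not (s := {A ∈ F | a ∉ A}) (fun A => b ∈ A)
  simp only [filter_filter] at h2 h3
  have h4 : #{A ∈ F | a ∉ A ∧ b ∈ A} = #{A ∈ F | b ∈ A ∧ a ∉ A} := by
    congr 1; ext A; simp only [mem_filter]; tauto
  omega

theorem card_filter_mem_halfLink_le (F : Finset (Finset ℕ)) (a b u : ℕ) :
    #{e ∈ halfLink F a b | u ∈ e} ≤ #{A ∈ F | (a ∈ A ∧ u ∈ A) ∧ b ∉ A} := by
  refine le_trans (card_le_card (t := {A ∈ F | (a ∈ A ∧ u ∈ A) ∧ b ∉ A}.image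
    fun A => A.erase a) ?_) card_image_le
  intro e he
  rw [mem_filter, mem_halfLink] at he
  obtain ⟨⟨A, hA, haA, hbA, rfl⟩, hu⟩ := he
  exact mem_image.2 ⟨A, mem_filter.2 ⟨hA, ⟨haA, mem_of_mem_erase hu⟩, hbA⟩, rfl⟩

/-- If every member of `F` meets `D` then `F` is no larger than the sum of the degrees in `D`. -/
theorem card_le_sum_degree {F : Finset (Finset ℕ)} {D : Finset ℕ}
    (h : ∀ A ∈ F, (A ∩ D).Nonempty) : #F ≤ ∑ w ∈ D, #{A ∈ F | w ∈ A} := by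
  refine le_trans (card_le_card (t := D.biUnion fun w => {A ∈ F | w ∈ A}) ?_) card_biUnion_le
  intro A hA
  obtain ⟨w, hw⟩ := h A hA
  rw [mem_inter] at hw
  exact mem_biUnion.2 ⟨w, hw.2, mem_filter.2 ⟨hA, hw.1⟩⟩

theorem card_le_five_of_meet_two {A : Finset (Finset ℕ)} (hA2 : ∀ e ∈ A, #e = 2) {e f : Finset ℕ}
    (he2 : #e = 2) (hf2 : #f = 2) (hef : e ≠ f) (he : ∀ h ∈ A, (h ∩ e).Nonempty)
    (hf : ∀ h ∈ A, (h ∩ f).Nonempty) (hdeg : ∀ u ∈ e, #{h ∈ A | u ∈ h} ≤ 3) : #A ≤ 5 := by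
  by_cases hd : Disjoint e f
  · have : A ⊆ (e ×ˢ f).image fun p => ({p.1, p.2} : Finset ℕ) := by
      intro h hh
      obtain ⟨x, hx⟩ := he h hh
      obtain ⟨y, hy⟩ := hf h hh
      rw [mem_inter] at hx hy
      refine mem_image.2 ⟨(x, y), mem_product.2 ⟨hx.2, hy.2⟩, eq_of_subset_of_card_le ?_ ?_⟩
      · intro z hz; simp only [mem_insert, mem_singleton] at hz; rcases hz with rfl | rfl
        exacts [hx.1, hy.1]
      · rw [hA2 h hh, card_pair]
        intro h
        have h' : x = y := h
        exact disjoint_left.1 hd hx.2 (h' ▸ hy.2)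
    have := (card_le_card this).trans card_image_le
    rw [card_product, he2, hf2] at this
    omega
  · obtain ⟨u, hu⟩ := not_disjoint_iff_nonempty_inter.1 hd
    rw [mem_inter] at hu
    have h1 := hdeg u hu.1
    have h2 : #{h ∈ A | u ∉ h} ≤ 1 := by
      rw [card_le_one]
      have key : ∀ h ∈ {h ∈ A | u ∉ h}, h = (e ∪ f).erase u := by
        intro h hh
        rw [mem_filter] at hh
        obtain ⟨x, hx⟩ := he h hh.1
        obtain ⟨y, hy⟩ := hf h hh.1
        rw [mem_inter] at hx hy
        have hux : u ≠ x := by rintro rfl; exact hh.2 hx.1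
        have huy : u ≠ y := by rintro rfl; exact hh.2 hy.1
        have he' : e = {u, x} := by
          refine (eq_of_subset_of_card_le ?_ ?_).symm
          · intro z hz; simp only [mem_insert, mem_singleton] at hz; rcases hz with rfl | rfl
            exacts [hu.1, hx.2]
          · rw [he2, card_pair hux]
        have hf' : f = {u, y} := by
          refine (eq_of_subset_of_card_le ?_ ?_).symm
          · intro z hz; simp only [mem_insert, mem_singleton] at hz; rcases hz with rfl | rfl
            exacts [hu.2, hy.2]
          · rw [hf2, card_pair huy]
        have hxy : x ≠ y := by rintro rfl; exact hef (he'.trans hf'.symm)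
        have hh' : h = {x, y} := by
          refine (eq_of_subset_of_card_le ?_ ?_).symm
          · intro z hz; simp only [mem_insert, mem_singleton] at hz; rcases hz with rfl | rfl
            exacts [hx.1, hy.1]
          · rw [hA2 h hh.1, card_pair hxy]
        rw [hh', he', hf']
        ext z
        simp only [mem_insert, mem_singleton, mem_erase, mem_union]
        grind
      intro h hh h' hh'
      rw [key h hh, key h' hh']
    have := card_filter_add_card_filter_not (s := A) (fun h => u ∈ h)
    omega

theorem card_add_card_le_seven {A B : Finset (Finset ℕ)} (hA2 : ∀ e ∈ A, #e = 2)
    (hB2 : ∀ e ∈ B, #e = 2) (hAB : ∀ e ∈ A, ∀ f ∈ B, (e ∩ f).Nonempty) (hA : #A ≤ 6)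
    (hB : #B ≤ 6) (hdA : ∀ e ∈ B, ∀ u ∈ e, #{h ∈ A | u ∈ h} ≤ 3)
    (hdB : ∀ e ∈ A, ∀ u ∈ e, #{h ∈ B | u ∈ h} ≤ 3) : #A + #B ≤ 7 := by
  have hBA : ∀ e ∈ B, ∀ f ∈ A, (e ∩ f).Nonempty := fun e he f hf => by
    rw [inter_comm]; exact hAB f hf e he
  have two : ∀ A B : Finset (Finset ℕ), (∀ e ∈ A, #e = 2) → (∀ e ∈ B, #e = 2) →
      (∀ e ∈ A, ∀ f ∈ B, (e ∩ f).Nonempty) → (∀ e ∈ B, ∀ u ∈ e, #{h ∈ A | u ∈ h} ≤ 3) →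
      2 ≤ #B → #A ≤ 5 := by
    intro A B hA2 hB2 hAB hdA h
    obtain ⟨e, he, f, hf, hef⟩ := one_lt_card.1 h
    exact card_le_five_of_meet_two hA2 (hB2 e he) (hB2 f hf) hef (fun h hh => hAB h hh e he)
      (fun h hh => hAB h hh f hf) (hdA e he)
  by_cases h1 : #A ≤ 1
  · omega
  by_cases h2 : #B ≤ 1
  · omega
  have h3 := two A B hA2 hB2 hAB hdA (by omega)
  have h4 := two B A hB2 hA2 hBA hdB (by omega)
  by_cases h5 : #A ≤ 2
  · omega
  by_cases h6 : #B ≤ 2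
  · omega
  rcases card_add_card_le_six_or_star hA2 hB2 hAB (by omega) (by omega) with h | ⟨u, hu, hu'⟩
  · omega
  · obtain ⟨e, he⟩ : A.Nonempty := card_pos.1 (by omega)
    obtain ⟨f, hf⟩ : B.Nonempty := card_pos.1 (by omega)
    have h7 := hdA f hf u (hu' f hf)
    have h8 := hdB e he u (hu e he)
    rw [filter_true_of_mem hu] at h7
    rw [filter_true_of_mem hu'] at h8
    omega

theorem card_add_three_le_of_pair_cover {V : Finset ℕ} {F : Finset (Finset ℕ)} (hn : 7 ≤ #V)
    (hF : F ⊆ powersetCard 3 V) (hint : ∀ A ∈ F, ∀ B ∈ F, (A ∩ B).Nonempty)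
    (hdiv : ∀ x ∈ V, 3 ≤ #{A ∈ F | x ∉ A})
    (hG : ¬ ∃ T ⊆ V, #T = 3 ∧ ∀ A ∈ F, 2 ≤ #(A ∩ T)) {c l : ℕ} (hc : c ∈ V) (hl : l ∈ V)
    (hcl : c ≠ l) (hcov : ∀ A ∈ F, c ∈ A ∨ l ∈ A) : #F + 3 ≤ 2 * #V := by
  have hs := card_eq_pair_split F c l
  have hF3 : ∀ A ∈ F, #A = 2 + 1 := fun A hA => (mem_powersetCard.1 (hF hA)).2
  have h0 : #{A ∈ F | c ∉ A ∧ l ∉ A} = 0 := by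
    rw [card_eq_zero, filter_eq_empty_iff]
    intro A hA h
    have := hcov A hA
    tauto
  have hA : 3 ≤ #(halfLink F c l) := by
    rw [card_halfLink]
    refine (hdiv l hl).trans (card_le_card fun A hA => ?_)
    rw [mem_filter] at hA ⊢
    have := hcov A hA.1
    tauto
  have hB : 3 ≤ #(halfLink F l c) := by
    rw [card_halfLink]
    refine (hdiv c hc).trans (card_le_card fun A hA => ?_)
    rw [mem_filter] at hA ⊢
    have := hcov A hA.1
    tauto
  have hboth : #{A ∈ F | c ∈ A ∧ l ∈ A} ≤ #V - 2 := by
    have hZ : ({c, l} : Finset ℕ) ⊆ V := by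
      intro z hz; simp only [mem_insert, mem_singleton] at hz; rcases hz with rfl | rfl
      exacts [hc, hl]
    have := card_filter_inter_eq (k := 3) hZ (subset_refl _) (by rw [card_pair hcl]; omega)
    rw [card_pair hcl, Nat.choose_one_right] at this
    rw [← this]
    refine card_le_card fun A hA => ?_
    rw [mem_filter] at hA ⊢
    refine ⟨hF hA.1, inter_eq_right.2 ?_⟩
    intro z hz; simp only [mem_insert, mem_singleton] at hz; rcases hz with rfl | rfl
    exacts [hA.2.1, hA.2.2]
  rcases card_add_card_le_six_or_star (card_eq_of_halfLink hF3) (card_eq_of_halfLink hF3)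
    (halfLink_cross hint) hA hB with h | ⟨u, hu, hu'⟩
  · omega
  · exfalso
    obtain ⟨e, he⟩ : (halfLink F c l).Nonempty := card_pos.1 (by omega)
    have hue := hu e he
    obtain ⟨A, hA, hcA, hlA, rfl⟩ := mem_halfLink.1 he
    rw [mem_erase] at hue
    have huV : u ∈ V := (mem_powersetCard.1 (hF hA)).1 hue.2
    have hul : u ≠ l := by rintro rfl; exact hlA hue.2
    refine hG ⟨{c, l, u}, ?_, ?_, ?_⟩
    · intro z hz; simp only [mem_insert, mem_singleton] at hz; rcases hz with rfl | rfl | rfl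
      exacts [hc, hl, huV]
    · rw [card_eq_three]; exact ⟨c, l, u, hcl, hue.1.symm, hul.symm, rfl⟩
    · intro B hB
      have pair : ∀ p q : ℕ, p ≠ q → p ∈ B → q ∈ B → p ∈ ({c, l, u} : Finset ℕ) →
          q ∈ ({c, l, u} : Finset ℕ) → 2 ≤ #(B ∩ {c, l, u}) := by
        intro p q hpq hp hq hp' hq'
        exact one_lt_card.2 ⟨p, mem_inter.2 ⟨hp, hp'⟩, q, mem_inter.2 ⟨hq, hq'⟩, hpq⟩
      by_cases hcB : c ∈ B <;> by_cases hlB : l ∈ B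
      · exact pair c l hcl hcB hlB (by simp) (by simp)
      · have := hu _ (mem_halfLink.2 ⟨B, hB, hcB, hlB, rfl⟩)
        rw [mem_erase] at this
        exact pair c u hue.1.symm hcB this.2 (by simp) (by simp)
      · have := hu' _ (mem_halfLink.2 ⟨B, hB, hlB, hcB, rfl⟩)
        rw [mem_erase] at this
        exact pair l u hul.symm hlB this.2 (by simp) (by simp)
      · have := hcov B hB
        tauto

theorem card_le_eleven_of_no_pair_cover {V : Finset ℕ} {F : Finset (Finset ℕ)}
    (hF : F ⊆ powersetCard 3 V) (hint : ∀ A ∈ F, ∀ B ∈ F, (A ∩ B).Nonempty)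
    (hcov : ∀ c ∈ V, ∀ l ∈ V, c ≠ l → ∃ A ∈ F, c ∉ A ∧ l ∉ A) : #F ≤ 11 := by
  by_cases hne : F.Nonempty
  swap
  · rw [not_nonempty_iff_eq_empty.1 hne]; simp
  have hF3 : ∀ A ∈ F, #A = 2 + 1 := fun A hA => (mem_powersetCard.1 (hF hA)).2
  have hFV : ∀ A ∈ F, A ⊆ V := fun A hA => (mem_powersetCard.1 (hF hA)).1
  set d : ℕ → ℕ → ℕ := fun x y => #{A ∈ F | x ∈ A ∧ y ∈ A} with hd
  have triple : ∀ A ∈ F, ∀ x ∈ A, ∀ y ∈ A, ∀ z ∈ A, x ≠ y → x ≠ z → y ≠ z → A = {x, y, z} := by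
    intro A hA x hx y hy z hz hxy hxz hyz
    refine (eq_of_subset_of_card_le ?_ ?_).symm
    · intro w hw; simp only [mem_insert, mem_singleton] at hw; rcases hw with rfl | rfl | rfl
      exacts [hx, hy, hz]
    · rw [hF3 A hA, card_eq_three.2 ⟨x, y, z, hxy, hxz, hyz, rfl⟩]
  have hd3 : ∀ x ∈ V, ∀ y ∈ V, x ≠ y → d x y ≤ 3 := by
    intro x hx y hy hxy
    obtain ⟨D, hD, hxD, hyD⟩ := hcov x hx y hy hxy
    have : {A ∈ F | x ∈ A ∧ y ∈ A} ⊆ D.image fun z => ({x, y, z} : Finset ℕ) := by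
      intro A hA
      rw [mem_filter] at hA
      obtain ⟨z, hz⟩ := hint A hA.1 D hD
      rw [mem_inter] at hz
      refine mem_image.2 ⟨z, hz.2, (triple A hA.1 x hA.2.1 y hA.2.2 z hz.1 hxy ?_ ?_).symm⟩
      · rintro rfl; exact hxD hz.2
      · rintro rfl; exact hyD hz.2
    have := (card_le_card this).trans card_image_le
    rwa [hF3 D hD] at this
  obtain ⟨A₀, hA₀⟩ := hne
  have hoff : V.offDiag.Nonempty := by
    obtain ⟨x, hx, y, hy, hxy⟩ := one_lt_card.1 (show 1 < #A₀ by rw [hF3 A₀ hA₀]; omega)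
    exact ⟨(x, y), mem_offDiag.2 ⟨hFV _ hA₀ hx, hFV _ hA₀ hy, hxy⟩⟩
  obtain ⟨⟨a, b⟩, hab, hmax⟩ := exists_max_image V.offDiag (fun p => d p.1 p.2) hoff
  rw [mem_offDiag] at hab
  obtain ⟨haV, hbV, hab⟩ := hab
  have hmax' : ∀ x ∈ V, ∀ y ∈ V, x ≠ y → d x y ≤ d a b := fun x hx y hy hxy =>
    hmax (x, y) (mem_offDiag.2 ⟨hx, hy, hxy⟩)
  have hdpos : 1 ≤ d a b := by
    obtain ⟨x, hx, y, hy, hxy⟩ := one_lt_card.1 (show 1 < #A₀ by rw [hF3 A₀ hA₀]; omega)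
    refine le_trans ?_ (hmax' x (hFV _ hA₀ hx) y (hFV _ hA₀ hy) hxy)
    exact card_pos.2 ⟨A₀, mem_filter.2 ⟨hA₀, hx, hy⟩⟩
  set Z : Finset ℕ := {z ∈ V | z ≠ a ∧ z ≠ b ∧ ({a, b, z} : Finset ℕ) ∈ F} with hZ
  have hZd : #Z = d a b := by
    refine card_bij (fun z _ => ({a, b, z} : Finset ℕ)) ?_ ?_ ?_
    · intro z hz
      rw [hZ, mem_filter] at hz
      exact mem_filter.2 ⟨hz.2.2.2, by simp, by simp⟩
    · intro z hz w hw h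
      rw [hZ, mem_filter] at hz hw
      have : z ∈ ({a, b, w} : Finset ℕ) := h ▸ (by simp)
      simp only [mem_insert, mem_singleton] at this
      tauto
    · intro A hA
      rw [mem_filter] at hA
      have : ((A.erase a).erase b).Nonempty := by
        rw [← card_pos, card_erase_of_mem (mem_erase.2 ⟨hab.symm, hA.2.2⟩),
          card_erase_of_mem hA.2.1, hF3 A hA.1]
        omega
      obtain ⟨z, hz⟩ := this
      simp only [mem_erase] at hz
      have := triple A hA.1 a hA.2.1 b hA.2.2 z hz.2.2 hab hz.2.1.symm hz.1.symm
      exact ⟨z, mem_filter.2 ⟨hFV A hA.1 hz.2.2, hz.2.1, hz.1, this ▸ hA.1⟩, this.symm⟩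
  have hZD : ∀ D ∈ {A ∈ F | a ∉ A ∧ b ∉ A}, Z ⊆ D := by
    intro D hD z hz
    rw [mem_filter] at hD hz
    obtain ⟨y, hy⟩ := hint _ hz.2.2.2 D hD.1
    simp only [mem_inter, mem_insert, mem_singleton] at hy
    rcases hy with ⟨rfl | rfl | rfl, h⟩
    · exact absurd h hD.2.1
    · exact absurd h hD.2.2
    · exact h
  have hZV : Z ⊆ V := filter_subset _ _
  have hab3 := hd3 a haV b hbV hab
  have hDcard : d a b + #{A ∈ F | a ∉ A ∧ b ∉ A} ≤ 4 := by
    have hcases : #Z = 1 ∨ #Z = 2 ∨ #Z = 3 := by omega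
    rcases hcases with h | h | h
    · obtain ⟨x, hx⟩ := card_eq_one.1 h
      have hxV : x ∈ V := hZV (hx ▸ mem_singleton_self x)
      have : ∃ y ∈ V, y ≠ x := by
        obtain rfl | h := eq_or_ne a x
        · exact ⟨b, hbV, hab.symm⟩
        · exact ⟨a, haV, h⟩
      obtain ⟨y, hyV, hyx⟩ := this
      obtain ⟨B, hB, hxB, -⟩ := hcov x hxV y hyV hyx.symm
      have h1 := card_le_sum_degree (F := {A ∈ F | a ∉ A ∧ b ∉ A}) (D := B)
        fun A hA => hint A (mem_filter.1 hA).1 B hB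
      have h2 : ∑ w ∈ B, #{A ∈ {A ∈ F | a ∉ A ∧ b ∉ A} | w ∈ A} ≤ ∑ w ∈ B, 1 := by
        refine sum_le_sum fun w hw => ?_
        have hxw : x ≠ w := by rintro rfl; exact hxB hw
        refine le_trans ?_ ((hmax' x hxV w (hFV B hB hw) hxw).trans (by omega))
        refine card_le_card fun A hA => ?_
        rw [mem_filter] at hA
        exact mem_filter.2 ⟨(mem_filter.1 hA.1).1, hZD A hA.1 (by simp [hx]), hA.2⟩
      rw [sum_const, hF3 B hB] at h2
      simp only [smul_eq_mul] at h2
      omega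
    · obtain ⟨x, y, hxy, hx⟩ := card_eq_two.1 h
      have : #{A ∈ F | a ∉ A ∧ b ∉ A} ≤ d x y := by
        refine card_le_card fun A hA => mem_filter.2 ⟨(mem_filter.1 hA).1, ?_, ?_⟩
        · exact hZD A hA (by simp [hx])
        · exact hZD A hA (by simp [hx])
      have := hmax' x (hZV (by simp [hx])) y (hZV (by simp [hx])) hxy
      omega
    · have : #{A ∈ F | a ∉ A ∧ b ∉ A} ≤ 1 := by
        rw [card_le_one]
        have key : ∀ D ∈ {A ∈ F | a ∉ A ∧ b ∉ A}, Z = D := fun D hD =>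
          eq_of_subset_of_card_le (hZD D hD) (by rw [hF3 D (mem_filter.1 hD).1, h])
        intro D hD D' hD'
        rw [← key D hD, ← key D' hD']
      omega
  obtain ⟨D, hD, haD, hbD⟩ := hcov a haV b hbV hab
  have hDZ := hZD D (mem_filter.2 ⟨hD, haD, hbD⟩)
  have hsix : ∀ p ∈ V, ∀ q ∈ V, p ≠ q → p ∉ D → q ∉ D →
      (∀ w ∈ Z, ({p, q, w} : Finset ℕ) ∈ F) → #(halfLink F p q) ≤ 6 := by
    intro p hp q hq hpq hpD hqD hw
    have h1 := card_le_sum_degree (F := halfLink F p q) (D := D) (by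
      intro e he
      obtain ⟨A, hA, hpA, hqA, rfl⟩ := mem_halfLink.1 he
      obtain ⟨y, hy⟩ := hint A hA D hD
      rw [mem_inter] at hy
      refine ⟨y, mem_inter.2 ⟨mem_erase.2 ⟨?_, hy.1⟩, hy.2⟩⟩
      rintro rfl
      exact hpD hy.2)
    have h2 : ∑ w ∈ D, #{e ∈ halfLink F p q | w ∈ e} ≤ ∑ w ∈ D, 2 := by
      refine sum_le_sum fun w hwD => ?_
      have hpw : p ≠ w := by rintro rfl; exact hpD hwD
      have hwV := hFV D hD hwD
      have e1 := card_filter_mem_halfLink_le F p q w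
      have e2 := card_filter_add_card_filter_not (s := {A ∈ F | p ∈ A ∧ w ∈ A}) (fun A => q ∈ A)
      simp only [filter_filter] at e2
      by_cases hwZ : w ∈ Z
      · have e3 : 1 ≤ #{A ∈ F | (p ∈ A ∧ w ∈ A) ∧ q ∈ A} :=
          card_pos.2 ⟨{p, q, w}, mem_filter.2 ⟨hw w hwZ, by simp⟩⟩
        have e4 := hd3 p hp w hwV hpw
        simp only [hd] at e4
        omega
      · have e3 : #Z < #D := card_lt_card ⟨hDZ, fun h => hwZ (h hwD)⟩
        rw [hF3 D hD] at e3
        have e4 := hmax' p hp w hwV hpw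
        simp only [hd] at e4 hZd
        omega
    rw [sum_const, hF3 D hD] at h2
    simp only [smul_eq_mul] at h2
    omega
  have hdeg : ∀ p ∈ V, ∀ q, ∀ e ∈ halfLink F q p, ∀ u ∈ e, #{h ∈ halfLink F p q | u ∈ h} ≤ 3 := by
    intro p hp q e he u hu
    obtain ⟨A, hA, hqA, hpA, rfl⟩ := mem_halfLink.1 he
    have huA := mem_of_mem_erase hu
    have hpu : p ≠ u := by rintro rfl; exact hpA huA
    refine (card_filter_mem_halfLink_le F p q u).trans (le_trans (card_le_card ?_)
      (hd3 p hp u (hFV A hA huA) hpu))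
    intro B hB
    rw [mem_filter] at hB ⊢
    exact ⟨hB.1, hB.2.1⟩
  have h7 := card_add_card_le_seven (card_eq_of_halfLink hF3) (card_eq_of_halfLink hF3)
    (halfLink_cross hint) (hsix a haV b hbV hab haD hbD fun w hw => (mem_filter.1 hw).2.2.2)
    (hsix b hbV a haV hab.symm hbD haD fun w hw => by
      rw [insert_comm]; exact (mem_filter.1 hw).2.2.2)
    (hdeg a haV b) (hdeg b hbV a)
  have hs := card_eq_pair_split F a b
  simp only [hd] at hDcard
  omega

theorem card_add_three_le_of_three_uniform {V : Finset ℕ} {F : Finset (Finset ℕ)} (hn : 7 ≤ #V)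
    (hF : F ⊆ powersetCard 3 V) (hint : ∀ A ∈ F, ∀ B ∈ F, (A ∩ B).Nonempty)
    (hdiv : ∀ x ∈ V, 3 ≤ #{A ∈ F | x ∉ A})
    (hG : ¬ ∃ T ⊆ V, #T = 3 ∧ ∀ A ∈ F, 2 ≤ #(A ∩ T)) : #F + 3 ≤ 2 * #V := by
  by_cases h : ∃ c ∈ V, ∃ l ∈ V, c ≠ l ∧ ∀ A ∈ F, c ∈ A ∨ l ∈ A
  · obtain ⟨c, hc, l, hl, hcl, hcov⟩ := h
    exact card_add_three_le_of_pair_cover hn hF hint hdiv hG hc hl hcl hcov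
  · push Not at h
    have := card_le_eleven_of_no_pair_cover hF hint h
    omega

/-- The shift of a family replacing `j` by `i`. -/
def shift (i j : ℕ) (F : Finset (Finset ℕ)) : Finset (Finset ℕ) :=
  UV.compression {i} {j} F

theorem compress_of_mem {i j : ℕ} {A : Finset ℕ} (hi : i ∉ A) (hj : j ∈ A) :
    UV.compress {i} {j} A = insert i (A.erase j) := by
  have hij : i ≠ j := by rintro rfl; exact hi hj
  rw [UV.compress, if_pos ⟨by simpa using hi, by simpa using hj⟩]
  ext x
  simp only [sup_eq_union, mem_sdiff, mem_union, mem_singleton, mem_insert, mem_erase]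
  grind

theorem compress_of_not {i j : ℕ} {A : Finset ℕ} (h : ¬ (i ∉ A ∧ j ∈ A)) :
    UV.compress {i} {j} A = A := by
  rw [UV.compress, if_neg]
  simpa using h

theorem mem_shift_of_iff {i j : ℕ} {F : Finset (Finset ℕ)} {A : Finset ℕ}
    (h : i ∈ A ↔ j ∈ A) : A ∈ shift i j F ↔ A ∈ F := by
  rw [shift, UV.mem_compression, compress_of_not (by tauto)]
  constructor
  · rintro (⟨h, _⟩ | ⟨_, B, hB, hBA⟩)
    · exact h
    · by_cases hc : i ∉ B ∧ j ∈ B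
      · rw [compress_of_mem hc.1 hc.2] at hBA
        subst hBA
        have : i ≠ j := by rintro rfl; exact hc.1 hc.2
        simp [this.symm] at h
      · rw [compress_of_not hc] at hBA
        exact hBA ▸ hB
  · exact fun h => Or.inl ⟨h, h⟩

theorem mem_shift_left {i j : ℕ} {F : Finset (Finset ℕ)} {A : Finset ℕ} (hi : i ∈ A)
    (hj : j ∉ A) : A ∈ shift i j F ↔ A ∈ F ∨ insert j (A.erase i) ∈ F := by
  have hij : i ≠ j := by rintro rfl; exact hj hi
  rw [shift, UV.mem_compression, compress_of_not (by tauto)]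
  have e : UV.compress {i} {j} (insert j (A.erase i)) = A := by
    rw [compress_of_mem (by simp [hij]) (by simp), erase_insert (by simp [hj]), insert_erase hi]
  constructor
  · rintro (⟨h, _⟩ | ⟨_, B, hB, hBA⟩)
    · exact Or.inl h
    · by_cases hc : i ∉ B ∧ j ∈ B
      · right
        rw [compress_of_mem hc.1 hc.2] at hBA
        subst hBA
        rwa [erase_insert (by simp [hc.1]), insert_erase hc.2]
      · rw [compress_of_not hc] at hBA
        exact Or.inl (hBA ▸ hB)
  · intro h
    by_cases hA : A ∈ F
    · exact Or.inl ⟨hA, hA⟩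
    · exact Or.inr ⟨hA, _, h.resolve_left hA, e⟩

theorem mem_shift_right {i j : ℕ} {F : Finset (Finset ℕ)} {A : Finset ℕ} (hi : i ∉ A)
    (hj : j ∈ A) : A ∈ shift i j F ↔ A ∈ F ∧ insert i (A.erase j) ∈ F := by
  have hij : i ≠ j := by rintro rfl; exact hi hj
  rw [shift, UV.mem_compression, compress_of_mem hi hj]
  constructor
  · rintro (h | ⟨hA, B, hB, hBA⟩)
    · exact h
    · by_cases hc : i ∉ B ∧ j ∈ B
      · rw [compress_of_mem hc.1 hc.2] at hBA
        subst hBA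
        simp at hi
      · rw [compress_of_not hc] at hBA
        exact absurd (hBA ▸ hB) hA
  · exact fun h => Or.inl h

theorem card_shift (i j : ℕ) (F : Finset (Finset ℕ)) : #(shift i j F) = #F :=
  UV.card_compression _ _ _

theorem shift_eq_image (i j : ℕ) (F : Finset (Finset ℕ)) :
    shift i j F = F.image fun A => if UV.compress {i} {j} A ∈ F then A
      else UV.compress {i} {j} A := by
  ext A
  rw [shift, UV.mem_compression, mem_image]
  constructor
  · rintro (⟨h, h'⟩ | ⟨h, B, hB, rfl⟩)
    · exact ⟨A, h, if_pos h'⟩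
    · exact ⟨B, hB, if_neg h⟩
  · rintro ⟨B, hB, rfl⟩
    split_ifs with h
    · exact Or.inl ⟨hB, h⟩
    · exact Or.inr ⟨h, B, hB, rfl⟩

theorem sum_compress_lt {i j : ℕ} (hij : i < j) {A : Finset ℕ}
    (h : UV.compress {i} {j} A ≠ A) : ∑ x ∈ UV.compress {i} {j} A, x < ∑ x ∈ A, x := by
  by_cases hc : i ∉ A ∧ j ∈ A
  · rw [compress_of_mem hc.1 hc.2, sum_insert (by simp [hc.1]), ← add_sum_erase A _ hc.2]
    simpa using hij
  · exact absurd (compress_of_not hc) h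

theorem sum_shift_lt {i j : ℕ} (hij : i < j) {F : Finset (Finset ℕ)} (h : shift i j F ≠ F) :
    ∑ A ∈ shift i j F, ∑ x ∈ A, x < ∑ A ∈ F, ∑ x ∈ A, x := by
  have hinj := card_image_iff.1 (by rw [← shift_eq_image, card_shift] :
    #(F.image fun A => if UV.compress {i} {j} A ∈ F then A else UV.compress {i} {j} A) = #F)
  have hex : ∃ A ∈ F, UV.compress {i} {j} A ∉ F := by
    by_contra hno
    push Not at hno
    apply h
    rw [shift_eq_image]
    conv_rhs => rw [← image_id (s := F)]
    exact image_congr fun A hA => if_pos (hno A hA)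
  rw [shift_eq_image, sum_image hinj]
  refine sum_lt_sum ?_ ?_
  · intro A hA
    split_ifs with h'
    · exact le_rfl
    · exact (sum_compress_lt hij fun e => h' (by rwa [e])).le
  · obtain ⟨A, hA, h'⟩ := hex
    refine ⟨A, hA, ?_⟩
    rw [if_neg h']
    exact sum_compress_lt hij fun e => h' (by rwa [e])

/-- Induction along shifts inside `W`. -/
theorem shift_induction (W : Finset ℕ) {P C : Finset (Finset ℕ) → Prop}
    (base : ∀ F, P F → (∀ i ∈ W, ∀ j ∈ W, i < j → shift i j F = F) → C F)
    (step : ∀ F, P F → ∀ i ∈ W, ∀ j ∈ W, i < j → (P (shift i j F) → C (shift i j F)) → C F)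
    (F : Finset (Finset ℕ)) (hF : P F) : C F := by
  induction hn : ∑ A ∈ F, ∑ x ∈ A, x using Nat.strong_induction_on generalizing F with
  | _ n ih =>
    by_cases h : ∀ i ∈ W, ∀ j ∈ W, i < j → shift i j F = F
    · exact base F hF h
    · push Not at h
      obtain ⟨i, hi, j, hj, hij, hne⟩ := h
      exact step F hF i hi j hj hij fun hP => ih _ (hn ▸ sum_shift_lt hij hne) _ hP rfl

theorem mem_of_shift_eq {i j : ℕ} {F : Finset (Finset ℕ)} (h : shift i j F = F) {A : Finset ℕ}
    (hA : A ∈ F) (hi : i ∉ A) (hj : j ∈ A) : insert i (A.erase j) ∈ F :=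
  ((mem_shift_right hi hj).1 (h.symm ▸ hA)).2

theorem shift_subset_powersetCard {i j k : ℕ} {V : Finset ℕ} {F : Finset (Finset ℕ)}
    (hF : F ⊆ powersetCard k V) (hi : i ∈ V) : shift i j F ⊆ powersetCard k V := by
  intro A hA
  by_cases h : i ∈ A ↔ j ∈ A
  · exact hF ((mem_shift_of_iff h).1 hA)
  by_cases hiA : i ∈ A
  · have hjA : j ∉ A := by tauto
    rcases (mem_shift_left hiA hjA).1 hA with h' | h'
    · exact hF h'
    · have := mem_powersetCard.1 (hF h')
      rw [card_insert_of_notMem (by simp [hjA]), card_erase_of_mem hiA] at this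
      have hp := card_pos.2 ⟨i, hiA⟩
      refine mem_powersetCard.2 ⟨?_, by omega⟩
      rw [← insert_erase hiA]
      exact insert_subset hi ((subset_insert _ _).trans this.1)
  · have hjA : j ∈ A := by tauto
    exact hF ((mem_shift_right hiA hjA).1 hA).1

theorem filter_shift {i j : ℕ} (F : Finset (Finset ℕ)) (p : Finset ℕ → Prop) [DecidablePred p]
    (hp : ∀ A, p (UV.compress {i} {j} A) ↔ p A) :
    (shift i j F).filter p = shift i j (F.filter p) := by
  ext A
  simp only [shift, mem_filter, UV.mem_compression, hp]
  constructor
  · rintro ⟨⟨h1, h2⟩ | ⟨h1, B, hB, rfl⟩, h⟩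
    · exact Or.inl ⟨⟨h1, h⟩, h2, h⟩
    · exact Or.inr ⟨fun h' => h1 h'.1, B, ⟨hB, (hp B).1 h⟩, rfl⟩
  · rintro (⟨⟨h1, h⟩, h2, _⟩ | ⟨h1, B, ⟨hB, hpB⟩, rfl⟩)
    · exact ⟨Or.inl ⟨h1, h2⟩, h⟩
    · have : p (UV.compress {i} {j} B) := (hp B).2 hpB
      exact ⟨Or.inr ⟨fun h' => h1 ⟨h', this⟩, B, hB, rfl⟩, this⟩

theorem card_filter_shift {i j : ℕ} (F : Finset (Finset ℕ)) (p : Finset ℕ → Prop)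
    [DecidablePred p] (hp : ∀ A, p (UV.compress {i} {j} A) ↔ p A) :
    #((shift i j F).filter p) = #(F.filter p) := by
  rw [filter_shift F p hp, card_shift]

theorem mem_compress_of_ne {i j x : ℕ} (hi : x ≠ i) (hj : x ≠ j) (A : Finset ℕ) :
    x ∈ UV.compress {i} {j} A ↔ x ∈ A := by
  by_cases hc : i ∉ A ∧ j ∈ A
  · rw [compress_of_mem hc.1 hc.2]; simp [hi, hj]
  · rw [compress_of_not hc]

theorem shift_intersecting {i j : ℕ} {F : Finset (Finset ℕ)}
    (hF : ∀ A ∈ F, ∀ B ∈ F, (A ∩ B).Nonempty) :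
    ∀ A ∈ shift i j F, ∀ B ∈ shift i j F, (A ∩ B).Nonempty := by
  have hF' : ∀ A ∈ F, ∀ B ∈ F, ∃ y, y ∈ A ∧ y ∈ B := fun A hA B hB => by
    obtain ⟨y, hy⟩ := hF A hA B hB
    exact ⟨y, mem_inter.1 hy⟩
  suffices H : ∀ A ∈ shift i j F, ∀ B ∈ shift i j F, ∃ y, y ∈ A ∧ y ∈ B by
    intro A hA B hB
    obtain ⟨y, hy⟩ := H A hA B hB
    exact ⟨y, mem_inter.2 hy⟩
  have key : ∀ A ∈ shift i j F, A ∈ F ∨ (i ∈ A ∧ j ∉ A ∧ insert j (A.erase i) ∈ F) := by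
    intro A hA
    by_cases h : i ∈ A ↔ j ∈ A
    · exact Or.inl ((mem_shift_of_iff h).1 hA)
    by_cases hiA : i ∈ A
    · have hjA : j ∉ A := by tauto
      rcases (mem_shift_left hiA hjA).1 hA with h' | h'
      · exact Or.inl h'
      · exact Or.inr ⟨hiA, hjA, h'⟩
    · have hjA : j ∈ A := by tauto
      exact Or.inl ((mem_shift_right hiA hjA).1 hA).1
  have mixed : ∀ A ∈ shift i j F, A ∈ F → ∀ B : Finset ℕ, i ∈ B → j ∉ B → insert j (B.erase i) ∈ F →
      ∃ y, y ∈ A ∧ y ∈ B := by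
    intro A hA hAF B hi hj hB
    by_cases hiA : i ∈ A
    · exact ⟨i, hiA, hi⟩
    by_cases hjA : j ∈ A
    · have h1 := ((mem_shift_right hiA hjA).1 hA).2
      obtain ⟨y, hy, hy'⟩ := hF' _ h1 _ hB
      refine ⟨y, ?_⟩
      simp only [mem_insert, mem_erase] at hy hy'
      have hij : i ≠ j := by rintro rfl; exact hj hi
      grind
    · obtain ⟨y, hy, hy'⟩ := hF' _ hAF _ hB
      refine ⟨y, hy, ?_⟩
      simp only [mem_insert, mem_erase] at hy'
      grind
  intro A hA B hB
  rcases key A hA with h | ⟨h1, h2, h3⟩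
  · rcases key B hB with h' | ⟨h1', h2', h3'⟩
    · exact hF' A h B h'
    · exact mixed A hA h B h1' h2' h3'
  · rcases key B hB with h' | ⟨h1', h2', h3'⟩
    · obtain ⟨y, hy, hy'⟩ := mixed B hB h' A h1 h2 h3
      exact ⟨y, hy', hy⟩
    · exact ⟨i, h1, h1'⟩

/-- An initial segment of a finite set of naturals of prescribed size. -/
theorem exists_initial_segment (W : Finset ℕ) (m : ℕ) (hm : m ≤ #W) :
    ∃ U ⊆ W, #U = m ∧ ∀ u ∈ U, ∀ w ∈ W, w ∉ U → u < w := by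
  induction m with
  | zero => exact ⟨∅, by simp⟩
  | succ m ih =>
    obtain ⟨U, hUW, hU, h⟩ := ih (by omega)
    have hne : (W \ U).Nonempty := by
      rw [← card_pos, card_sdiff_of_subset hUW]; omega
    set a := (W \ U).min' hne
    have ha := mem_sdiff.1 (min'_mem _ hne)
    refine ⟨insert a U, insert_subset ha.1 hUW, by rw [card_insert_of_notMem ha.2, hU], ?_⟩
    intro u hu w hw hwU
    rw [mem_insert, not_or] at hwU
    rcases mem_insert.1 hu with rfl | hu
    · exact lt_of_le_of_ne (min'_le _ _ (mem_sdiff.2 ⟨hw, hwU.2⟩)) (Ne.symm hwU.1)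
    · exact h u hu w hw hwU.2

/-- Families shifted outside `X` are intersecting on a set of `2k` elements. -/
theorem exists_kernel_of_shifted {V X : Finset ℕ} {F : Finset (Finset ℕ)} {k : ℕ} (hk : 4 ≤ k)
    (hn : 2 * k + 1 ≤ #V) (hXV : X ⊆ V) (hX : #X ≤ 2)
    (hF : F ⊆ powersetCard k V) (hint : ∀ A ∈ F, ∀ B ∈ F, (A ∩ B).Nonempty)
    (hmiss : X = ∅ ∨ #{A ∈ F | A ∩ X = ∅} ≤ 2)
    (hsh : ∀ i ∈ V \ X, ∀ j ∈ V \ X, i < j → shift i j F = F) :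
    ∃ Y ⊆ V, #Y = 2 * k ∧ ∀ A ∈ F, ∀ B ∈ F, (A ∩ B ∩ Y).Nonempty := by
  obtain ⟨U, hUW, hU, hlt⟩ := exists_initial_segment (V \ X) (2 * k - #X) (by
    rw [card_sdiff_of_subset hXV]; omega)
  have hdXU : Disjoint X U := disjoint_left.2 fun x hx hx' => (mem_sdiff.1 (hUW hx')).2 hx
  refine ⟨X ∪ U, union_subset hXV (hUW.trans sdiff_subset), ?_, ?_⟩
  · rw [card_union_of_disjoint hdXU]; omega
  have hFk : ∀ A ∈ F, #A = k := fun A hA => (mem_powersetCard.1 (hF hA)).2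
  have main : ∀ m, ∀ A ∈ F, ∀ B ∈ F, #(A ∩ B) = m → (A ∩ B ∩ (X ∪ U)).Nonempty := by
    intro m
    induction m using Nat.strong_induction_on with
    | _ m ih =>
      intro A hA B hB hm
      by_contra hempty
      rw [not_nonempty_iff_eq_empty] at hempty
      have hno : ∀ y, y ∈ A → y ∈ B → y ∉ X ∪ U := fun y h1 h2 h3 => by
        have : y ∈ A ∩ B ∩ (X ∪ U) := mem_inter.2 ⟨mem_inter.2 ⟨h1, h2⟩, h3⟩
        simp [hempty] at this
      obtain ⟨a, ha⟩ := hint A hA B hB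
      rw [mem_inter] at ha
      have haXU := hno a ha.1 ha.2
      rw [mem_union, not_or] at haXU
      have haW : a ∈ V \ X := mem_sdiff.2 ⟨(mem_powersetCard.1 (hF hA)).1 ha.1, haXU.1⟩
      by_cases hcov : U ⊆ A ∪ B
      · have e1 : #U = #(U ∩ A) + #(U ∩ B) := by
          rw [← card_union_of_disjoint, ← inter_union_distrib_left, inter_eq_left.2 hcov]
          rw [disjoint_left]
          intro y hy hy'
          rw [mem_inter] at hy hy'
          exact hno y hy.2 hy'.2 (mem_union_right _ hy.1)
        have bd : ∀ D ∈ F, a ∈ D → #(U ∩ D) + #(D ∩ X) + 1 ≤ k := by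
          intro D hD haD
          rw [← hFk D hD, ← card_union_of_disjoint, ← card_singleton a, ← card_union_of_disjoint]
          · refine card_le_card ?_
            intro y hy
            simp only [mem_union, mem_inter, mem_singleton] at hy
            rcases hy with (⟨_, h⟩ | ⟨h, _⟩) | rfl
            exacts [h, h, haD]
          · rw [disjoint_singleton_right]; simp [haXU.1, haXU.2]
          · refine disjoint_left.2 fun y hy hy' => ?_
            exact disjoint_left.1 hdXU (mem_inter.1 hy').2 (mem_inter.1 hy).1
        have bA := bd A hA ha.1
        have bB := bd B hB ha.2
        have hA0 : #(A ∩ X) = 0 := by omega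
        have hX2 : #X = 2 := by omega
        have hUB : #(U ∩ B) = k - 1 := by omega
        rcases hmiss with rfl | hmiss
        · simp at hX2
        have : #(U ∩ B) ≤ #{A ∈ F | A ∩ X = ∅} := by
          refine card_le_card_of_injOn (fun b => insert b (A.erase a)) ?_ ?_
          · intro b hb
            rw [mem_coe, mem_inter] at hb
            have hbA : b ∉ A := fun h => hno b h hb.2 (mem_union_right _ hb.1)
            have hbW := hUW hb.1
            refine mem_coe.2 (mem_filter.2 ⟨mem_of_shift_eq (hsh b hbW a haW
              (hlt b hb.1 a haW haXU.2)) hA hbA ha.1, ?_⟩)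
            rw [eq_empty_iff_forall_notMem]
            intro y hy
            rw [mem_inter, mem_insert, mem_erase] at hy
            rcases hy with ⟨rfl | ⟨_, h⟩, h'⟩
            · exact (mem_sdiff.1 hbW).2 h'
            · have : y ∈ A ∩ X := mem_inter.2 ⟨h, h'⟩
              rw [card_eq_zero.1 hA0] at this
              simp at this
          · intro b hb c hc h
            rw [mem_coe, mem_inter] at hb hc
            have hbA : b ∉ A := fun h => hno b h hb.2 (mem_union_right _ hb.1)
            have h' : insert b (A.erase a) = insert c (A.erase a) := h
            have : b ∈ insert c (A.erase a) := h' ▸ mem_insert_self _ _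
            rw [mem_insert, mem_erase] at this
            tauto
        omega
      · obtain ⟨b, hbU, hb⟩ := not_subset.1 hcov
        rw [mem_union, not_or] at hb
        have hA' := mem_of_shift_eq (hsh b (hUW hbU) a haW (hlt b hbU a haW haXU.2)) hA hb.1 ha.1
        have e : insert b (A.erase a) ∩ B = (A ∩ B).erase a := by
          ext y
          simp only [mem_inter, mem_insert, mem_erase]
          grind
        have := ih _ (by
          rw [e, card_erase_of_mem (mem_inter.2 ha)]
          have := card_pos.2 ⟨a, mem_inter.2 ha⟩
          omega) _ hA' B hB rfl
        obtain ⟨y, hy⟩ := this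
        rw [e] at hy
        simp only [mem_inter, mem_erase] at hy
        exact hno y hy.1.2.1 hy.1.2.2 hy.2
  exact fun A hA B hB => main _ A hA B hB rfl

theorem subset_of_filter_notMem_eq_singleton {V B : Finset ℕ} {F : Finset (Finset ℕ)} {k x : ℕ}
    (hF : F ⊆ powersetCard k V) (hint : ∀ A ∈ F, ∀ B ∈ F, (A ∩ B).Nonempty)
    (hx : {A ∈ F | x ∉ A} = {B}) :
    F ⊆ insert B {A ∈ powersetCard k V | x ∈ A ∧ (A ∩ B).Nonempty} := by
  have hB : B ∈ F ∧ x ∉ B := mem_filter.1 (hx ▸ mem_singleton_self B)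
  intro A hA
  by_cases hxA : x ∈ A
  · exact mem_insert_of_mem (mem_filter.2 ⟨hF hA, hxA, hint A hA B hB.1⟩)
  · have : A ∈ ({B} : Finset (Finset ℕ)) := hx ▸ mem_filter.2 ⟨hA, hxA⟩
    rw [mem_singleton.1 this]
    exact mem_insert_self _ _

theorem card_insert_star_meet {V B : Finset ℕ} {k x : ℕ} (hk : 1 ≤ k) (hx : x ∈ V)
    (hB : B ∈ powersetCard k V) (hxB : x ∉ B) :
    #(insert B {A ∈ powersetCard k V | x ∈ A ∧ (A ∩ B).Nonempty}) + (#V - 1 - k).choose (k - 1)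
      = (#V - 1).choose (k - 1) + 1 := by
  obtain ⟨hBV, hBk⟩ := mem_powersetCard.1 hB
  have h := card_star_meet_pair hk hx hBV hBV hxB hxB hBk hBk
  rw [union_self, hBk] at h
  simp only [and_self] at h
  rw [card_insert_of_notMem (by simp [hxB])]
  omega

theorem subset_of_filter_notMem_eq_pair {V B₁ B₂ : Finset ℕ} {F : Finset (Finset ℕ)} {k x : ℕ}
    (hF : F ⊆ powersetCard k V) (hint : ∀ A ∈ F, ∀ B ∈ F, (A ∩ B).Nonempty)
    (hx : {A ∈ F | x ∉ A} = {B₁, B₂}) :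
    F ⊆ {A ∈ powersetCard k V | x ∈ A ∧ (A ∩ B₁).Nonempty ∧ (A ∩ B₂).Nonempty} ∪ {B₁, B₂} := by
  have h₁ : B₁ ∈ F ∧ x ∉ B₁ := mem_filter.1 (hx ▸ mem_insert_self B₁ {B₂})
  have h₂ : B₂ ∈ F ∧ x ∉ B₂ := mem_filter.1 (hx ▸ mem_insert_of_mem (mem_singleton_self B₂))
  intro A hA
  by_cases hxA : x ∈ A
  · exact mem_union_left _ (mem_filter.2 ⟨hF hA, hxA, hint A hA B₁ h₁.1, hint A hA B₂ h₂.1⟩)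
  · exact mem_union_right _ (hx ▸ mem_filter.2 ⟨hA, hxA⟩)

theorem card_star_meet_pair_union {V B₁ B₂ : Finset ℕ} {k x : ℕ} (hk : 1 ≤ k) (hx : x ∈ V)
    (h₁ : B₁ ∈ powersetCard k V) (h₂ : B₂ ∈ powersetCard k V) (hx₁ : x ∉ B₁) (hx₂ : x ∉ B₂)
    (hne : B₁ ≠ B₂) :
    #({A ∈ powersetCard k V | x ∈ A ∧ (A ∩ B₁).Nonempty ∧ (A ∩ B₂).Nonempty} ∪ {B₁, B₂})
        + 2 * (#V - 1 - k).choose (k - 1)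
      = (#V - 1).choose (k - 1) + (#V - 1 - #(B₁ ∪ B₂)).choose (k - 1) + 2 := by
  obtain ⟨h₁V, h₁k⟩ := mem_powersetCard.1 h₁
  obtain ⟨h₂V, h₂k⟩ := mem_powersetCard.1 h₂
  have h := card_star_meet_pair hk hx h₁V h₂V hx₁ hx₂ h₁k h₂k
  rw [card_union_of_disjoint, card_pair hne]
  · omega
  · rw [disjoint_right]
    intro A hA hA'
    rcases mem_insert.1 hA with rfl | hA
    · exact hx₁ (mem_filter.1 hA').2.1
    · rw [mem_singleton.1 hA] at hA'
      exact hx₂ (mem_filter.1 hA').2.1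

theorem lt_card_union_of_ne {B₁ B₂ : Finset ℕ} {k : ℕ} (h₁ : #B₁ = k) (h₂ : #B₂ = k)
    (hne : B₁ ≠ B₂) : k + 1 ≤ #(B₁ ∪ B₂) := by
  by_contra! h
  have e1 := eq_of_subset_of_card_le (subset_union_left (s₁ := B₁) (s₂ := B₂)) (by omega)
  have e2 := eq_of_subset_of_card_le (subset_union_right (s₁ := B₁) (s₂ := B₂)) (by omega)
  exact hne (e1.trans e2.symm)

theorem card_bound_of_filter_notMem_eq_pair {V B₁ B₂ : Finset ℕ} {F : Finset (Finset ℕ)} {k x : ℕ}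
    (hk : 2 ≤ k) (hn : 2 * k + 1 ≤ #V) (hxV : x ∈ V)
    (hF : F ⊆ powersetCard k V) (hint : ∀ A ∈ F, ∀ B ∈ F, (A ∩ B).Nonempty)
    (hx : {A ∈ F | x ∉ A} = {B₁, B₂}) (hne : B₁ ≠ B₂) :
    #F + (#V - k - 1).choose (k - 1) + (#V - k - 2).choose (k - 2) ≤ (#V - 1).choose (k - 1) + 2 ∧
      (#F + (#V - k - 1).choose (k - 1) + (#V - k - 2).choose (k - 2)
          = (#V - 1).choose (k - 1) + 2 →
        #(B₁ ∪ B₂) = k + 1 ∧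
          F = {A ∈ powersetCard k V | x ∈ A ∧ (A ∩ B₁).Nonempty ∧ (A ∩ B₂).Nonempty}
            ∪ {B₁, B₂}) := by
  have h₁ : B₁ ∈ F ∧ x ∉ B₁ := mem_filter.1 (hx ▸ mem_insert_self B₁ {B₂})
  have h₂ : B₂ ∈ F ∧ x ∉ B₂ := mem_filter.1 (hx ▸ mem_insert_of_mem (mem_singleton_self B₂))
  have hsub := subset_of_filter_notMem_eq_pair hF hint hx
  have hcard := card_star_meet_pair_union (by omega) hxV (hF h₁.1) (hF h₂.1) h₁.2 h₂.2 hne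
  have hu := lt_card_union_of_ne (mem_powersetCard.1 (hF h₁.1)).2 (mem_powersetCard.1 (hF h₂.1)).2
    hne
  have hle := card_le_card hsub
  have hpas : (#V - k - 1).choose (k - 1)
      = (#V - k - 2).choose (k - 1) + (#V - k - 2).choose (k - 2) := by
    obtain ⟨a, ha⟩ : ∃ a, #V = a + k + 2 := ⟨#V - k - 2, by omega⟩
    obtain ⟨b, rfl⟩ : ∃ b, k = b + 2 := ⟨k - 2, by omega⟩
    rw [show #V - (b + 2) - 1 = a + 1 by omega, show #V - (b + 2) - 2 = a by omega,
      show b + 2 - 1 = b + 1 by omega, show b + 2 - 2 = b by omega, Nat.choose_succ_succ']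
    ring
  have e1 : #V - 1 - k = #V - k - 1 := by omega
  rw [e1] at hcard
  have hmono : (#V - 1 - #(B₁ ∪ B₂)).choose (k - 1) ≤ (#V - k - 2).choose (k - 1) :=
    Nat.choose_le_choose _ (by omega)
  refine ⟨by omega, fun heq => ?_⟩
  have hu2 : #(B₁ ∪ B₂) = k + 1 := by
    by_contra hne'
    have h1 : (#V - 1 - #(B₁ ∪ B₂)).choose (k - 1) ≤ (#V - k - 3).choose (k - 1) :=
      Nat.choose_le_choose _ (by omega)
    have h2 : (#V - k - 3).choose (k - 1) < (#V - k - 2).choose (k - 1) := by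
      obtain ⟨a, ha⟩ : ∃ a, #V = a + k + 3 := ⟨#V - k - 3, by omega⟩
      obtain ⟨b, rfl⟩ : ∃ b, k = b + 2 := ⟨k - 2, by omega⟩
      rw [show #V - (b + 2) - 3 = a by omega, show #V - (b + 2) - 2 = a + 1 by omega,
        show b + 2 - 1 = b + 1 by omega, Nat.choose_succ_succ']
      have : 0 < a.choose b := Nat.choose_pos (by omega)
      omega
    omega
  exact ⟨hu2, eq_of_subset_of_card_le hsub (by
    rw [hu2, show #V - 1 - (k + 1) = #V - k - 2 by omega] at hcard; omega)⟩

/-- The subsets of a set of size three with at least two elements, counted with binomial weights. -/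
theorem card_filter_two_le_inter {V T : Finset ℕ} {k : ℕ} (hk : 3 ≤ k) (hTV : T ⊆ V)
    (hT : #T = 3) :
    #{A ∈ powersetCard k V | 2 ≤ #(A ∩ T)}
      = 3 * (#V - 3).choose (k - 2) + (#V - 3).choose (k - 3) := by
  have h := card_filter_inter_mem hTV (k := k) (powersetCard 2 T ∪ powersetCard 3 T)
    (by
      intro S hS
      simp only [mem_union, mem_powersetCard] at hS
      exact mem_powerset.2 (hS.elim And.left And.left))
    (by
      intro S hS
      simp only [mem_union, mem_powersetCard] at hS
      omega)
  have e : {A ∈ powersetCard k V | 2 ≤ #(A ∩ T)}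
      = {A ∈ powersetCard k V | A ∩ T ∈ powersetCard 2 T ∪ powersetCard 3 T} := by
    refine filter_congr fun A _ => ?_
    have := card_le_card (inter_subset_right (s₁ := A) (s₂ := T))
    simp only [mem_union, mem_powersetCard, inter_subset_right, true_and]
    omega
  rw [e, h, sum_union (disjoint_left.2 fun S h1 h2 => by
    have := (mem_powersetCard.1 h1).2
    have := (mem_powersetCard.1 h2).2
    omega)]
  rw [sum_congr rfl (g := fun _ => (#V - 3).choose (k - 2)) fun S hS => by
      rw [(mem_powersetCard.1 hS).2, hT],
    sum_congr (s₁ := powersetCard 3 T) rfl (g := fun _ => (#V - 3).choose (k - 3)) fun S hS => by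
      rw [(mem_powersetCard.1 hS).2, hT]]
  simp [hT]

theorem card_filter_subset_or_star {V E : Finset ℕ} {k x : ℕ} (hk : 4 ≤ k) (hEV : E ⊆ V)
    (hE : #E = 3) (hx : x ∈ V) (hxE : x ∉ E) :
    #{A ∈ powersetCard k V | E ⊆ A ∨ (x ∈ A ∧ (A ∩ E).Nonempty)}
      = (#V - 4).choose (k - 3) + 3 * (#V - 4).choose (k - 2) + 3 * (#V - 4).choose (k - 3)
        + (#V - 4).choose (k - 4) := by
  have hZ : insert x E ⊆ V := insert_subset hx hEV
  have hZc : #(insert x E) = 4 := by rw [card_insert_of_notMem hxE, hE]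
  have hxS : ∀ S ⊆ E, x ∉ S := fun S hS h => hxE (hS h)
  set J : Finset ℕ := {1, 2, 3} with hJ
  set S₁ := J.biUnion fun i => (powersetCard i E).image (insert x) with hS₁
  have hd : E ∉ S₁ := by
    simp only [hS₁, mem_biUnion, mem_image, not_exists, not_and]
    intro i _ S _ h
    exact hxE (h ▸ mem_insert_self x S)
  have h := card_filter_inter_mem hZ (k := k) (insert E S₁)
    (by
      intro S hS
      simp only [hS₁, mem_insert, mem_biUnion, mem_image, mem_powersetCard] at hS
      rw [mem_powerset]
      rcases hS with rfl | ⟨i, _, S, ⟨h, _⟩, rfl⟩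
      · exact subset_insert _ _
      · exact insert_subset_insert _ h)
    (by
      intro S hS
      simp only [hS₁, mem_insert, mem_biUnion, mem_image, mem_powersetCard] at hS
      rcases hS with rfl | ⟨i, hi, S, ⟨h, _⟩, rfl⟩
      · omega
      · have := card_le_card h
        rw [card_insert_of_notMem (hxS S h)]; omega)
  have e : {A ∈ powersetCard k V | E ⊆ A ∨ (x ∈ A ∧ (A ∩ E).Nonempty)}
      = {A ∈ powersetCard k V | A ∩ insert x E ∈ insert E S₁} := by
    refine filter_congr fun A _ => ?_
    simp only [hS₁, mem_insert, mem_biUnion, mem_image, mem_powersetCard]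
    by_cases hxA : x ∈ A
    · rw [inter_insert_of_mem hxA]
      constructor
      · intro h
        right
        have hne : (A ∩ E).Nonempty := by
          rcases h with h | h
          · rw [inter_eq_right.2 h]; exact card_pos.1 (by omega)
          · exact h.2
        have h1 := hne.card_pos
        have h2 := card_le_card (inter_subset_right (s₁ := A) (s₂ := E))
        refine ⟨#(A ∩ E), ?_, A ∩ E, ⟨inter_subset_right, rfl⟩, rfl⟩
        simp only [hJ, mem_insert, mem_singleton]; omega
      · rintro (h | ⟨i, hi, S, ⟨hSE, hSi⟩, hS⟩)
        · exact absurd (h ▸ mem_insert_self x (A ∩ E)) hxE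
        · right
          refine ⟨hxA, ?_⟩
          have : S = A ∩ E := by
            rw [← erase_insert (hxS S hSE), hS, erase_insert (fun h => hxE (mem_inter.1 h).2)]
          rw [← this, ← card_pos, hSi]
          simp only [hJ, mem_insert, mem_singleton] at hi; omega
    · rw [inter_insert_of_notMem hxA]
      constructor
      · rintro (h | h)
        · exact Or.inl (inter_eq_right.2 h)
        · exact absurd h.1 hxA
      · rintro (h | ⟨i, hi, S, ⟨hSE, hSi⟩, hS⟩)
        · exact Or.inl (inter_eq_right.1 h)
        · exact absurd (mem_inter.1 (hS ▸ mem_insert_self x S)).1 hxA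
  have hinj : ∀ i, Set.InjOn (insert x) (powersetCard i E : Set (Finset ℕ)) := by
    intro i S hS S' hS' h
    have h1 := hxS S (mem_powersetCard.1 hS).1
    have h2 := hxS S' (mem_powersetCard.1 hS').1
    rw [← erase_insert h1, ← erase_insert h2, h]
  have hsum : ∑ T ∈ S₁, (#V - #(insert x E)).choose (k - #T)
      = ∑ i ∈ J, (Nat.choose 3 i) * (#V - 4).choose (k - (i + 1)) := by
    rw [hS₁, sum_biUnion]
    · refine sum_congr rfl fun i _ => ?_
      rw [sum_image (hinj i), sum_congr rfl (g := fun _ => (#V - 4).choose (k - (i + 1)))]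
      · simp [hE]
      · intro S hS
        rw [card_insert_of_notMem (hxS S (mem_powersetCard.1 hS).1), (mem_powersetCard.1 hS).2, hZc]
    · intro i _ i' _ hii'
      simp only [Function.onFun]
      rw [disjoint_left]
      intro S hS hS'
      obtain ⟨S1, h1, rfl⟩ := mem_image.1 hS
      obtain ⟨S2, h2, h3⟩ := mem_image.1 hS'
      have h1' := mem_powersetCard.1 h1
      have h2' := mem_powersetCard.1 h2
      have := congrArg card h3
      rw [card_insert_of_notMem (hxS _ h1'.1), card_insert_of_notMem (hxS _ h2'.1)] at this
      omega
  rw [e, h, sum_insert hd, hsum, hZc, hE, hJ]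
  simp
  ring

/-- All `k`-subsets of `V` meeting a fixed triple in at least two points. -/
def IsTwoOfThree (V : Finset ℕ) (k : ℕ) (F : Finset (Finset ℕ)) : Prop :=
  ∃ T ⊆ V, #T = 3 ∧ F = {A ∈ powersetCard k V | 2 ≤ #(A ∩ T)}

/-- All `k`-subsets of `V` that contain a fixed triple `E`, or contain `x` and meet `E`. -/
def IsTripleOrStar (V : Finset ℕ) (k : ℕ) (F : Finset (Finset ℕ)) : Prop :=
  ∃ E ⊆ V, ∃ x ∈ V, #E = 3 ∧ x ∉ E ∧
    F = {A ∈ powersetCard k V | E ⊆ A ∨ (x ∈ A ∧ (A ∩ E).Nonempty)}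

/-- The Hilton–Milner bound for `k`-uniform families. -/
def HiltonMilnerBound (k : ℕ) : Prop :=
  ∀ (V : Finset ℕ) (F : Finset (Finset ℕ)), 2 * k + 1 ≤ #V → F ⊆ powersetCard k V →
    (∀ A ∈ F, ∀ B ∈ F, (A ∩ B).Nonempty) → (∀ x ∈ V, ∃ A ∈ F, x ∉ A) →
    #F + (#V - 1 - k).choose (k - 1) ≤ (#V - 1).choose (k - 1) + 1

/-- The second-level bound, together with the extremal families of covering defect at least `3`. -/
def SecondLevelBound (V : Finset ℕ) (k : ℕ) (F : Finset (Finset ℕ)) : Prop :=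
  #F + (#V - k - 1).choose (k - 1) + (#V - k - 2).choose (k - 2)
      ≤ (#V - 1).choose (k - 1) + 2 ∧
    (#F + (#V - k - 1).choose (k - 1) + (#V - k - 2).choose (k - 2)
        = (#V - 1).choose (k - 1) + 2 →
      k = 4 ∧ (IsTwoOfThree V k F ∨ IsTripleOrStar V k F))

theorem card_union_powersetCard_ge {C₁ C₂ C₃ : Finset ℕ} {m j : ℕ} (h₁ : #C₁ = m) (h₂ : #C₂ = m)
    (h₃ : #C₃ = m) (h₁₂ : C₁ ≠ C₂) (h₁₃ : C₁ ≠ C₃) (h₂₃ : C₂ ≠ C₃) (hj : 1 ≤ j) (hjm : j ≤ m) :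
    m.choose j + (m - 1).choose (j - 1) + (if 2 ≤ j then 1 else 0)
      ≤ #(powersetCard j C₁ ∪ powersetCard j C₂ ∪ powersetCard j C₃) := by
  have hdiff : ∀ {A B : Finset ℕ}, #A = m → #B = m → A ≠ B → ∃ w ∈ B, w ∉ A := by
    intro A B hA hB h
    by_contra! hc
    exact h (eq_of_subset_of_card_le (s := B) (t := A) (fun x hx => hc x hx) (by omega)).symm
  obtain ⟨w, hw2, hw1⟩ := hdiff h₁ h₂ h₁₂
  obtain ⟨p, hp3, hp1⟩ := hdiff h₁ h₃ h₁₃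
  obtain ⟨q, hq3, hq2⟩ := hdiff h₂ h₃ h₂₃
  set N := (powersetCard (j - 1) (C₂.erase w)).image (insert w) with hN
  have hNc : #N = (m - 1).choose (j - 1) := by
    rw [hN, card_image_of_injOn, card_powersetCard, card_erase_of_mem hw2, h₂]
    intro S hS S' hS' h
    have hn : ∀ S ∈ powersetCard (j - 1) (C₂.erase w), w ∉ S := fun S hS h => by
      simpa using (mem_powersetCard.1 hS).1 h
    rw [← erase_insert (hn S hS), ← erase_insert (hn S' hS'), h]
  have hN2 : N ⊆ powersetCard j C₂ := by
    intro S hS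
    obtain ⟨Q, hQ, rfl⟩ := mem_image.1 hS
    obtain ⟨hQ, hQc⟩ := mem_powersetCard.1 hQ
    refine mem_powersetCard.2 ⟨insert_subset hw2 (hQ.trans (erase_subset _ _)), ?_⟩
    rw [card_insert_of_notMem fun h => by simpa using hQ h]
    omega
  have hd : Disjoint (powersetCard j C₁) N := by
    rw [disjoint_right]
    intro S hS hS1
    obtain ⟨Q, hQ, rfl⟩ := mem_image.1 hS
    exact hw1 ((mem_powersetCard.1 hS1).1 (mem_insert_self _ _))
  have hcard : #(powersetCard j C₁ ∪ N) = m.choose j + (m - 1).choose (j - 1) := by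
    rw [card_union_of_disjoint hd, hNc, card_powersetCard, h₁]
  rw [← hcard]
  split_ifs with hj2
  · obtain ⟨Z, hZ1, hZ2, hZc⟩ := exists_subsuperset_card_eq (s := {p, q}) (t := C₃) (n := j)
      (by intro y hy; simp only [mem_insert, mem_singleton] at hy; rcases hy with rfl | rfl <;>
            assumption)
      (card_le_two.trans hj2) (by omega)
    rw [← card_insert_of_notMem (a := Z)]
    · apply card_le_card
      intro S hS
      simp only [mem_insert, mem_union] at hS ⊢
      rcases hS with rfl | hS | hS
      · exact Or.inr (mem_powersetCard.2 ⟨hZ2, hZc⟩)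
      · exact Or.inl (Or.inl hS)
      · exact Or.inl (Or.inr (hN2 hS))
    · simp only [mem_union, not_or]
      constructor
      · intro h
        exact hp1 ((mem_powersetCard.1 h).1 (hZ1 (by simp)))
      · intro h
        exact hq2 ((mem_powersetCard.1 (hN2 h)).1 (hZ1 (by simp)))
  · apply card_le_card
    intro S hS
    simp only [mem_union] at hS ⊢
    rcases hS with hS | hS
    · exact Or.inl (Or.inl hS)
    · exact Or.inl (Or.inr (hN2 hS))

theorem choose_ge_of_three_le {k i : ℕ} (hi : 2 ≤ i) (hik : i + 1 ≤ k) :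
    (k - 1).choose (i - 1) + (k - 2).choose (i - 2) + (if 3 ≤ i then (k - 2).choose (i - 3) else 0)
      = k.choose (i - 1) := by
  obtain ⟨j, rfl⟩ : ∃ j, i = j + 2 := ⟨i - 2, by omega⟩
  obtain ⟨m, rfl⟩ : ∃ m, k = m + 2 := ⟨k - 2, by omega⟩
  simp only [show m + 2 - 1 = m + 1 by omega, show m + 2 - 2 = m by omega,
    show j + 2 - 1 = j + 1 by omega, show j + 2 - 2 = j by omega]
  rw [Nat.choose_succ_succ' (m + 1) j]
  rcases j with _ | j
  · simp [add_comm]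
  · rw [Nat.choose_succ_succ' m j]
    simp [show j + 1 + 2 - 3 = j by omega]
    ring

/-- A star of traces all meeting many small sets that avoid its centre. -/
theorem card_star_trace_le {Y : Finset ℕ} {x k i : ℕ} (hi : 2 ≤ i) (hik : i + 1 ≤ k)
    (hY : #Y = 2 * k) (hx : x ∈ Y) {T : Finset (Finset ℕ)} (hT : T ⊆ powersetCard i Y)
    (hTx : ∀ A ∈ T, x ∈ A)
    (hD : (∃ D ⊆ Y.erase x, #D + 1 ≤ k ∧ ∀ A ∈ T, (A ∩ D).Nonempty) ∨
      ∃ D₁ ⊆ Y.erase x, ∃ D₂ ⊆ Y.erase x, ∃ D₃ ⊆ Y.erase x, #D₁ = k ∧ #D₂ = k ∧ #D₃ = k ∧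
        D₁ ≠ D₂ ∧ D₁ ≠ D₃ ∧ D₂ ≠ D₃ ∧
        ∀ A ∈ T, (A ∩ D₁).Nonempty ∧ (A ∩ D₂).Nonempty ∧ (A ∩ D₃).Nonempty) :
    #T + (k - 1).choose (i - 1) + (k - 2).choose (i - 2) + (if 3 ≤ i then 1 else 0)
      ≤ (2 * k - 1).choose (i - 1) := by
  have hR : #(Y.erase x) = 2 * k - 1 := by rw [card_erase_of_mem hx, hY]
  have aux : ∀ D ⊆ Y.erase x, ∀ A ∈ T, (A ∩ D).Nonempty →
      A.erase x ∉ powersetCard (i - 1) (Y.erase x \ D) := by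
    intro D hDY A hA ⟨y, hy⟩ h
    obtain ⟨hyA, hyD⟩ := mem_inter.1 hy
    have : y ∈ A.erase x := mem_erase.2 ⟨fun e => by simpa [e] using hDY hyD, hyA⟩
    exact (mem_sdiff.1 ((mem_powersetCard.1 h).1 this)).2 hyD
  have mono : ∀ D, powersetCard (i - 1) (Y.erase x \ D) ⊆ powersetCard (i - 1) (Y.erase x) :=
    fun D => powersetCard_mono sdiff_subset
  rcases hD with ⟨D, hDY, hDk, hTD⟩ | ⟨D₁, h₁, D₂, h₂, D₃, h₃, c₁, c₂, c₃, n₁₂, n₁₃, n₂₃, hTD⟩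
  · have h := card_star_add_le hx hT hTx (mono D) fun A hA => aux D hDY A hA (hTD A hA)
    rw [card_powersetCard, card_sdiff_of_subset hDY, hR, hY] at h
    have h1 : k.choose (i - 1) ≤ (2 * k - 1 - #D).choose (i - 1) :=
      Nat.choose_le_choose _ (by omega)
    have h2 := choose_ge_of_three_le hi hik
    have h3 : (if 3 ≤ i then 1 else 0) ≤ (if 3 ≤ i then (k - 2).choose (i - 3) else 0) := by
      split_ifs
      · exact Nat.choose_pos (by omega)
      · exact le_rfl
    omega
  · have h := card_star_add_le hx hT hTx
      (union_subset (union_subset (mono D₁) (mono D₂)) (mono D₃)) fun A hA hU => by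
        obtain ⟨a1, a2, a3⟩ := hTD A hA
        simp only [mem_union] at hU
        rcases hU with (hU | hU) | hU
        · exact aux D₁ h₁ A hA a1 hU
        · exact aux D₂ h₂ A hA a2 hU
        · exact aux D₃ h₃ A hA a3 hU
    have hc : ∀ D ⊆ Y.erase x, #D = k → #(Y.erase x \ D) = k - 1 := fun D hD hc => by
      rw [card_sdiff_of_subset hD, hR, hc]; omega
    have hne : ∀ D ⊆ Y.erase x, ∀ D' ⊆ Y.erase x, D ≠ D' → Y.erase x \ D ≠ Y.erase x \ D' :=
      fun D hD D' hD' hne h => hne (by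
        rw [← Finset.sdiff_sdiff_eq_self hD, h, Finset.sdiff_sdiff_eq_self hD'])
    have h' := card_union_powersetCard_ge (j := i - 1) (hc D₁ h₁ c₁) (hc D₂ h₂ c₂) (hc D₃ h₃ c₃)
      (hne D₁ h₁ D₂ h₂ n₁₂) (hne D₁ h₁ D₃ h₃ n₁₃) (hne D₂ h₂ D₃ h₃ n₂₃) (by omega) (by omega)
    rw [hY] at h
    have e1 : k - 1 - 1 = k - 2 := by omega
    have e2 : i - 1 - 1 = i - 2 := by omega
    rw [e1, e2] at h'
    by_cases h3 : 3 ≤ i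
    · rw [if_pos (by omega)] at h'; rw [if_pos h3]; omega
    · rw [if_neg (by omega)] at h'; rw [if_neg h3]; omega

theorem card_intersecting_half_le {Y : Finset ℕ} {k : ℕ} (hk : 1 ≤ k) (hY : #Y = 2 * k)
    {S : Finset (Finset ℕ)} (hS : S ⊆ powersetCard k Y)
    (hint : ∀ A ∈ S, ∀ B ∈ S, (A ∩ B).Nonempty) : #S ≤ (2 * k - 1).choose (k - 1) := by
  have hinj : Set.InjOn (fun A : Finset ℕ => Y \ A) S := by
    intro A hA B hB h
    have h' : Y \ A = Y \ B := h
    rw [← Finset.sdiff_sdiff_eq_self (mem_powersetCard.1 (hS hA)).1, h',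
      Finset.sdiff_sdiff_eq_self (mem_powersetCard.1 (hS hB)).1]
  have hd : Disjoint S (S.image fun A => Y \ A) := by
    rw [disjoint_left]
    intro A hA hA'
    obtain ⟨B, hB, rfl⟩ := mem_image.1 hA'
    obtain ⟨y, hy⟩ := hint _ hA B hB
    simp at hy
  have hsub : S ∪ S.image (fun A => Y \ A) ⊆ powersetCard k Y := by
    refine union_subset hS fun A hA => ?_
    obtain ⟨B, hB, rfl⟩ := mem_image.1 hA
    obtain ⟨hBY, hBk⟩ := mem_powersetCard.1 (hS hB)
    exact mem_powersetCard.2 ⟨sdiff_subset, by rw [card_sdiff_of_subset hBY]; omega⟩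
  have h := card_le_card hsub
  rw [card_union_of_disjoint hd, card_image_of_injOn hinj, card_powersetCard, hY] at h
  have h2 : (2 * k).choose k = 2 * (2 * k - 1).choose (k - 1) := by
    obtain ⟨m, rfl⟩ : ∃ m, k = m + 1 := ⟨k - 1, by omega⟩
    rw [show 2 * (m + 1) = (2 * m + 1) + 1 by ring, Nat.choose_succ_succ',
      show 2 * m + 1 + 1 - 1 = 2 * m + 1 by omega, show m + 1 - 1 = m by omega,
      ← Nat.choose_symm_of_eq_add (n := 2 * m + 1) (a := m + 1) (b := m) (by ring)]
    ring
  omega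

theorem card_nonstar_trace_le {Y : Finset ℕ} {k i : ℕ} (hk : 4 ≤ k) (hi : 2 ≤ i) (hik : i + 1 ≤ k)
    (hHM : 3 ≤ i → HiltonMilnerBound i)
    (hY : #Y = 2 * k) {T : Finset (Finset ℕ)} (hT : T ⊆ powersetCard i Y)
    (hint : ∀ A ∈ T, ∀ B ∈ T, (A ∩ B).Nonempty) (hstar : ∀ x ∈ Y, ∃ A ∈ T, x ∉ A) :
    #T + (k - 1).choose (i - 1) + (k - 2).choose (i - 2)
      + (if i + 1 = k ∧ 5 ≤ k then 1 else 0) ≤ (2 * k - 1).choose (i - 1) := by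
  by_cases h3 : 3 ≤ i
  · have h := hHM h3 Y T (by omega) hT hint hstar
    rw [hY] at h
    have h1 : k.choose (i - 1) ≤ (2 * k - 1 - i).choose (i - 1) :=
      Nat.choose_le_choose _ (by omega)
    have h2 := choose_ge_of_three_le hi hik
    rw [if_pos h3] at h2
    have h4 : 0 < (k - 2).choose (i - 3) := Nat.choose_pos (by omega)
    split_ifs with hc
    · have h5 : 2 ≤ (k - 2).choose (i - 3) := by
        obtain ⟨rfl, hc⟩ := hc
        have := Nat.choose_le_choose 1 (show 2 ≤ i + 1 - 2 by omega)
        rw [show i + 1 - 2 = i - 3 + 2 by omega]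
        rw [Nat.choose_symm_of_eq_add (n := i - 3 + 2) (a := i - 3) (b := 2) rfl]
        have := Nat.choose_le_choose 2 (show 3 ≤ i - 3 + 2 by omega)
        simp only [show Nat.choose 3 2 = 3 by decide] at this
        omega
      omega
    · omega
  · obtain rfl : i = 2 := by omega
    have hc2 : ∀ e ∈ T, #e = 2 := fun e he => (mem_powersetCard.1 (hT he)).2
    have h3 : #T ≤ 3 := by
      rcases star_or_triangle_of_intersecting hc2 hint with ⟨u, hu⟩ | ⟨Z, hZ, hTZ⟩
      · exfalso
        obtain ⟨y, hy⟩ : Y.Nonempty := card_pos.1 (by omega)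
        obtain ⟨A, hA, -⟩ := hstar y hy
        obtain ⟨B, hB, huB⟩ := hstar u ((mem_powersetCard.1 (hT hA)).1 (hu A hA))
        exact huB (hu B hB)
      · exact card_le_three_of_subset_triangle hc2 hZ hTZ
    rw [if_neg (by omega)]
    simp
    omega

theorem sum_choose_shift (a d m : ℕ) :
    (a + d).choose (m + 1)
      = d.choose (m + 1) + ∑ j ∈ range (m + 1), a.choose (j + 1) * d.choose (m - j) := by
  rw [Nat.add_choose_eq, Nat.sum_antidiagonal_eq_sum_range_succ_mk, sum_range_succ', add_comm]
  simp

theorem sum_choose_range (a d m : ℕ) :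
    (a + d).choose m = ∑ j ∈ range (m + 1), a.choose j * d.choose (m - j) := by
  rw [Nat.add_choose_eq, Nat.sum_antidiagonal_eq_sum_range_succ_mk]

theorem exists_filter_notMem_eq_pair {F : Finset (Finset ℕ)} {x : ℕ} (h1 : ∃ A ∈ F, x ∉ A)
    (h2 : #{A ∈ F | x ∉ A} < 3) :
    (∃ B, {A ∈ F | x ∉ A} = {B}) ∨ ∃ B₁ B₂, B₁ ≠ B₂ ∧ {A ∈ F | x ∉ A} = {B₁, B₂} := by
  obtain ⟨A, hA, hxA⟩ := h1
  have hpos : 0 < #{A ∈ F | x ∉ A} := card_pos.2 ⟨A, mem_filter.2 ⟨hA, hxA⟩⟩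
  rcases (show #{A ∈ F | x ∉ A} = 1 ∨ #{A ∈ F | x ∉ A} = 2 by omega) with h | h
  · exact Or.inl (card_eq_one.1 h)
  · exact Or.inr (card_eq_two.1 h)

theorem three_uniform_eight {Y : Finset ℕ} (hY : #Y = 8) {S : Finset (Finset ℕ)}
    (hS : S ⊆ powersetCard 3 Y) (hint : ∀ A ∈ S, ∀ B ∈ S, (A ∩ B).Nonempty)
    (hstar : ∀ x ∈ Y, ∃ A ∈ S, x ∉ A) (hc : 16 ≤ #S) :
    (∃ T ⊆ Y, #T = 3 ∧ S = {A ∈ powersetCard 3 Y | 2 ≤ #(A ∩ T)}) ∨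
      ∃ E ⊆ Y, ∃ x ∈ Y, #E = 3 ∧ x ∉ E ∧
        S = insert E {A ∈ powersetCard 3 Y | x ∈ A ∧ (A ∩ E).Nonempty} := by
  by_cases hdiv : ∀ x ∈ Y, 3 ≤ #{A ∈ S | x ∉ A}
  · left
    by_cases hG : ∃ T ⊆ Y, #T = 3 ∧ ∀ A ∈ S, 2 ≤ #(A ∩ T)
    · obtain ⟨T, hTY, hT, hST⟩ := hG
      refine ⟨T, hTY, hT, eq_of_subset_of_card_le
        (fun A hA => mem_filter.2 ⟨hS hA, hST A hA⟩) ?_⟩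
      rw [card_filter_two_le_inter le_rfl hTY hT, hY]
      simpa using hc
    · have := card_add_three_le_of_three_uniform (by omega) hS hint hdiv hG
      omega
  · right
    push Not at hdiv
    obtain ⟨x, hx, hlt⟩ := hdiv
    rcases exists_filter_notMem_eq_pair (hstar x hx) hlt with ⟨B, hB⟩ | ⟨B₁, B₂, hne, hB⟩
    · have hBm : B ∈ S ∧ x ∉ B := mem_filter.1 (hB ▸ mem_singleton_self B)
      have hBY := mem_powersetCard.1 (hS hBm.1)
      refine ⟨B, hBY.1, x, hx, hBY.2, hBm.2,
        eq_of_subset_of_card_le (subset_of_filter_notMem_eq_singleton hS hint hB) ?_⟩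
      have := card_insert_star_meet (by omega) hx (hS hBm.1) hBm.2
      rw [hY, show Nat.choose (8 - 1 - 3) (3 - 1) = 6 by decide,
        show Nat.choose (8 - 1) (3 - 1) = 21 by decide] at this
      omega
    · have := (card_bound_of_filter_notMem_eq_pair (by omega) (by omega) hx hS hint hB hne).1
      rw [hY, show Nat.choose (8 - 3 - 1) (3 - 1) = 6 by decide,
        show Nat.choose (8 - 1) (3 - 1) = 21 by decide,
        show Nat.choose (8 - 3 - 2) (3 - 2) = 3 by decide] at this
      omega

theorem four_uniform_bound_eq (n : ℕ) (hn : 9 ≤ n) :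
    3 * (n - 3).choose 2 + (n - 3) + (n - 5).choose 3 + (n - 6).choose 2
      = (n - 1).choose 3 + 2 := by
  obtain ⟨m, rfl⟩ : ∃ m, n = m + 9 := ⟨n - 9, by omega⟩
  simp only [show m + 9 - 3 = m + 6 by omega, show m + 9 - 5 = m + 4 by omega,
    show m + 9 - 6 = m + 3 by omega, show m + 9 - 1 = m + 8 by omega]
  have h2 : ∀ a : ℕ, (a + 1).choose 2 = a + a.choose 2 := fun a => by
    rw [Nat.choose_succ_succ' a 1, Nat.choose_one_right]
  have h3 : ∀ a : ℕ, (a + 1).choose 3 = a.choose 2 + a.choose 3 := fun a =>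
    Nat.choose_succ_succ' a 2
  rw [h3 (m + 7), h3 (m + 6), h3 (m + 5), h3 (m + 4), h2 (m + 6), h2 (m + 5), h2 (m + 4),
    h2 (m + 3)]
  ring

theorem card_isTwoOfThree {V : Finset ℕ} {F : Finset (Finset ℕ)} (hn : 9 ≤ #V)
    (hF : IsTwoOfThree V 4 F) :
    #F + (#V - 4 - 1).choose (4 - 1) + (#V - 4 - 2).choose (4 - 2)
      = (#V - 1).choose (4 - 1) + 2 := by
  obtain ⟨T, hTV, hT, rfl⟩ := hF
  rw [card_filter_two_le_inter (by omega) hTV hT]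
  have := four_uniform_bound_eq #V hn
  rw [show #V - 4 - 1 = #V - 5 by omega, show #V - 4 - 2 = #V - 6 by omega]
  simp only [show 4 - 2 = 2 by rfl, show 4 - 1 = 3 by rfl, show 4 - 3 = 1 by rfl,
    Nat.choose_one_right]
  exact this

theorem card_isTripleOrStar {V : Finset ℕ} {F : Finset (Finset ℕ)} (hn : 9 ≤ #V)
    (hF : IsTripleOrStar V 4 F) :
    #F + (#V - 4 - 1).choose (4 - 1) + (#V - 4 - 2).choose (4 - 2)
      = (#V - 1).choose (4 - 1) + 2 := by
  obtain ⟨E, hEV, x, hx, hE, hxE, rfl⟩ := hF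
  rw [card_filter_subset_or_star le_rfl hEV hE hx hxE]
  have := four_uniform_bound_eq #V hn
  rw [show #V - 4 - 1 = #V - 5 by omega, show #V - 4 - 2 = #V - 6 by omega]
  rw [show #V - 3 = #V - 4 + 1 by omega, Nat.choose_succ_succ' (#V - 4) 1] at this
  simp only [show 4 - 2 = 2 by rfl, show 4 - 1 = 3 by rfl, show 4 - 3 = 1 by rfl,
    show 4 - 4 = 0 by rfl, Nat.choose_one_right, Nat.choose_zero_right, Nat.reduceAdd] at this ⊢
  omega

/-- Four-uniform families whose triple traces on a kernel are extremal. -/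
theorem isTwoOfThree_or_isTripleOrStar_of_trace {V Y : Finset ℕ} {F : Finset (Finset ℕ)}
    (hn : 9 ≤ #V) (hF : F ⊆ powersetCard 4 V) (hYV : Y ⊆ V) (hY : #Y = 8)
    {S : Finset (Finset ℕ)} (hS : S ⊆ powersetCard 3 Y)
    (hint : ∀ A ∈ S, ∀ B ∈ S, (A ∩ B).Nonempty)
    (hstar : ∀ x ∈ Y, ∃ A ∈ S, x ∉ A) (hc : 16 ≤ #S)
    (hSF : ∀ A ∈ S, ∀ B ∈ F, (A ∩ B).Nonempty)
    (hcard : #F + (#V - 4 - 1).choose (4 - 1) + (#V - 4 - 2).choose (4 - 2)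
      = (#V - 1).choose (4 - 1) + 2) :
    IsTwoOfThree V 4 F ∨ IsTripleOrStar V 4 F := by
  rcases three_uniform_eight hY hS hint hstar hc with ⟨T, hTY, hT, hST⟩ | ⟨E, hEY, x, hx, hE, hxE,
    hSE⟩
  · left
    have hsub : F ⊆ {A ∈ powersetCard 4 V | 2 ≤ #(A ∩ T)} := by
      intro B hB
      refine mem_filter.2 ⟨hF hB, ?_⟩
      by_contra! hlt
      have hle := card_sdiff_add_card_inter T B
      rw [inter_comm T B] at hle
      obtain ⟨P, hP, hPc⟩ := exists_subset_card_eq (show 2 ≤ #(T \ B) by omega)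
      have hPT : P ⊆ T := hP.trans sdiff_subset
      have hPB : Disjoint P B := disjoint_left.2 fun y hy => (mem_sdiff.1 (hP hy)).2
      have hu : ∃ u ∈ Y \ P, u ∉ B := by
        by_contra! h
        have h1 := card_le_card (show Y \ P ⊆ B from h)
        have h4 := (mem_powersetCard.1 (hF hB)).2
        have h5 := le_card_sdiff P Y
        omega
      obtain ⟨u, hu, huB⟩ := hu
      obtain ⟨huY, huP⟩ := mem_sdiff.1 hu
      have hm : insert u P ∈ S := by
        rw [hST]
        refine mem_filter.2 ⟨mem_powersetCard.2 ⟨insert_subset huY (hPT.trans hTY),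
          by rw [card_insert_of_notMem huP, hPc]⟩, ?_⟩
        rw [← hPc]
        exact card_le_card (subset_inter (subset_insert _ _) hPT)
      obtain ⟨y, hy⟩ := hSF _ hm B hB
      obtain ⟨hy1, hy2⟩ := mem_inter.1 hy
      rcases mem_insert.1 hy1 with rfl | hy1
      · exact huB hy2
      · exact disjoint_left.1 hPB hy1 hy2
    refine ⟨T, hTY.trans hYV, hT, eq_of_subset_of_card_le hsub ?_⟩
    have := card_isTwoOfThree hn ⟨T, hTY.trans hYV, hT, rfl⟩
    omega
  · right
    have hsub : F ⊆ {A ∈ powersetCard 4 V | E ⊆ A ∨ (x ∈ A ∧ (A ∩ E).Nonempty)} := by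
      intro B hB
      refine mem_filter.2 ⟨hF hB, ?_⟩
      have hEB : (E ∩ B).Nonempty := hSF E (hSE ▸ mem_insert_self _ _) B hB
      by_cases hxB : x ∈ B
      · exact Or.inr ⟨hxB, by rwa [inter_comm]⟩
      left
      by_contra hnot
      obtain ⟨e, heE, heB⟩ := not_subset.1 hnot
      have hP : #({x, e} : Finset ℕ) ≤ 2 := card_le_two
      have hu : ∃ u ∈ Y \ {x, e}, u ∉ B := by
        by_contra! h
        have h1 := card_le_card (show Y \ {x, e} ⊆ B from h)
        have h4 := (mem_powersetCard.1 (hF hB)).2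
        have h5 := le_card_sdiff {x, e} Y
        omega
      obtain ⟨u, hu, huB⟩ := hu
      simp only [mem_sdiff, mem_insert, mem_singleton, not_or] at hu
      have hxe : x ≠ e := fun h => hxE (h ▸ heE)
      have hm : ({u, x, e} : Finset ℕ) ∈ S := by
        rw [hSE]
        refine mem_insert_of_mem (mem_filter.2 ⟨mem_powersetCard.2 ⟨?_, ?_⟩, by simp,
          ⟨e, by simp [heE]⟩⟩)
        · intro y hy
          simp only [mem_insert, mem_singleton] at hy
          rcases hy with rfl | rfl | rfl
          exacts [hu.1, hx, hEY heE]
        · exact card_eq_three.2 ⟨u, x, e, hu.2.1, hu.2.2, hxe, rfl⟩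
      obtain ⟨y, hy⟩ := hSF _ hm B hB
      simp only [mem_inter, mem_insert, mem_singleton] at hy
      rcases hy with ⟨rfl | rfl | rfl, hy⟩
      exacts [huB hy, hxB hy, heB hy]
    refine ⟨E, hEY.trans hYV, x, hYV hx, hE, hxE, eq_of_subset_of_card_le hsub ?_⟩
    have := card_isTripleOrStar hn ⟨E, hEY.trans hYV, x, hYV hx, hE, hxE, rfl⟩
    omega

theorem sum_trace_bound {m d : ℕ} {a b : ℕ → ℕ}
    (h : ∀ j ≤ m, a j + (m + 1).choose (j + 1) + m.choose j
      ≤ b j + if j = m then 2 else 0) :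
    ∑ j ∈ range (m + 1), a j * d.choose (m - j)
        + ∑ j ∈ range (m + 1), (m + 1).choose (j + 1) * d.choose (m - j)
        + ∑ j ∈ range (m + 1), m.choose j * d.choose (m - j)
      ≤ ∑ j ∈ range (m + 1), b j * d.choose (m - j) + 2 := by
  have e : ∑ j ∈ range (m + 1), (if j = m then 2 else 0) * d.choose (m - j) = 2 := by
    rw [sum_eq_single m]
    · simp
    · intro j _ hj; simp [hj]
    · intro hm; simp at hm
  refine le_of_le_of_eq ?_ (congrArg (∑ j ∈ range (m + 1), b j * d.choose (m - j) + ·) e)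
  rw [← sum_add_distrib, ← sum_add_distrib]
  rw [← sum_add_distrib]
  refine sum_le_sum fun j hj => ?_
  rw [← add_mul, ← add_mul, ← add_mul]
  exact Nat.mul_le_mul_right _ (h j (by simpa [Nat.lt_succ_iff] using hj))

/-- Counting a family with an intersecting trace on a `2k`-set. -/
theorem secondLevelBound_of_kernel {V Y : Finset ℕ} {G : Finset (Finset ℕ)} {k : ℕ} (hk : 4 ≤ k)
    (hn : 2 * k + 1 ≤ #V) (hG : G ⊆ powersetCard k V) (hYV : Y ⊆ V) (hY : #Y = 2 * k)
    (hker : ∀ A ∈ G, ∀ B ∈ G, (A ∩ B ∩ Y).Nonempty)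
    (hdiv : ∀ x ∈ V, 3 ≤ #{A ∈ G | x ∉ A})
    (hHM : ∀ i, 3 ≤ i → i < k → HiltonMilnerBound i) : SecondLevelBound V k G := by
  obtain ⟨m, rfl⟩ : ∃ m, k = m + 2 := ⟨k - 2, by omega⟩
  obtain ⟨d, hd⟩ : ∃ d, #V = 2 * (m + 2) + d := ⟨#V - 2 * (m + 2), by omega⟩
  set S := G.image fun A => A ∩ Y with hS
  have hSY : ∀ T ∈ S, T ⊆ Y := by
    intro T hT
    obtain ⟨A, _, rfl⟩ := mem_image.1 hT
    exact inter_subset_right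
  have hSG : ∀ T ∈ S, ∀ B ∈ G, (T ∩ (B ∩ Y)).Nonempty := by
    intro T hT B hB
    obtain ⟨A, hA, rfl⟩ := mem_image.1 hT
    obtain ⟨y, hy⟩ := hker A hA B hB
    refine ⟨y, ?_⟩
    simp only [mem_inter] at hy ⊢
    tauto
  have hSS : ∀ T ∈ S, ∀ T' ∈ S, (T ∩ T').Nonempty := by
    intro T hT T' hT'
    obtain ⟨B, hB, rfl⟩ := mem_image.1 hT'
    exact hSG T hT B hB
  have hSle : ∀ T ∈ S, #T ≤ m + 2 := by
    intro T hT
    obtain ⟨A, hA, rfl⟩ := mem_image.1 hT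
    rw [← (mem_powersetCard.1 (hG hA)).2]
    exact card_le_card inter_subset_left
  have hSge : ∀ T ∈ S, 2 ≤ #T := by
    intro T hT
    have h1 := (hSS T hT T hT).card_pos
    rw [inter_self] at h1
    by_contra! h2
    obtain ⟨x, rfl⟩ := card_eq_one.1 (show #T = 1 by omega)
    have hxV : x ∈ V := hYV (hSY _ hT (mem_singleton_self x))
    have h3 := hdiv x hxV
    obtain ⟨B, hB⟩ := card_pos.1 (show 0 < #{A ∈ G | x ∉ A} by omega)
    obtain ⟨hB, hxB⟩ := mem_filter.1 hB
    obtain ⟨y, hy⟩ := hSG _ hT B hB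
    simp only [mem_inter, mem_singleton] at hy
    exact hxB (hy.1 ▸ hy.2.1)
  have hcount : #G ≤ ∑ j ∈ range (m + 1), #{T ∈ S | #T - 2 = j} * d.choose (m - j) := by
    have h1 : G ⊆ {A ∈ powersetCard (m + 2) V | A ∩ Y ∈ S} := fun A hA =>
      mem_filter.2 ⟨hG hA, mem_image_of_mem _ hA⟩
    refine (card_le_card h1).trans ?_
    rw [card_filter_inter_mem hYV S (fun T hT => mem_powerset.2 (hSY T hT)) hSle, hY,
      show #V - 2 * (m + 2) = d by omega,
      ← sum_fiberwise_of_maps_to (s := S) (t := range (m + 1)) (g := fun T => #T - 2)]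
    · refine le_of_eq (sum_congr rfl fun j _ => ?_)
      rw [sum_congr rfl (g := fun _ => d.choose (m - j)), sum_const, smul_eq_mul]
      intro T hT
      obtain ⟨hT, hTj⟩ := mem_filter.1 hT
      have := hSge T hT
      rw [show m + 2 - #T = m - j by omega]
    · intro T hT
      have := hSle T hT
      exact mem_range.2 (by omega)
  have hSj : ∀ j, {T ∈ S | #T - 2 = j} ⊆ powersetCard (j + 2) Y := by
    intro j T hT
    obtain ⟨hT, hTj⟩ := mem_filter.1 hT
    have := hSge T hT
    exact mem_powersetCard.2 ⟨hSY T hT, by omega⟩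
  have hSint : ∀ j, ∀ A ∈ ({T ∈ S | #T - 2 = j} : Finset (Finset ℕ)),
      ∀ B ∈ ({T ∈ S | #T - 2 = j} : Finset (Finset ℕ)), (A ∩ B).Nonempty := fun j A hA B hB =>
    hSS A (mem_filter.1 hA).1 B (mem_filter.1 hB).1
  have hstarlev : ∀ j < m, (∃ x ∈ Y, ∀ T ∈ S, #T - 2 = j → x ∈ T) →
      #{T ∈ S | #T - 2 = j} + (m + 1).choose (j + 1) + m.choose j + (if 1 ≤ j then 1 else 0)
        ≤ (2 * (m + 2) - 1).choose (j + 1) := by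
    rintro j hj ⟨x, hx, hxS⟩
    have h := card_star_trace_le (Y := Y) (x := x) (k := m + 2) (i := j + 2) (by omega) (by omega)
      hY hx (hSj j) (fun T hT => hxS T (mem_filter.1 hT).1 (mem_filter.1 hT).2) (by
        have hsub : ∀ B : Finset ℕ, x ∉ B → B ∩ Y ⊆ Y.erase x := fun B hxB y hy =>
          mem_erase.2 ⟨fun e => hxB (e ▸ (mem_inter.1 hy).1), (mem_inter.1 hy).2⟩
        by_cases hsmall : ∃ B ∈ G, x ∉ B ∧ #(B ∩ Y) + 1 ≤ m + 2
        · obtain ⟨B, hB, hxB, hBc⟩ := hsmall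
          exact Or.inl ⟨B ∩ Y, hsub B hxB, hBc, fun T hT => hSG T (mem_filter.1 hT).1 B hB⟩
        · right
          push Not at hsmall
          obtain ⟨B₁, B₂, B₃, h₁, h₂, h₃, n₁₂, n₁₃, n₂₃⟩ := two_lt_card_iff.1
            (show 2 < #{A ∈ G | x ∉ A} from hdiv x (hYV hx))
          rw [mem_filter] at h₁ h₂ h₃
          have hfull : ∀ B ∈ G, x ∉ B → B ∩ Y = B ∧ #B = m + 2 := fun B hB hxB => by
            have h1 := hsmall B hB hxB
            have h2 := (mem_powersetCard.1 (hG hB)).2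
            exact ⟨eq_of_subset_of_card_le inter_subset_left (by omega), h2⟩
          have f₁ := hfull B₁ h₁.1 h₁.2
          have f₂ := hfull B₂ h₂.1 h₂.2
          have f₃ := hfull B₃ h₃.1 h₃.2
          have s₁ := hsub B₁ h₁.2
          have s₂ := hsub B₂ h₂.2
          have s₃ := hsub B₃ h₃.2
          rw [f₁.1] at s₁
          rw [f₂.1] at s₂
          rw [f₃.1] at s₃
          refine ⟨B₁, s₁, B₂, s₂, B₃, s₃, f₁.2, f₂.2, f₃.2, n₁₂, n₁₃, n₂₃, fun T hT => ?_⟩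
          have a₁ := hSG T (mem_filter.1 hT).1 B₁ h₁.1
          have a₂ := hSG T (mem_filter.1 hT).1 B₂ h₂.1
          have a₃ := hSG T (mem_filter.1 hT).1 B₃ h₃.1
          rw [f₁.1] at a₁
          rw [f₂.1] at a₂
          rw [f₃.1] at a₃
          exact ⟨a₁, a₂, a₃⟩)
    simp only [show m + 2 - 1 = m + 1 by omega, show m + 2 - 2 = m by omega,
      show j + 2 - 1 = j + 1 by omega, show j + 2 - 2 = j by omega,
      show 3 ≤ j + 2 ↔ 1 ≤ j by omega] at h
    exact h
  have hnonlev : ∀ j < m, (∀ x ∈ Y, ∃ T ∈ S, #T - 2 = j ∧ x ∉ T) →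
      #{T ∈ S | #T - 2 = j} + (m + 1).choose (j + 1) + m.choose j
          + (if j + 1 = m ∧ 3 ≤ m then 1 else 0)
        ≤ (2 * (m + 2) - 1).choose (j + 1) := by
    intro j hj hx
    have h := card_nonstar_trace_le (Y := Y) (k := m + 2) (i := j + 2) hk (by omega) (by omega)
      (fun h3 => hHM _ h3 (by omega)) hY (hSj j) (hSint j) (fun x hxY => by
        obtain ⟨T, hT, h1, h2⟩ := hx x hxY
        exact ⟨T, mem_filter.2 ⟨hT, h1⟩, h2⟩)
    simp only [show m + 2 - 1 = m + 1 by omega, show m + 2 - 2 = m by omega,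
      show j + 2 - 1 = j + 1 by omega, show j + 2 - 2 = j by omega,
      show j + 2 + 1 = m + 2 ↔ j + 1 = m by omega, show 5 ≤ m + 2 ↔ 3 ≤ m by omega] at h
    exact h
  have hlev : ∀ j ≤ m, #{T ∈ S | #T - 2 = j} + (m + 1).choose (j + 1) + m.choose j
      ≤ (2 * (m + 2) - 1).choose (j + 1) + if j = m then 2 else 0 := by
    intro j hj
    rcases Nat.lt_or_ge j m with hjm | hjm
    · rw [if_neg (by omega)]
      by_cases hc : ∃ x ∈ Y, ∀ T ∈ S, #T - 2 = j → x ∈ T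
      · have := hstarlev j hjm hc
        omega
      · push Not at hc
        have := hnonlev j hjm hc
        omega
    · obtain rfl : j = m := by omega
      rw [if_pos rfl, Nat.choose_self, Nat.choose_self]
      have := card_intersecting_half_le (by omega) hY (hSj j) (hSint j)
      rw [show j + 2 - 1 = j + 1 by omega] at this
      omega
  have v1 := sum_choose_shift (2 * (m + 2) - 1) d m
  have v2 := sum_choose_shift (m + 1) d m
  have v3 := sum_choose_range m d m
  have c1 : #V - 1 = 2 * (m + 2) - 1 + d := by omega
  have c2 : #V - (m + 2) - 1 = m + 1 + d := by omega
  have c3 : #V - (m + 2) - 2 = m + d := by omega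
  unfold SecondLevelBound
  rw [c1, c2, c3, show m + 2 - 1 = m + 1 by omega, show m + 2 - 2 = m by omega]
  have hsum := sum_trace_bound (d := d) hlev
  refine ⟨by omega, fun heq => ?_⟩
  have htight : #{T ∈ S | #T - 2 = m - 1} + (m + 1).choose (m - 1 + 1) + m.choose (m - 1)
      = (2 * (m + 2) - 1).choose (m - 1 + 1) := by
    have h1 := hlev (m - 1) (by omega)
    rw [if_neg (by omega)] at h1
    by_contra hne
    have hsum' := sum_trace_bound (d := d) (m := m)
      (a := fun j => #{T ∈ S | #T - 2 = j} + if j = m - 1 then 1 else 0)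
      (b := fun j => (2 * (m + 2) - 1).choose (j + 1)) (by
        intro j hj
        by_cases hjm : j = m - 1
        · subst hjm
          rw [if_pos rfl, if_neg (by omega)]
          omega
        · have := hlev j hj
          rw [if_neg hjm]
          exact this)
    have e : ∑ j ∈ range (m + 1), (if j = m - 1 then 1 else 0) * d.choose (m - j) = d := by
      rw [sum_eq_single (m - 1)]
      · rw [if_pos rfl, one_mul, show m - (m - 1) = 1 by omega, Nat.choose_one_right]
      · intro j _ hj; simp [hj]
      · intro hm
        exact absurd (mem_range.2 (by omega)) hm
    simp only [add_mul, sum_add_distrib] at hsum'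
    rw [e] at hsum'
    omega
  have hns : ∀ x ∈ Y, ∃ T ∈ S, #T - 2 = m - 1 ∧ x ∉ T := by
    by_contra hc
    push Not at hc
    have := hstarlev (m - 1) (by omega) hc
    rw [if_pos (by omega)] at this
    omega
  have hm2 : m = 2 := by
    by_contra hm
    have := hnonlev (m - 1) (by omega) hns
    rw [if_pos (by omega)] at this
    omega
  subst hm2
  refine ⟨rfl, isTwoOfThree_or_isTripleOrStar_of_trace (by omega) hG hYV (by omega)
    (hSj 1) (hSint 1) (fun x hx => ?_) ?_ (fun A hA B hB => ?_) ?_⟩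
  · obtain ⟨T, hT, h1, h2⟩ := hns x hx
    exact ⟨T, mem_filter.2 ⟨hT, h1⟩, h2⟩
  · simp only [show 2 - 1 = 1 by rfl, show Nat.choose (2 + 1) (1 + 1) = 3 by decide,
      show Nat.choose 2 1 = 2 by decide,
      show Nat.choose (2 * (2 + 2) - 1) (1 + 1) = 21 by decide] at htight
    omega
  · exact (hSG A (mem_filter.1 hA).1 B hB).mono
      (inter_subset_inter le_rfl inter_subset_left)
  · rw [c1, show #V - 4 - 1 = 2 + 1 + d by omega, show #V - 4 - 2 = 2 + d by omega]
    exact heq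

theorem mem_image_swap {i j x : ℕ} {A : Finset ℕ} :
    x ∈ A.image (Equiv.swap i j) ↔ Equiv.swap i j x ∈ A := by
  constructor
  · intro h
    obtain ⟨y, hy, rfl⟩ := mem_image.1 h
    simpa using hy
  · intro h
    exact mem_image.2 ⟨_, h, by simp⟩

theorem image_swap_image_swap (i j : ℕ) (A : Finset ℕ) :
    (A.image (Equiv.swap i j)).image (Equiv.swap i j) = A := by
  ext x
  simp

theorem image_swap_of_iff {i j : ℕ} {A : Finset ℕ} (h : i ∈ A ↔ j ∈ A) :
    A.image (Equiv.swap i j) = A := by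
  ext x
  rw [mem_image_swap, Equiv.swap_apply_def]
  grind

theorem image_swap_of_left {i j : ℕ} {A : Finset ℕ} (hi : i ∈ A) (hj : j ∉ A) :
    A.image (Equiv.swap i j) = insert j (A.erase i) := by
  ext x
  rw [mem_image_swap, Equiv.swap_apply_def]
  grind

theorem image_swap_of_right {i j : ℕ} {A : Finset ℕ} (hi : i ∉ A) (hj : j ∈ A) :
    A.image (Equiv.swap i j) = insert i (A.erase j) := by
  ext x
  rw [mem_image_swap, Equiv.swap_apply_def]
  grind

/-- If the sets moved only by the shift form a connected system, the shift is undone by a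
transposition or did nothing. -/
theorem eq_shift_or_swap {i j : ℕ} {F : Finset (Finset ℕ)}
    (hint : ∀ A ∈ F, ∀ B ∈ F, (A ∩ B).Nonempty)
    (hconn : ∀ p : Finset ℕ → Prop,
      (∀ A ∈ shift i j F, i ∈ A → j ∉ A → A.image (Equiv.swap i j) ∉ shift i j F →
        ∀ B ∈ shift i j F, i ∈ B → j ∉ B → B.image (Equiv.swap i j) ∉ shift i j F →
          A ∩ B = {i} → p A → p B) →
      ∀ A ∈ shift i j F, i ∈ A → j ∉ A → A.image (Equiv.swap i j) ∉ shift i j F →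
        ∀ B ∈ shift i j F, i ∈ B → j ∉ B → B.image (Equiv.swap i j) ∉ shift i j F → p A → p B) :
    F = shift i j F ∨ ∀ A, A ∈ F ↔ A.image (Equiv.swap i j) ∈ shift i j F := by
  have hback : ∀ A, i ∈ A → j ∉ A → A.image (Equiv.swap i j) ∈ shift i j F →
      A ∈ F ∧ A.image (Equiv.swap i j) ∈ F := by
    intro A hi hj h
    have hij : i ≠ j := by rintro rfl; exact hj hi
    have e := image_swap_of_left hi hj
    rw [e] at h ⊢
    have h' := (mem_shift_right (by simp [hij]) (by simp)).1 h
    rw [erase_insert (by simp [hj]), insert_erase hi] at h'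
    exact ⟨h'.2, h'.1⟩
  have hmem : ∀ A ∈ shift i j F, i ∈ A → j ∉ A → A ∉ F → A.image (Equiv.swap i j) ∈ F := by
    intro A hA hi hj hAF
    rw [image_swap_of_left hi hj]
    exact ((mem_shift_left hi hj).1 hA).resolve_left hAF
  have hc := hconn (fun A => A ∈ F) (by
    intro A hA hiA hjA hAn B hB hiB hjB hBn hAB hAF
    by_contra hBF
    have hB' := hmem B hB hiB hjB hBF
    rw [image_swap_of_left hiB hjB] at hB'
    obtain ⟨y, hy⟩ := hint A hAF _ hB'
    simp only [mem_inter, mem_insert, mem_erase] at hy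
    rcases hy with ⟨hyA, rfl | ⟨hyi, hyB⟩⟩
    · exact hjA hyA
    · have : y ∈ A ∩ B := mem_inter.2 ⟨hyA, hyB⟩
      rw [hAB] at this
      exact hyi (mem_singleton.1 this))
  by_cases hall : ∀ A ∈ shift i j F, i ∈ A → j ∉ A → A.image (Equiv.swap i j) ∉ shift i j F → A ∈ F
  · left
    refine (eq_of_subset_of_card_le ?_ (card_shift i j F).ge).symm
    intro A hA
    by_cases h : i ∈ A ↔ j ∈ A
    · exact (mem_shift_of_iff h).1 hA
    by_cases hiA : i ∈ A
    · have hjA : j ∉ A := by tauto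
      by_cases h' : A.image (Equiv.swap i j) ∈ shift i j F
      · exact (hback A hiA hjA h').1
      · exact hall A hA hiA hjA h'
    · exact ((mem_shift_right hiA (by tauto)).1 hA).1
  · right
    push Not at hall
    obtain ⟨A₀, hA₀, hi₀, hj₀, hn₀, hF₀⟩ := hall
    have hnone : ∀ A ∈ shift i j F, i ∈ A → j ∉ A → A.image (Equiv.swap i j) ∉ shift i j F →
        A ∉ F := fun A hA hi hj hn hAF => hF₀ (hc A hA hi hj hn A₀ hA₀ hi₀ hj₀ hn₀ hAF)
    intro A
    by_cases h : i ∈ A ↔ j ∈ A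
    · rw [image_swap_of_iff h, mem_shift_of_iff h]
    by_cases hiA : i ∈ A
    · have hjA : j ∉ A := by tauto
      constructor
      · intro hAF
        by_contra hn
        exact hnone A ((mem_shift_left hiA hjA).2 (Or.inl hAF)) hiA hjA hn hAF
      · exact fun h' => (hback A hiA hjA h').1
    · have hjA : j ∈ A := by tauto
      have hij : i ≠ j := by rintro rfl; exact hiA hjA
      have e := image_swap_of_right hiA hjA
      have hi' : i ∈ A.image (Equiv.swap i j) := by rw [e]; simp
      have hj' : j ∉ A.image (Equiv.swap i j) := by rw [e]; simp [hij.symm]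
      have e2 := image_swap_image_swap i j A
      constructor
      · intro hAF
        rw [mem_shift_left hi' hj', ← image_swap_of_left hi' hj', e2]
        exact Or.inr hAF
      · intro h'
        by_cases hn : A ∈ shift i j F
        · exact ((mem_shift_right hiA hjA).1 hn).1
        · have h1 := hnone _ h' hi' hj' (by rwa [e2])
          have h2 := hmem _ h' hi' hj' h1
          rwa [e2] at h2

theorem powersetCard_swap_iff {V A : Finset ℕ} {i j k : ℕ} (hi : i ∈ V) (hj : j ∈ V) :
    A.image (Equiv.swap i j) ∈ powersetCard k V ↔ A ∈ powersetCard k V := by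
  have hs : ∀ B ∈ powersetCard k V, B.image (Equiv.swap i j) ∈ powersetCard k V := by
    intro B hB
    obtain ⟨h1, h2⟩ := mem_powersetCard.1 hB
    refine mem_powersetCard.2 ⟨fun x hx => ?_, ?_⟩
    · rw [mem_image_swap] at hx
      by_cases hxi : x = i
      · exact hxi ▸ hi
      by_cases hxj : x = j
      · exact hxj ▸ hj
      rw [Equiv.swap_apply_of_ne_of_ne hxi hxj] at hx
      exact h1 hx
    · rw [card_image_of_injective _ (Equiv.injective _), h2]
  exact ⟨fun h => by simpa only [image_swap_image_swap] using hs _ h, hs A⟩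

theorem isTwoOfThree_of_swap {V : Finset ℕ} {F G : Finset (Finset ℕ)} {i j k : ℕ} (hi : i ∈ V)
    (hj : j ∈ V) (hG : IsTwoOfThree V k G)
    (h : ∀ A, A ∈ F ↔ A.image (Equiv.swap i j) ∈ G) : IsTwoOfThree V k F := by
  obtain ⟨T, hTV, hT, rfl⟩ := hG
  have hTp := (powersetCard_swap_iff (k := 3) hi hj).2 (mem_powersetCard.2 ⟨hTV, hT⟩)
  refine ⟨T.image (Equiv.swap i j), (mem_powersetCard.1 hTp).1, (mem_powersetCard.1 hTp).2, ?_⟩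
  ext A
  rw [h, mem_filter, mem_filter, powersetCard_swap_iff hi hj]
  have : #(A.image (Equiv.swap i j) ∩ T) = #(A ∩ T.image (Equiv.swap i j)) := by
    rw [← card_image_of_injective _ (Equiv.injective (Equiv.swap i j)),
      image_inter _ _ (Equiv.injective _), image_swap_image_swap]
  rw [this]

theorem isTripleOrStar_of_swap {V : Finset ℕ} {F G : Finset (Finset ℕ)} {i j k : ℕ} (hi : i ∈ V)
    (hj : j ∈ V) (hG : IsTripleOrStar V k G)
    (h : ∀ A, A ∈ F ↔ A.image (Equiv.swap i j) ∈ G) : IsTripleOrStar V k F := by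
  obtain ⟨E, hEV, x, hx, hE, hxE, rfl⟩ := hG
  have hEp := (powersetCard_swap_iff (k := 3) hi hj).2 (mem_powersetCard.2 ⟨hEV, hE⟩)
  have hxp := (powersetCard_swap_iff (A := {x}) (k := 1) hi hj).2
    (mem_powersetCard.2 ⟨by simpa using hx, by simp⟩)
  rw [image_singleton, mem_powersetCard, singleton_subset_iff] at hxp
  refine ⟨E.image (Equiv.swap i j), (mem_powersetCard.1 hEp).1, Equiv.swap i j x, hxp.1,
    (mem_powersetCard.1 hEp).2, by simpa [mem_image_swap] using hxE, ?_⟩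
  ext A
  rw [h, mem_filter, mem_filter, powersetCard_swap_iff hi hj, mem_image_swap]
  have e1 : E ⊆ A.image (Equiv.swap i j) ↔ E.image (Equiv.swap i j) ⊆ A := by
    conv_rhs => rw [← image_swap_image_swap i j A]
    rw [image_subset_image_iff (Equiv.injective _)]
  have e2 : (A.image (Equiv.swap i j) ∩ E).Nonempty ↔ (A ∩ E.image (Equiv.swap i j)).Nonempty := by
    rw [← image_nonempty (f := Equiv.swap i j) (s := A.image (Equiv.swap i j) ∩ E),
      image_inter _ _ (Equiv.injective _), image_swap_image_swap]
  rw [e1, e2]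

theorem pair_chain {W : Finset ℕ} {α : Finset ℕ → Prop}
    (h : ∀ P ∈ powersetCard 2 W, ∀ Q ∈ powersetCard 2 W, #(P ∪ Q) ≤ 3 → α P → α Q) :
    ∀ P ∈ powersetCard 2 W, ∀ Q ∈ powersetCard 2 W, α P → α Q := by
  intro P hP Q hQ hα
  obtain ⟨hPW, hPc⟩ := mem_powersetCard.1 hP
  obtain ⟨hQW, hQc⟩ := mem_powersetCard.1 hQ
  obtain ⟨p, q, hpq, rfl⟩ := card_eq_two.1 hPc
  obtain ⟨r, s, hrs, rfl⟩ := card_eq_two.1 hQc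
  by_cases hd : p = r
  · refine h _ hP _ hQ ?_ hα
    subst hd
    have : ({p, q} ∪ {p, s} : Finset ℕ) ⊆ {p, q, s} := by intro x; simp
    exact (card_le_card this).trans card_le_three
  · have hR : ({p, r} : Finset ℕ) ∈ powersetCard 2 W :=
      mem_powersetCard.2 ⟨by
        intro x hx
        simp only [mem_insert, mem_singleton] at hx
        rcases hx with rfl | rfl
        · exact hPW (by simp)
        · exact hQW (by simp), card_pair hd⟩
    refine h _ hR _ hQ ?_ (h _ hP _ hR ?_ hα)
    · have : ({p, r} ∪ {r, s} : Finset ℕ) ⊆ {p, r, s} := by intro x; simp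
      exact (card_le_card this).trans card_le_three
    · have : ({p, q} ∪ {p, r} : Finset ℕ) ⊆ {p, q, r} := by intro x; simp
      exact (card_le_card this).trans card_le_three

theorem exists_pair_disjoint {W S : Finset ℕ} (h : #S + 2 ≤ #W) :
    ∃ P ∈ powersetCard 2 W, Disjoint P S := by
  obtain ⟨P, hP, hPc⟩ := exists_subset_card_eq (show 2 ≤ #(W \ S) by
    have := le_card_sdiff S W
    omega)
  exact ⟨P, mem_powersetCard.2 ⟨hP.trans sdiff_subset, hPc⟩,
    disjoint_left.2 fun x hx => (mem_sdiff.1 (hP hx)).2⟩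

theorem pair_colouring {W : Finset ℕ} (hW : 5 ≤ #W) {α β : Finset ℕ → Prop}
    (h : ∀ P ∈ powersetCard 2 W, ∀ Q ∈ powersetCard 2 W, Disjoint P Q → (α P ↔ β Q)) :
    ∀ P ∈ powersetCard 2 W, ∀ Q ∈ powersetCard 2 W,
      (α P ↔ α Q) ∧ (β P ↔ β Q) ∧ (α P ↔ β Q) := by
  have hα : ∀ P ∈ powersetCard 2 W, ∀ Q ∈ powersetCard 2 W, α P → α Q := by
    refine pair_chain fun P hP Q hQ hPQ hαP => ?_
    obtain ⟨R, hR, hd⟩ := exists_pair_disjoint (W := W) (S := P ∪ Q) (by omega)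
    rw [disjoint_union_right] at hd
    exact (h Q hQ R hR hd.2.symm).2 ((h P hP R hR hd.1.symm).1 hαP)
  have hβ : ∀ P ∈ powersetCard 2 W, ∀ Q ∈ powersetCard 2 W, β P → β Q := by
    refine pair_chain fun P hP Q hQ hPQ hβP => ?_
    obtain ⟨R, hR, hd⟩ := exists_pair_disjoint (W := W) (S := P ∪ Q) (by omega)
    rw [disjoint_union_right] at hd
    exact (h R hR Q hQ hd.2).1 ((h R hR P hP hd.1).2 hβP)
  intro P hP Q hQ
  refine ⟨⟨hα P hP Q hQ, hα Q hQ P hP⟩, ⟨hβ P hP Q hQ, hβ Q hQ P hP⟩, ?_⟩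
  obtain ⟨R, hR, hd⟩ := exists_pair_disjoint (W := W) (S := P) (by
    rw [(mem_powersetCard.1 hP).2]; omega)
  rw [h P hP R hR hd.symm]
  exact ⟨hβ R hR Q hQ, hβ Q hQ R hR⟩

theorem connected_of_two_links {V : Finset ℕ} {i j a b : ℕ} (hn : 9 ≤ #V) (hi : i ∈ V)
    (ha : a ∈ V) (hb : b ∈ V) (hij : i ≠ j) (hia : i ≠ a) (hib : i ≠ b) (hja : j ≠ a)
    (hjb : j ≠ b) (hab : a ≠ b) {p : Finset ℕ → Prop}
    (hp : ∀ A ∈ powersetCard 4 V, i ∈ A → j ∉ A → (a ∈ A ↔ b ∉ A) →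
      ∀ B ∈ powersetCard 4 V, i ∈ B → j ∉ B → (a ∈ B ↔ b ∉ B) → A ∩ B = {i} → p A → p B) :
    ∀ A ∈ powersetCard 4 V, i ∈ A → j ∉ A → (a ∈ A ↔ b ∉ A) →
      ∀ B ∈ powersetCard 4 V, i ∈ B → j ∉ B → (a ∈ B ↔ b ∉ B) → p A → p B := by
  set W := V \ {i, j, a, b} with hWdef
  have hW : 5 ≤ #W := by
    have h1 := le_card_sdiff ({i, j, a, b} : Finset ℕ) V
    have h2 : #({i, j, a, b} : Finset ℕ) ≤ 4 := card_le_four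
    rw [hWdef]
    omega
  have hdec : ∀ A ∈ powersetCard 4 V, i ∈ A → j ∉ A → (a ∈ A ↔ b ∉ A) →
      ∃ P ∈ powersetCard 2 W, A = insert i (insert a P) ∨ A = insert i (insert b P) := by
    intro A hA hiA hjA habA
    obtain ⟨hAV, hAc⟩ := mem_powersetCard.1 hA
    have main : ∀ c, c ∈ A → i ≠ c → (∀ d, d = a ∨ d = b → d ≠ c → d ∉ A) →
        (A.erase i).erase c ∈ powersetCard 2 W ∧ A = insert i (insert c ((A.erase i).erase c)) := by
      intro c hc hic hd
      refine ⟨mem_powersetCard.2 ⟨fun y hy => ?_, ?_⟩, ?_⟩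
      · simp only [mem_erase] at hy
        simp only [hWdef, mem_sdiff, mem_insert, mem_singleton, not_or]
        refine ⟨hAV hy.2.2, hy.2.1, fun h => hjA (h ▸ hy.2.2), fun h => ?_, fun h => ?_⟩
        · exact hd y (Or.inl h) hy.1 hy.2.2
        · exact hd y (Or.inr h) hy.1 hy.2.2
      · rw [card_erase_of_mem (mem_erase.2 ⟨hic.symm, hc⟩), card_erase_of_mem hiA, hAc]
      · rw [insert_erase (mem_erase.2 ⟨hic.symm, hc⟩), insert_erase hiA]
    by_cases haA : a ∈ A
    · have h := main a haA hia (by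
        rintro d (rfl | rfl) hd
        · exact absurd rfl hd
        · exact habA.1 haA)
      exact ⟨_, h.1, Or.inl h.2⟩
    · have hbA : b ∈ A := by tauto
      have h := main b hbA hib (by
        rintro d (rfl | rfl) hd
        · exact haA
        · exact absurd rfl hd)
      exact ⟨_, h.1, Or.inr h.2⟩
  have hWn : ∀ P ∈ powersetCard 2 W, i ∉ P ∧ j ∉ P ∧ a ∉ P ∧ b ∉ P ∧ P ⊆ V ∧ #P = 2 := by
    intro P hP
    obtain ⟨h1, h2⟩ := mem_powersetCard.1 hP
    have hx : ∀ x, x ∈ P → x ∈ V ∧ x ≠ i ∧ x ≠ j ∧ x ≠ a ∧ x ≠ b := fun x hx => by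
      simpa [hWdef] using h1 hx
    exact ⟨fun h => (hx _ h).2.1 rfl, fun h => (hx _ h).2.2.1 rfl, fun h => (hx _ h).2.2.2.1 rfl,
      fun h => (hx _ h).2.2.2.2 rfl, fun x h => (hx x h).1, h2⟩
  have hbuild : ∀ c ∈ V, i ≠ c → j ≠ c → ∀ P ∈ powersetCard 2 W, c ∉ P →
      insert i (insert c P) ∈ powersetCard 4 V ∧ i ∈ insert i (insert c P) ∧
        j ∉ insert i (insert c P) := by
    intro c hc hic hjc P hP hcP
    obtain ⟨h1, h2, -, -, h5, h6⟩ := hWn P hP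
    refine ⟨mem_powersetCard.2 ⟨insert_subset hi (insert_subset hc h5), ?_⟩, mem_insert_self _ _, ?_⟩
    · rw [card_insert_of_notMem (by simp [hic, h1]), card_insert_of_notMem hcP, h6]
    · simp [hij.symm, hjc, h2]
  have hba : ∀ P ∈ powersetCard 2 W, insert i (insert a P) ∈ powersetCard 4 V ∧
      i ∈ insert i (insert a P) ∧ j ∉ insert i (insert a P) ∧
      (a ∈ insert i (insert a P) ↔ b ∉ insert i (insert a P)) := by
    intro P hP
    obtain ⟨h1, h2, h3, h4, h5, h6⟩ := hWn P hP
    obtain ⟨g1, g2, g3⟩ := hbuild a ha hia hja P hP h3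
    exact ⟨g1, g2, g3, by simp [hib.symm, hab.symm, h4]⟩
  have hbb : ∀ P ∈ powersetCard 2 W, insert i (insert b P) ∈ powersetCard 4 V ∧
      i ∈ insert i (insert b P) ∧ j ∉ insert i (insert b P) ∧
      (a ∈ insert i (insert b P) ↔ b ∉ insert i (insert b P)) := by
    intro P hP
    obtain ⟨h1, h2, h3, h4, h5, h6⟩ := hWn P hP
    obtain ⟨g1, g2, g3⟩ := hbuild b hb hib hjb P hP h4
    exact ⟨g1, g2, g3, by simp [hia.symm, hab, h3]⟩
  have hcol := pair_colouring hW (α := fun P => p (insert i (insert a P)))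
    (β := fun P => p (insert i (insert b P))) (by
      intro P hP Q hQ hPQ
      obtain ⟨p1, p2, p3, p4⟩ := hba P hP
      obtain ⟨q1, q2, q3, q4⟩ := hbb Q hQ
      have hP' := hWn P hP
      have hQ' := hWn Q hQ
      have e : insert i (insert a P) ∩ insert i (insert b Q) = {i} := by
        ext y
        have hd : y ∈ P → y ∉ Q := fun h => disjoint_left.1 hPQ h
        simp only [mem_inter, mem_insert, mem_singleton]
        grind
      exact ⟨hp _ p1 p2 p3 p4 _ q1 q2 q3 q4 e,
        hp _ q1 q2 q3 q4 _ p1 p2 p3 p4 (by rw [inter_comm, e])⟩)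
  intro A hA hiA hjA habA B hB hiB hjB habB
  obtain ⟨P, hP, hAP⟩ := hdec A hA hiA hjA habA
  obtain ⟨Q, hQ, hBQ⟩ := hdec B hB hiB hjB habB
  obtain ⟨c1, c2, c3⟩ := hcol P hP Q hQ
  obtain ⟨-, -, c4⟩ := hcol Q hQ P hP
  rcases hAP with rfl | rfl <;> rcases hBQ with rfl | rfl
  exacts [c1.1, c3.1, c4.2, c2.1]

/-- Sets through `i` avoiding `j` that meet a triple `E` without containing it. -/
theorem connected_of_star {V E : Finset ℕ} {i j : ℕ} (hn : 9 ≤ #V) (hi : i ∈ V)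
    (hEV : E ⊆ V) (hE : #E = 3) (hij : i ≠ j) (hiE : i ∉ E) (hjE : j ∉ E) {p : Finset ℕ → Prop}
    (hp : ∀ A ∈ powersetCard 4 V, i ∈ A → j ∉ A → (A ∩ E).Nonempty → ¬ E ⊆ A →
      ∀ B ∈ powersetCard 4 V, i ∈ B → j ∉ B → (B ∩ E).Nonempty → ¬ E ⊆ B →
        A ∩ B = {i} → p A → p B) :
    ∀ A ∈ powersetCard 4 V, i ∈ A → j ∉ A → (A ∩ E).Nonempty → ¬ E ⊆ A →
      ∀ B ∈ powersetCard 4 V, i ∈ B → j ∉ B → (B ∩ E).Nonempty → ¬ E ⊆ B → p A → p B := by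
  set W := V \ insert i (insert j E) with hWdef
  have hW : 4 ≤ #W := by
    have h1 := le_card_sdiff (insert i (insert j E)) V
    have h2 := card_insert_le i (insert j E)
    have h3 := card_insert_le j E
    rw [hWdef]
    omega
  have hWm : ∀ y, y ∈ W → y ∈ V ∧ y ≠ i ∧ y ≠ j ∧ y ∉ E := fun y hy => by
    simpa [hWdef] using hy
  have hsingle : ∀ e ∈ E, ∀ P ∈ powersetCard 2 W, insert i (insert e P) ∈ powersetCard 4 V ∧
      i ∈ insert i (insert e P) ∧ j ∉ insert i (insert e P) ∧
      (insert i (insert e P) ∩ E).Nonempty ∧ ¬ E ⊆ insert i (insert e P) := by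
    intro e he P hP
    obtain ⟨hPW, hPc⟩ := mem_powersetCard.1 hP
    have h1 : i ∉ insert e P := by
      simp only [mem_insert, not_or]
      exact ⟨fun h => hiE (h ▸ he), fun h => (hWm i (hPW h)).2.1 rfl⟩
    have h2 : e ∉ P := fun h => (hWm e (hPW h)).2.2.2 he
    refine ⟨mem_powersetCard.2 ⟨insert_subset hi (insert_subset (hEV he)
      fun y hy => (hWm y (hPW hy)).1), ?_⟩, mem_insert_self _ _, ?_, ⟨e, by simp [he]⟩, ?_⟩
    · rw [card_insert_of_notMem h1, card_insert_of_notMem h2, hPc]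
    · simp only [mem_insert, not_or]
      exact ⟨hij.symm, fun h => hjE (h ▸ he), fun h => (hWm j (hPW h)).2.2.1 rfl⟩
    · intro h
      have h3 : E ⊆ {e} := by
        intro y hy
        have := h hy
        simp only [mem_insert] at this
        rcases this with rfl | rfl | h'
        · exact absurd hy hiE
        · exact mem_singleton_self _
        · exact absurd hy (hWm y (hPW h')).2.2.2
      have := card_le_card h3
      rw [hE, card_singleton] at this
      omega
  have hdouble : ∀ e ∈ E, ∀ w ∈ W, insert i (insert w (E.erase e)) ∈ powersetCard 4 V ∧
      i ∈ insert i (insert w (E.erase e)) ∧ j ∉ insert i (insert w (E.erase e)) ∧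
      (insert i (insert w (E.erase e)) ∩ E).Nonempty ∧ ¬ E ⊆ insert i (insert w (E.erase e)) := by
    intro e he w hw
    obtain ⟨hwV, hwi, hwj, hwE⟩ := hWm w hw
    have hc : #(E.erase e) = 2 := by rw [card_erase_of_mem he, hE]
    have h1 : i ∉ insert w (E.erase e) := by simp [hwi.symm, hiE]
    have h2 : w ∉ E.erase e := by simp [hwE]
    refine ⟨mem_powersetCard.2 ⟨insert_subset hi (insert_subset hwV
      ((erase_subset _ _).trans hEV)), ?_⟩, mem_insert_self _ _, ?_, ?_, ?_⟩
    · rw [card_insert_of_notMem h1, card_insert_of_notMem h2, hc]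
    · simp [hij.symm, hwj.symm, hjE]
    · obtain ⟨y, hy⟩ := card_pos.1 (show 0 < #(E.erase e) by omega)
      refine ⟨y, ?_⟩
      have := (mem_erase.1 hy)
      simp [this.1, this.2]
    · intro h
      have := h he
      simp only [mem_insert, mem_erase] at this
      rcases this with rfl | rfl | h'
      · exact hiE he
      · exact hwE he
      · exact h'.1 rfl
  have hsd : ∀ e ∈ E, ∀ P ∈ powersetCard 2 W, ∀ w ∈ W, w ∉ P →
      (p (insert i (insert e P)) ↔ p (insert i (insert w (E.erase e)))) := by
    intro e he P hP w hw hwP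
    obtain ⟨p1, p2, p3, p4, p5⟩ := hsingle e he P hP
    obtain ⟨q1, q2, q3, q4, q5⟩ := hdouble e he w hw
    have hPW := (mem_powersetCard.1 hP).1
    have hew : e ≠ w := fun h => (hWm w hw).2.2.2 (h ▸ he)
    have hx : insert i (insert e P) ∩ insert i (insert w (E.erase e)) = {i} := by
      ext y
      have hd : y ∈ P → y ∉ E := fun h => (hWm y (hPW h)).2.2.2
      simp only [mem_inter, mem_insert, mem_singleton, mem_erase]
      grind
    exact ⟨hp _ p1 p2 p3 p4 p5 _ q1 q2 q3 q4 q5 hx,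
      hp _ q1 q2 q3 q4 q5 _ p1 p2 p3 p4 p5 (by rw [inter_comm, hx])⟩
  have hss : ∀ e ∈ E, ∀ P ∈ powersetCard 2 W, ∀ Q ∈ powersetCard 2 W,
      p (insert i (insert e P)) → p (insert i (insert e Q)) := by
    intro e he
    refine pair_chain (α := fun P => p (insert i (insert e P))) fun P hP Q hQ hPQ h => ?_
    obtain ⟨w, hw⟩ := card_pos.1 (show 0 < #(W \ (P ∪ Q)) by
      have := le_card_sdiff (P ∪ Q) W
      omega)
    simp only [mem_sdiff, mem_union, not_or] at hw
    exact (hsd e he Q hQ w hw.1 hw.2.2).2 ((hsd e he P hP w hw.1 hw.2.1).1 h)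
  have hall : ∀ e ∈ E, ∀ P ∈ powersetCard 2 W, ∀ e' ∈ E, ∀ Q ∈ powersetCard 2 W,
      p (insert i (insert e P)) → p (insert i (insert e' Q)) := by
    intro e he P hP e' he' Q hQ h
    by_cases hee : e = e'
    · subst hee
      exact hss e he P hP Q hQ h
    obtain ⟨R, hR, hd⟩ := exists_pair_disjoint (W := W) (S := P) (by
      rw [(mem_powersetCard.1 hP).2]; omega)
    obtain ⟨p1, p2, p3, p4, p5⟩ := hsingle e he P hP
    obtain ⟨q1, q2, q3, q4, q5⟩ := hsingle e' he' R hR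
    refine hss e' he' R hR Q hQ (hp _ p1 p2 p3 p4 p5 _ q1 q2 q3 q4 q5 ?_ h)
    have hPW := (mem_powersetCard.1 hP).1
    have hRW := (mem_powersetCard.1 hR).1
    ext y
    have hd1 : y ∈ P → y ∉ E := fun h => (hWm y (hPW h)).2.2.2
    have hd2 : y ∈ R → y ∉ E := fun h => (hWm y (hRW h)).2.2.2
    have hd3 : y ∈ R → y ∉ P := fun h => disjoint_left.1 hd h
    simp only [mem_inter, mem_insert, mem_singleton]
    grind
  have hdec : ∀ A ∈ powersetCard 4 V, i ∈ A → j ∉ A → (A ∩ E).Nonempty → ¬ E ⊆ A →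
      (∃ e ∈ E, ∃ P ∈ powersetCard 2 W, A = insert i (insert e P)) ∨
      ∃ e ∈ E, ∃ w ∈ W, A = insert i (insert w (E.erase e)) := by
    intro A hA hiA hjA hAE hEA
    obtain ⟨hAV, hAc⟩ := mem_powersetCard.1 hA
    have h1 := hAE.card_pos
    have h2 : #(A ∩ E) < 3 := by
      rw [← hE]
      refine card_lt_card ⟨inter_subset_right, fun h => hEA (h.trans inter_subset_left)⟩
    have h3 := card_sdiff_add_card_inter (A.erase i) E
    rw [erase_inter, erase_eq_of_notMem (s := A ∩ E) (by simp [hiE]), card_erase_of_mem hiA,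
      hAc] at h3
    have hsub : A.erase i \ E ⊆ W := by
      intro y hy
      simp only [mem_sdiff, mem_erase] at hy
      simp only [hWdef, mem_sdiff, mem_insert, not_or]
      exact ⟨hAV hy.1.2, hy.1.1, fun h => hjA (h ▸ hy.1.2), hy.2⟩
    have hre : A = insert i ((A.erase i \ E) ∪ A ∩ E) := by
      ext y
      simp only [mem_insert, mem_union, mem_sdiff, mem_erase, mem_inter]
      grind
    rcases (show #(A ∩ E) = 1 ∨ #(A ∩ E) = 2 by omega) with hc | hc
    · left
      obtain ⟨e, he⟩ := card_eq_one.1 hc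
      refine ⟨e, (mem_inter.1 (he ▸ mem_singleton_self e)).2, A.erase i \ E,
        mem_powersetCard.2 ⟨hsub, by omega⟩, ?_⟩
      rw [he, union_comm, ← insert_eq] at hre
      exact hre
    · right
      obtain ⟨w, hw⟩ := card_eq_one.1 (show #(A.erase i \ E) = 1 by omega)
      obtain ⟨e, he⟩ := card_eq_one.1 (show #(E \ A) = 1 by
        have := card_sdiff_add_card_inter E A
        rw [inter_comm E A] at this
        omega)
      refine ⟨e, (mem_sdiff.1 (he ▸ mem_singleton_self e)).1, w,
        hsub (hw ▸ mem_singleton_self w), ?_⟩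
      have e3 : A ∩ E = E.erase e := by
        rw [← sdiff_singleton_eq_erase, ← he]
        ext y
        simp only [mem_inter, mem_sdiff]
        tauto
      rw [hw, e3, ← insert_eq] at hre
      exact hre
  have hred : ∀ A ∈ powersetCard 4 V, i ∈ A → j ∉ A → (A ∩ E).Nonempty → ¬ E ⊆ A →
      ∃ e ∈ E, ∃ P ∈ powersetCard 2 W, p A ↔ p (insert i (insert e P)) := by
    intro A hA hiA hjA hAE hEA
    rcases hdec A hA hiA hjA hAE hEA with ⟨e, he, P, hP, rfl⟩ | ⟨e, he, w, hw, rfl⟩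
    · exact ⟨e, he, P, hP, Iff.rfl⟩
    · obtain ⟨P, hP, hd⟩ := exists_pair_disjoint (W := W) (S := {w}) (by
        rw [card_singleton]; omega)
      exact ⟨e, he, P, hP, (hsd e he P hP w hw fun h =>
        disjoint_left.1 hd h (mem_singleton_self w)).symm⟩
  intro A hA hiA hjA hAE hEA B hB hiB hjB hBE hEB h
  obtain ⟨e, he, P, hP, hAP⟩ := hred A hA hiA hjA hAE hEA
  obtain ⟨e', he', Q, hQ, hBQ⟩ := hred B hB hiB hjB hBE hEB
  exact hBQ.2 (hall e he P hP e' he' Q hQ (hAP.1 h))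

/-- Sets through `i` avoiding `j` that contain `{i, f, g}` but not `x`, or contain `x` but neither
`f` nor `g`. -/
theorem connected_of_mixed {V : Finset ℕ} {i j x f g : ℕ} (hn : 9 ≤ #V) (hi : i ∈ V) (hx : x ∈ V)
    (hf : f ∈ V) (hg : g ∈ V) (hij : i ≠ j) (hix : i ≠ x) (hif : i ≠ f) (hig : i ≠ g)
    (hjx : j ≠ x) (hjf : j ≠ f) (hjg : j ≠ g) (hxf : x ≠ f) (hxg : x ≠ g) (hfg : f ≠ g)
    {p : Finset ℕ → Prop}
    (hp : ∀ A ∈ powersetCard 4 V, i ∈ A → j ∉ A →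
        ((f ∈ A ∧ g ∈ A ∧ x ∉ A) ∨ (f ∉ A ∧ g ∉ A ∧ x ∈ A)) →
      ∀ B ∈ powersetCard 4 V, i ∈ B → j ∉ B →
        ((f ∈ B ∧ g ∈ B ∧ x ∉ B) ∨ (f ∉ B ∧ g ∉ B ∧ x ∈ B)) → A ∩ B = {i} → p A → p B) :
    ∀ A ∈ powersetCard 4 V, i ∈ A → j ∉ A →
        ((f ∈ A ∧ g ∈ A ∧ x ∉ A) ∨ (f ∉ A ∧ g ∉ A ∧ x ∈ A)) →
      ∀ B ∈ powersetCard 4 V, i ∈ B → j ∉ B →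
        ((f ∈ B ∧ g ∈ B ∧ x ∉ B) ∨ (f ∉ B ∧ g ∉ B ∧ x ∈ B)) → p A → p B := by
  set W := V \ {i, j, x, f, g} with hWdef
  have hW : 4 ≤ #W := by
    have h1 := le_card_sdiff ({i, j, x, f, g} : Finset ℕ) V
    have h2 : #({i, j, x, f, g} : Finset ℕ) ≤ 5 := card_le_five
    rw [hWdef]
    omega
  have hWm : ∀ y, y ∈ W → y ∈ V ∧ y ≠ i ∧ y ≠ j ∧ y ≠ x ∧ y ≠ f ∧ y ≠ g := fun y hy => by
    simpa [hWdef] using hy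
  have hL : ∀ w ∈ W, ({i, f, g, w} : Finset ℕ) ∈ powersetCard 4 V ∧
      i ∈ ({i, f, g, w} : Finset ℕ) ∧ j ∉ ({i, f, g, w} : Finset ℕ) ∧
      f ∈ ({i, f, g, w} : Finset ℕ) ∧ g ∈ ({i, f, g, w} : Finset ℕ) ∧
      x ∉ ({i, f, g, w} : Finset ℕ) := by
    intro w hw
    obtain ⟨w1, w2, w3, w4, w5, w6⟩ := hWm w hw
    refine ⟨mem_powersetCard.2 ⟨?_, ?_⟩, ?_, ?_, ?_, ?_, ?_⟩
    · intro y hy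
      simp only [mem_insert, mem_singleton] at hy
      rcases hy with rfl | rfl | rfl | rfl <;> assumption
    · rw [card_insert_of_notMem, card_insert_of_notMem, card_pair w6.symm]
      · simp [hfg, w5.symm]
      · simp [hif, hig, w2.symm]
    all_goals simp; try tauto
  have hM : ∀ P ∈ powersetCard 2 W, insert i (insert x P) ∈ powersetCard 4 V ∧
      i ∈ insert i (insert x P) ∧ j ∉ insert i (insert x P) ∧ f ∉ insert i (insert x P) ∧
      g ∉ insert i (insert x P) ∧ x ∈ insert i (insert x P) := by
    intro P hP
    obtain ⟨hPW, hPc⟩ := mem_powersetCard.1 hP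
    have hn : i ∉ P ∧ j ∉ P ∧ x ∉ P ∧ f ∉ P ∧ g ∉ P := by
      refine ⟨fun h => ?_, fun h => ?_, fun h => ?_, fun h => ?_, fun h => ?_⟩ <;>
      · have := hWm _ (hPW h)
        tauto
    refine ⟨mem_powersetCard.2 ⟨insert_subset hi (insert_subset hx
      fun y hy => (hWm y (hPW hy)).1), ?_⟩, ?_, ?_, ?_, ?_, ?_⟩
    · rw [card_insert_of_notMem (by simp [hix, hn.1]), card_insert_of_notMem hn.2.2.1, hPc]
    all_goals simp only [mem_insert]; tauto
  have hLM : ∀ w ∈ W, ∀ P ∈ powersetCard 2 W, w ∉ P →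
      (p {i, f, g, w} ↔ p (insert i (insert x P))) := by
    intro w hw P hP hwP
    obtain ⟨p1, p2, p3, p4⟩ := hL w hw
    obtain ⟨q1, q2, q3, q4⟩ := hM P hP
    have e : ({i, f, g, w} : Finset ℕ) ∩ insert i (insert x P) = {i} := by
      ext y
      simp only [mem_inter, mem_insert, mem_singleton] at p3 p4 q3 q4 ⊢
      grind
    exact ⟨hp _ p1 p2 p3 (Or.inl p4) _ q1 q2 q3 (Or.inr q4) e,
      hp _ q1 q2 q3 (Or.inr q4) _ p1 p2 p3 (Or.inl p4) (by rw [inter_comm, e])⟩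
  have hLL : ∀ w ∈ W, ∀ w' ∈ W, p {i, f, g, w} → p {i, f, g, w'} := by
    intro w hw w' hw' h
    have hc : #({w, w'} : Finset ℕ) ≤ 2 := card_le_two
    obtain ⟨P, hP, hd⟩ := exists_pair_disjoint (W := W) (S := {w, w'}) (by omega)
    rw [disjoint_right] at hd
    exact (hLM w' hw' P hP (hd (by simp))).2 ((hLM w hw P hP (hd (by simp))).1 h)
  have hred : ∀ A ∈ powersetCard 4 V, i ∈ A → j ∉ A →
      ((f ∈ A ∧ g ∈ A ∧ x ∉ A) ∨ (f ∉ A ∧ g ∉ A ∧ x ∈ A)) → ∃ w ∈ W, p A ↔ p {i, f, g, w} := by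
    intro A hA hiA hjA hAt
    obtain ⟨hAV, hAc⟩ := mem_powersetCard.1 hA
    rcases hAt with ⟨hfA, hgA, hxA⟩ | ⟨hfA, hgA, hxA⟩
    · obtain ⟨w, hw⟩ := card_eq_one.1 (show #(A \ {i, f, g}) = 1 by
        rw [card_sdiff_of_subset (by
          intro y hy
          simp only [mem_insert, mem_singleton] at hy
          rcases hy with rfl | rfl | rfl <;> assumption), hAc,
          card_eq_three.2 ⟨i, f, g, hif, hig, hfg, rfl⟩])
      have hwA : w ∈ A \ {i, f, g} := hw ▸ mem_singleton_self w
      simp only [mem_sdiff, mem_insert, mem_singleton, not_or] at hwA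
      refine ⟨w, ?_, ?_⟩
      · simp only [hWdef, mem_sdiff, mem_insert, mem_singleton, not_or]
        exact ⟨hAV hwA.1, hwA.2.1, fun h => hjA (h ▸ hwA.1), fun h => hxA (h ▸ hwA.1),
          hwA.2.2.1, hwA.2.2.2⟩
      · have : A = {i, f, g, w} := by
          ext y
          have h1 : y ∈ A \ {i, f, g} ↔ y ∈ ({w} : Finset ℕ) := by rw [hw]
          simp only [mem_sdiff, mem_insert, mem_singleton] at h1 ⊢
          grind
        rw [this]
    · have hxA' : x ∈ A.erase i := mem_erase.2 ⟨hix.symm, hxA⟩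
      have hP : (A.erase i).erase x ∈ powersetCard 2 W := by
        refine mem_powersetCard.2 ⟨fun y hy => ?_, ?_⟩
        · simp only [mem_erase] at hy
          simp only [hWdef, mem_sdiff, mem_insert, mem_singleton, not_or]
          exact ⟨hAV hy.2.2, hy.2.1, fun h => hjA (h ▸ hy.2.2), hy.1, fun h => hfA (h ▸ hy.2.2),
            fun h => hgA (h ▸ hy.2.2)⟩
        · rw [card_erase_of_mem hxA', card_erase_of_mem hiA, hAc]
      obtain ⟨w, hw⟩ := card_pos.1 (show 0 < #(W \ (A.erase i).erase x) by
        have := le_card_sdiff ((A.erase i).erase x) W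
        rw [(mem_powersetCard.1 hP).2] at this
        omega)
      rw [mem_sdiff] at hw
      refine ⟨w, hw.1, ?_⟩
      rw [hLM w hw.1 _ hP hw.2, insert_erase hxA', insert_erase hiA]
  intro A hA hiA hjA hAt B hB hiB hjB hBt h
  obtain ⟨w, hw, h1⟩ := hred A hA hiA hjA hAt
  obtain ⟨w', hw', h2⟩ := hred B hB hiB hjB hBt
  exact h2.2 (hLL w hw w' hw' (h1.1 h))

theorem two_le_card_inter_triple {A : Finset ℕ} {a b c : ℕ} (hab : a ≠ b) (hac : a ≠ c)
    (hbc : b ≠ c) : 2 ≤ #(A ∩ {a, b, c}) ↔ (a ∈ A ∧ b ∈ A) ∨ (a ∈ A ∧ c ∈ A) ∨ (b ∈ A ∧ c ∈ A) := by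
  by_cases ha : a ∈ A <;> by_cases hb : b ∈ A <;> by_cases hc : c ∈ A <;>
    simp [inter_insert_of_mem, inter_insert_of_notMem, inter_singleton_of_mem,
      inter_singleton_of_notMem, ha, hb, hc, hab, hac, hbc]

theorem inter_triple_nonempty {A : Finset ℕ} {a b c : ℕ} :
    (A ∩ {a, b, c}).Nonempty ↔ a ∈ A ∨ b ∈ A ∨ c ∈ A := by
  constructor
  · rintro ⟨x, hx⟩
    simp only [mem_inter, mem_insert, mem_singleton] at hx
    grind
  · rintro (h | h | h)
    exacts [⟨a, by simp [h]⟩, ⟨b, by simp [h]⟩, ⟨c, by simp [h]⟩]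

theorem triple_subset_iff {A : Finset ℕ} {a b c : ℕ} :
    ({a, b, c} : Finset ℕ) ⊆ A ↔ a ∈ A ∧ b ∈ A ∧ c ∈ A := by
  simp [insert_subset_iff]

theorem exists_triple_of_mem {E : Finset ℕ} {i : ℕ} (hE : #E = 3) (hi : i ∈ E) :
    ∃ f g, i ≠ f ∧ i ≠ g ∧ f ≠ g ∧ E = {i, f, g} := by
  have h := card_erase_of_mem hi
  rw [hE] at h
  obtain ⟨f, g, hfg, he⟩ := card_eq_two.1 h
  refine ⟨f, g, ?_, ?_, hfg, ?_⟩
  · rintro rfl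
    exact notMem_erase i E (he ▸ mem_insert_self _ _)
  · rintro rfl
    exact notMem_erase i E (he ▸ mem_insert_of_mem (mem_singleton_self _))
  · rw [← insert_erase hi, he]

/-- It suffices to describe the sets moved only by the shift through a predicate `q` for which
the Kneser-type graph is connected. -/
theorem eq_shift_or_swap_of_connected {V : Finset ℕ} {F G : Finset (Finset ℕ)} {i j k : ℕ}
    (hint : ∀ A ∈ F, ∀ B ∈ F, (A ∩ B).Nonempty) (hG : shift i j F = G)
    (hGV : G ⊆ powersetCard k V) (q : Finset ℕ → Prop)
    (hq : ∀ A ∈ powersetCard k V, i ∈ A → j ∉ A →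
      (A ∈ G ∧ insert j (A.erase i) ∉ G ↔ q A))
    (hconn : ∀ p : Finset ℕ → Prop,
      (∀ A ∈ powersetCard k V, i ∈ A → j ∉ A → q A →
        ∀ B ∈ powersetCard k V, i ∈ B → j ∉ B → q B → A ∩ B = {i} → p A → p B) →
      ∀ A ∈ powersetCard k V, i ∈ A → j ∉ A → q A →
        ∀ B ∈ powersetCard k V, i ∈ B → j ∉ B → q B → p A → p B) :
    F = G ∨ ∀ A, A ∈ F ↔ A.image (Equiv.swap i j) ∈ G := by
  subst hG
  refine eq_shift_or_swap hint fun p hp A hA hi hj hn B hB hi' hj' hn' => ?_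
  rw [image_swap_of_left hi hj] at hn
  rw [image_swap_of_left hi' hj'] at hn'
  refine hconn p ?_ A (hGV hA) hi hj ((hq A (hGV hA) hi hj).1 ⟨hA, hn⟩) B (hGV hB) hi' hj'
    ((hq B (hGV hB) hi' hj').1 ⟨hB, hn'⟩)
  intro A hA hi hj hqA B hB hi' hj' hqB
  obtain ⟨h1, h2⟩ := (hq A hA hi hj).2 hqA
  obtain ⟨h3, h4⟩ := (hq B hB hi' hj').2 hqB
  exact hp A h1 hi hj (by rwa [image_swap_of_left hi hj]) B h3 hi' hj'
    (by rwa [image_swap_of_left hi' hj'])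

theorem insert_erase_mem_powersetCard {V A : Finset ℕ} {i j k : ℕ} (hi : i ∈ V) (hj : j ∈ V)
    (hA : A ∈ powersetCard k V) (hiA : i ∈ A) (hjA : j ∉ A) :
    insert j (A.erase i) ∈ powersetCard k V := by
  rw [← image_swap_of_left hiA hjA, powersetCard_swap_iff hi hj]
  exact hA

theorem isTwoOfThree_of_shift {V : Finset ℕ} {F : Finset (Finset ℕ)} {i j : ℕ} (hn : 9 ≤ #V)
    (hi : i ∈ V) (hj : j ∈ V) (hij : i ≠ j) (hint : ∀ A ∈ F, ∀ B ∈ F, (A ∩ B).Nonempty)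
    (h : IsTwoOfThree V 4 (shift i j F)) : IsTwoOfThree V 4 F := by
  suffices hs : F = shift i j F ∨ ∀ A, A ∈ F ↔ A.image (Equiv.swap i j) ∈ shift i j F by
    rcases hs with hs | hs
    · rwa [hs]
    · exact isTwoOfThree_of_swap hi hj h hs
  obtain ⟨T, hTV, hT, hG⟩ := h
  have hGV : shift i j F ⊆ powersetCard 4 V := hG ▸ filter_subset _ _
  by_cases hc : i ∈ T ∧ j ∉ T
  · obtain ⟨a, b, hia, hib, hab, rfl⟩ := exists_triple_of_mem hT hc.1
    have hj' := hc.2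
    simp only [mem_insert, mem_singleton, not_or] at hj'
    refine eq_shift_or_swap_of_connected hint rfl hGV (fun A => a ∈ A ↔ b ∉ A) ?_ ?_
    · intro A hA hiA hjA
      have hA' := insert_erase_mem_powersetCard hi hj hA hiA hjA
      rw [hG, mem_filter, mem_filter, two_le_card_inter_triple hia hib hab,
        two_le_card_inter_triple hia hib hab]
      simp only [mem_insert, mem_erase]
      grind
    · intro p hp
      exact connected_of_two_links hn hi (hTV (by simp)) (hTV (by simp)) hij hia hib hj'.2.1
        hj'.2.2 hab hp
  · refine eq_shift_or_swap_of_connected hint rfl hGV (fun _ => False) ?_ (by simp)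
    intro A hA hiA hjA
    have hA' := insert_erase_mem_powersetCard hi hj hA hiA hjA
    obtain ⟨a, b, c, hab, hac, hbc, rfl⟩ := card_eq_three.1 hT
    rw [hG, mem_filter, mem_filter, two_le_card_inter_triple hab hac hbc,
      two_le_card_inter_triple hab hac hbc]
    simp only [mem_insert, mem_erase, mem_singleton] at hc ⊢
    grind

theorem isTripleOrStar_of_shift {V : Finset ℕ} {F : Finset (Finset ℕ)} {i j : ℕ} (hn : 9 ≤ #V)
    (hi : i ∈ V) (hj : j ∈ V) (hij : i ≠ j) (hint : ∀ A ∈ F, ∀ B ∈ F, (A ∩ B).Nonempty)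
    (h : IsTripleOrStar V 4 (shift i j F)) : IsTripleOrStar V 4 F := by
  suffices hs : F = shift i j F ∨ ∀ A, A ∈ F ↔ A.image (Equiv.swap i j) ∈ shift i j F by
    rcases hs with hs | hs
    · rwa [hs]
    · exact isTripleOrStar_of_swap hi hj h hs
  obtain ⟨E, hEV, x, hx, hE, hxE, hG⟩ := h
  have hGV : shift i j F ⊆ powersetCard 4 V := hG ▸ filter_subset _ _
  by_cases hc : i ∈ E ∧ j ∉ E ∧ j ≠ x
  · obtain ⟨hiE, hjE, hjx⟩ := hc
    obtain ⟨f, g, hif, hig, hfg, rfl⟩ := exists_triple_of_mem hE hiE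
    simp only [mem_insert, mem_singleton, not_or] at hjE hxE
    refine eq_shift_or_swap_of_connected hint rfl hGV
      (fun A => (f ∈ A ∧ g ∈ A ∧ x ∉ A) ∨ (f ∉ A ∧ g ∉ A ∧ x ∈ A)) ?_ ?_
    · intro A hA hiA hjA
      have hA' := insert_erase_mem_powersetCard hi hj hA hiA hjA
      rw [hG, mem_filter, mem_filter, inter_triple_nonempty, inter_triple_nonempty,
        triple_subset_iff, triple_subset_iff]
      simp only [mem_insert, mem_erase]
      grind
    · intro p hp
      exact connected_of_mixed hn hi hx (hEV (by simp)) (hEV (by simp)) hij (Ne.symm hxE.1) hif hig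
        hjx hjE.2.1 hjE.2.2 hxE.2.1 hxE.2.2 hfg hp
  by_cases hix : i = x
  · subst hix
    by_cases hjE : j ∈ E
    · obtain ⟨f, g, hjf, hjg, hfg, rfl⟩ := exists_triple_of_mem hE hjE
      simp only [mem_insert, mem_singleton, not_or] at hxE
      refine eq_shift_or_swap_of_connected hint rfl hGV (fun A => f ∈ A ↔ g ∉ A) ?_ ?_
      · intro A hA hiA hjA
        have hA' := insert_erase_mem_powersetCard hi hj hA hiA hjA
        rw [hG, mem_filter, mem_filter, inter_triple_nonempty, inter_triple_nonempty,
          triple_subset_iff, triple_subset_iff]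
        simp only [mem_insert, mem_erase]
        grind
      · intro p hp
        exact connected_of_two_links hn hi (hEV (by simp)) (hEV (by simp)) hij hxE.2.1 hxE.2.2
          hjf hjg hfg hp
    · refine eq_shift_or_swap_of_connected hint rfl hGV
        (fun A => (A ∩ E).Nonempty ∧ ¬ E ⊆ A) ?_ ?_
      · intro A hA hiA hjA
        have hA' := insert_erase_mem_powersetCard hi hj hA hiA hjA
        obtain ⟨a, b, c, hab, hac, hbc, rfl⟩ := card_eq_three.1 hE
        rw [hG, mem_filter, mem_filter, inter_triple_nonempty, inter_triple_nonempty,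
          triple_subset_iff, triple_subset_iff]
        simp only [mem_insert, mem_erase, mem_singleton] at hxE hjE ⊢
        grind
      · intro p hp A hA hiA hjA hqA B hB hiB hjB hqB
        exact connected_of_star hn hi hEV hE hij hxE hjE
          (fun A hA h1 h2 h3 h4 B hB h5 h6 h7 h8 =>
            hp A hA h1 h2 ⟨h3, h4⟩ B hB h5 h6 ⟨h7, h8⟩)
          A hA hiA hjA hqA.1 hqA.2 B hB hiB hjB hqB.1 hqB.2
  · refine eq_shift_or_swap_of_connected hint rfl hGV (fun _ => False) ?_ (by simp)
    intro A hA hiA hjA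
    have hA' := insert_erase_mem_powersetCard hi hj hA hiA hjA
    obtain ⟨a, b, c, hab, hac, hbc, rfl⟩ := card_eq_three.1 hE
    rw [hG, mem_filter, mem_filter, inter_triple_nonempty, inter_triple_nonempty,
      triple_subset_iff, triple_subset_iff]
    simp only [mem_insert, mem_erase, mem_singleton] at hc hxE ⊢
    grind

theorem secondLevelBound_of_shift {V : Finset ℕ} {F : Finset (Finset ℕ)} {i j k : ℕ}
    (hk : 2 * k + 1 ≤ #V) (hi : i ∈ V) (hj : j ∈ V) (hij : i ≠ j)
    (hint : ∀ A ∈ F, ∀ B ∈ F, (A ∩ B).Nonempty) (h : SecondLevelBound V k (shift i j F)) :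
    SecondLevelBound V k F := by
  obtain ⟨h1, h2⟩ := h
  rw [card_shift] at h1 h2
  refine ⟨h1, fun he => ?_⟩
  obtain ⟨rfl, h3⟩ := h2 he
  exact ⟨rfl, h3.imp (isTwoOfThree_of_shift hk hi hj hij hint)
    (isTripleOrStar_of_shift hk hi hj hij hint)⟩

theorem card_filter_superset {V Z : Finset ℕ} (hZ : Z ⊆ V) {k : ℕ} (hk : #Z ≤ k) :
    #{A ∈ powersetCard k V | Z ⊆ A} = (#V - #Z).choose (k - #Z) := by
  rw [← card_filter_inter_eq hZ subset_rfl hk]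
  simp only [inter_eq_right]

theorem card_superset_meet_pair {V X D₁ D₂ : Finset ℕ} {k : ℕ} (hk : 4 ≤ k) (hn : 2 * k + 1 ≤ #V)
    (hXV : X ⊆ V) (hX : #X = 2) (h₁ : D₁ ∈ powersetCard k (V \ X))
    (h₂ : D₂ ∈ powersetCard k (V \ X)) (hne : (D₁ ∩ D₂).Nonempty) :
    (#V - 3).choose (k - 3) + 3 ≤
      #{A ∈ powersetCard k V | X ⊆ A ∧ (A ∩ D₁).Nonempty ∧ (A ∩ D₂).Nonempty} := by
  obtain ⟨u, hu⟩ := hne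
  rw [mem_inter] at hu
  rw [mem_powersetCard] at h₁ h₂
  obtain ⟨b, hb⟩ : (D₂.erase u).Nonempty := by
    rw [← card_pos, card_erase_of_mem hu.2]
    omega
  obtain ⟨hbu, hbD⟩ := mem_erase.1 hb
  have huV := mem_sdiff.1 (h₁.1 hu.1)
  have hbV := mem_sdiff.1 (h₂.1 hbD)
  obtain ⟨R, hRV, hR, hRD⟩ : ∃ R ⊆ V \ insert u (insert b X), k - 1 ≤ #R ∧ (b ∈ D₁ ∨ R ⊆ D₁) := by
    by_cases hbD₁ : b ∈ D₁
    · refine ⟨_, subset_rfl, ?_, Or.inl hbD₁⟩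
      have h1 := le_card_sdiff (insert u (insert b X)) V
      have h2 := card_insert_le u (insert b X)
      have h3 := card_insert_le b X
      omega
    · refine ⟨D₁.erase u, fun x hx => ?_, (card_erase_of_mem hu.1).symm ▸ by omega,
        Or.inr (erase_subset _ _)⟩
      obtain ⟨hxu, hxD⟩ := mem_erase.1 hx
      have hxV := mem_sdiff.1 (h₁.1 hxD)
      simp only [mem_sdiff, mem_insert, not_or]
      exact ⟨hxV.1, hxu, fun h => hbD₁ (h ▸ hxD), hxV.2⟩
  have hRb : Disjoint R (insert b X) :=
    disjoint_left.2 fun x hx h => (mem_sdiff.1 (hRV hx)).2 (mem_insert_of_mem h)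
  set S₁ := {A ∈ powersetCard k V | insert u X ⊆ A} with hS₁
  set S₂ := (powersetCard (k - 3) R).image fun Q => Q ∪ insert b X with hS₂
  have hc₁ : #S₁ = (#V - 3).choose (k - 3) := by
    have hcu : #(insert u X) = 3 := by rw [card_insert_of_notMem huV.2, hX]
    rw [hS₁, card_filter_superset (insert_subset huV.1 hXV) (by omega), hcu]
  have hbX : #(insert b X) = 3 := by rw [card_insert_of_notMem hbV.2, hX]
  have hc₂ : 3 ≤ #S₂ := by
    rw [hS₂, card_image_of_injOn, card_powersetCard]
    · have h1 : (k - 1).choose (k - 3) ≤ (#R).choose (k - 3) := Nat.choose_le_choose _ hR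
      have h2 : (k - 1).choose (k - 3) = (k - 1).choose 2 := Nat.choose_symm_of_eq_add (by omega)
      have h3 : Nat.choose 3 2 ≤ (k - 1).choose 2 := Nat.choose_le_choose _ (by omega)
      have h4 : Nat.choose 3 2 = 3 := by decide
      omega
    · intro Q hQ Q' hQ' h
      have hQ := (mem_powersetCard.1 (mem_coe.1 hQ)).1
      have hQ' := (mem_powersetCard.1 (mem_coe.1 hQ')).1
      have h' : Q ∪ insert b X = Q' ∪ insert b X := h
      rw [← union_sdiff_cancel_right (disjoint_of_subset_left hQ hRb), h',
        union_sdiff_cancel_right (disjoint_of_subset_left hQ' hRb)]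
  have hdisj : Disjoint S₁ S₂ := by
    refine disjoint_left.2 fun A h1 h2 => ?_
    obtain ⟨Q, hQ, rfl⟩ := mem_image.1 h2
    have huA := (mem_filter.1 h1).2 (mem_insert_self u X)
    rcases mem_union.1 huA with h | h
    · exact (mem_sdiff.1 (hRV ((mem_powersetCard.1 hQ).1 h))).2 (mem_insert_self _ _)
    · rcases mem_insert.1 h with h | h
      · exact hbu h.symm
      · exact huV.2 h
  have hle : S₁ ∪ S₂ ⊆
      {A ∈ powersetCard k V | X ⊆ A ∧ (A ∩ D₁).Nonempty ∧ (A ∩ D₂).Nonempty} := by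
    refine union_subset (fun A hA => ?_) fun A hA => ?_
    · obtain ⟨h1, h2⟩ := mem_filter.1 hA
      have huA := h2 (mem_insert_self u X)
      exact mem_filter.2 ⟨h1, (subset_insert _ _).trans h2, ⟨u, mem_inter.2 ⟨huA, hu.1⟩⟩,
        ⟨u, mem_inter.2 ⟨huA, hu.2⟩⟩⟩
    · obtain ⟨Q, hQ, rfl⟩ := mem_image.1 hA
      obtain ⟨hQR, hQc⟩ := mem_powersetCard.1 hQ
      refine mem_filter.2 ⟨mem_powersetCard.2 ⟨union_subset
        ((hQR.trans hRV).trans sdiff_subset) (insert_subset hbV.1 hXV), ?_⟩,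
        (subset_insert _ _).trans subset_union_right, ?_, ⟨b, by simp [hbD]⟩⟩
      · rw [card_union_of_disjoint (disjoint_of_subset_left hQR hRb), hQc, hbX]
        omega
      · rcases hRD with h | h
        · exact ⟨b, by simp [h]⟩
        · obtain ⟨q, hq⟩ : Q.Nonempty := by
            rw [← card_pos]
            omega
          exact ⟨q, mem_inter.2 ⟨mem_union_left _ hq, h (hQR hq)⟩⟩
  have := card_le_card hle
  rw [card_union_of_disjoint hdisj] at this
  omega

theorem card_superset_meet {V X : Finset ℕ} {D : Finset (Finset ℕ)} {k : ℕ} (hk : 4 ≤ k)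
    (hn : 2 * k + 1 ≤ #V) (hXV : X ⊆ V) (hX : #X = 2) (hD : D ⊆ powersetCard k (V \ X))
    (hint : ∀ A ∈ D, ∀ B ∈ D, (A ∩ B).Nonempty) (hc : #D ≤ 2) :
    (#V - 3).choose (k - 3) + 3 ≤
      #{A ∈ powersetCard k V | X ⊆ A ∧ ∀ B ∈ D, (A ∩ B).Nonempty} := by
  obtain ⟨D₁, D₂, h₁, h₂, hne, hsub⟩ : ∃ D₁ D₂, D₁ ∈ powersetCard k (V \ X) ∧
      D₂ ∈ powersetCard k (V \ X) ∧ (D₁ ∩ D₂).Nonempty ∧ D ⊆ {D₁, D₂} := by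
    have h3 : #D = 0 ∨ #D = 1 ∨ #D = 2 := by omega
    rcases h3 with h | h | h
    · have hle : k ≤ #(V \ X) := by
        have := le_card_sdiff X V
        omega
      obtain ⟨T, hT⟩ := powersetCard_nonempty.2 hle
      refine ⟨T, T, hT, hT, ?_, by simp [card_eq_zero.1 h]⟩
      rw [inter_self, ← card_pos, (mem_powersetCard.1 hT).2]
      omega
    · obtain ⟨B, rfl⟩ := card_eq_one.1 h
      exact ⟨B, B, hD (by simp), hD (by simp), hint B (by simp) B (by simp), by simp⟩
    · obtain ⟨A, B, _, rfl⟩ := card_eq_two.1 h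
      exact ⟨A, B, hD (by simp), hD (by simp), hint A (by simp) B (by simp), subset_rfl⟩
  refine (card_superset_meet_pair hk hn hXV hX h₁ h₂ hne).trans (card_le_card fun A hA => ?_)
  simp only [mem_filter] at hA ⊢
  refine ⟨hA.1, hA.2.1, fun B hB => ?_⟩
  have := hsub hB
  simp only [mem_insert, mem_singleton] at this
  rcases this with rfl | rfl
  exacts [hA.2.2.1, hA.2.2.2]

/-- Intersecting families with at most two members missing the pair `X` and many members
containing it. -/
structure IsPairRich (V X : Finset ℕ) (k : ℕ) (F : Finset (Finset ℕ)) : Prop where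
  subset : F ⊆ powersetCard k V
  intersecting : ∀ A ∈ F, ∀ B ∈ F, (A ∩ B).Nonempty
  defect : ∀ x ∈ X, 3 ≤ #{A ∈ F | x ∉ A}
  missing : #{A ∈ F | A ∩ X = ∅} ≤ 2
  rich : (#V - 3).choose (k - 3) + 3 ≤ #{A ∈ F | X ⊆ A}

theorem IsPairRich.three_le_card_filter {V X : Finset ℕ} {k : ℕ} {F : Finset (Finset ℕ)}
    (hF : IsPairRich V X k F) (hk : 4 ≤ k) (hXV : X ⊆ V) (hX : #X = 2) :
    ∀ x ∈ V, 3 ≤ #{A ∈ F | x ∉ A} := by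
  intro x hx
  by_cases hxX : x ∈ X
  · exact hF.defect x hxX
  have h1 : #{A ∈ F | X ⊆ A ∧ x ∈ A} ≤ (#V - 3).choose (k - 3) := by
    have hcu : #(insert x X) = 3 := by rw [card_insert_of_notMem hxX, hX]
    rw [← hcu, ← card_filter_superset (insert_subset hx hXV) (by omega)]
    refine card_le_card fun A hA => ?_
    simp only [mem_filter] at hA ⊢
    exact ⟨hF.subset hA.1, insert_subset hA.2.2 hA.2.1⟩
  have h2 : #{A ∈ F | X ⊆ A ∧ x ∉ A} ≤ #{A ∈ F | x ∉ A} :=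
    card_le_card fun A hA => by
      simp only [mem_filter] at hA ⊢
      exact ⟨hA.1, hA.2.2⟩
  have h3 := card_filter_add_card_filter_not (s := {A ∈ F | X ⊆ A}) (fun A => x ∈ A)
  rw [filter_filter, filter_filter] at h3
  have h4 := hF.rich
  omega

theorem IsPairRich.shift {V X : Finset ℕ} {k i j : ℕ} {F : Finset (Finset ℕ)}
    (hF : IsPairRich V X k F) (hi : i ∈ V \ X) (hj : j ∈ V \ X) :
    IsPairRich V X k (shift i j F) := by
  rw [mem_sdiff] at hi hj
  have hne : ∀ x ∈ X, ∀ A, x ∈ UV.compress {i} {j} A ↔ x ∈ A := fun x hx A =>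
    mem_compress_of_ne (by rintro rfl; exact hi.2 hx) (by rintro rfl; exact hj.2 hx) A
  have hinter : ∀ A, UV.compress {i} {j} A ∩ X = A ∩ X := fun A => by
    ext x
    simp only [mem_inter]
    exact and_congr_left fun hx => hne x hx A
  refine ⟨shift_subset_powersetCard hF.subset hi.1, shift_intersecting hF.intersecting,
    fun x hx => ?_, ?_, ?_⟩
  · rw [card_filter_shift F _ fun A => not_congr (hne x hx A)]
    exact hF.defect x hx
  · rw [card_filter_shift F _ fun A => by rw [hinter]]
    exact hF.missing
  · rw [card_filter_shift F _ fun A => ?_]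
    · exact hF.rich
    · rw [← inter_eq_right, hinter, inter_eq_right]

theorem IsPairRich.secondLevelBound {V X : Finset ℕ} {k : ℕ} {F : Finset (Finset ℕ)}
    (hF : IsPairRich V X k F) (hk : 4 ≤ k) (hn : 2 * k + 1 ≤ #V) (hXV : X ⊆ V) (hX : #X = 2)
    (hHM : ∀ i, 3 ≤ i → i < k → HiltonMilnerBound i) : SecondLevelBound V k F := by
  refine shift_induction (V \ X) (P := IsPairRich V X k) ?_ ?_ F hF
  · intro F hF hsh
    obtain ⟨Y, hYV, hY, hker⟩ := exists_kernel_of_shifted hk hn hXV hX.le hF.subset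
      hF.intersecting (Or.inr hF.missing) hsh
    exact secondLevelBound_of_kernel hk hn hF.subset hYV hY hker
      (hF.three_le_card_filter hk hXV hX) hHM
  · intro F hF i hi j hj hij h
    exact secondLevelBound_of_shift hn (mem_sdiff.1 hi).1 (mem_sdiff.1 hj).1 hij.ne
      hF.intersecting (h (hF.shift hi hj))

theorem SecondLevelBound.mono {V : Finset ℕ} {k : ℕ} {F G : Finset (Finset ℕ)} (hFG : F ⊆ G)
    (h : SecondLevelBound V k G) : SecondLevelBound V k F := by
  have hc := card_le_card hFG
  obtain ⟨h1, h2⟩ := h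
  refine ⟨by omega, fun he => ?_⟩
  rw [eq_of_subset_of_card_le hFG (by omega)]
  exact h2 (by omega)

theorem secondLevelBound_of_few_missing_pair {V X : Finset ℕ} {k : ℕ} {F : Finset (Finset ℕ)}
    (hk : 4 ≤ k) (hn : 2 * k + 1 ≤ #V) (hF : F ⊆ powersetCard k V)
    (hint : ∀ A ∈ F, ∀ B ∈ F, (A ∩ B).Nonempty) (hXV : X ⊆ V) (hX : #X = 2)
    (hdef : ∀ x ∈ X, 3 ≤ #{A ∈ F | x ∉ A}) (hmiss : #{A ∈ F | A ∩ X = ∅} ≤ 2)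
    (hHM : ∀ i, 3 ≤ i → i < k → HiltonMilnerBound i) : SecondLevelBound V k F := by
  have hXne : X.Nonempty := by
    rw [← card_pos]
    omega
  set N := {A ∈ powersetCard k V | X ⊆ A ∧ ∀ B ∈ {A ∈ F | A ∩ X = ∅}, (A ∩ B).Nonempty} with hN
  refine SecondLevelBound.mono (G := F ∪ N) subset_union_left
    (IsPairRich.secondLevelBound ?_ hk hn hXV hX hHM)
  have hFN : ∀ A ∈ F, ∀ B ∈ N, (B ∩ A).Nonempty := by
    intro A hA B hB
    obtain ⟨_, hXB, h⟩ := mem_filter.1 hB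
    by_cases hAX : A ∩ X = ∅
    · exact h A (mem_filter.2 ⟨hA, hAX⟩)
    · obtain ⟨y, hy⟩ := nonempty_iff_ne_empty.2 hAX
      rw [mem_inter] at hy
      exact ⟨y, mem_inter.2 ⟨hXB hy.2, hy.1⟩⟩
  refine ⟨union_subset hF (filter_subset _ _), ?_, fun x hx => ?_, ?_, ?_⟩
  · intro A hA B hB
    rcases mem_union.1 hA with hA | hA <;> rcases mem_union.1 hB with hB | hB
    · exact hint A hA B hB
    · rw [inter_comm]
      exact hFN A hA B hB
    · exact hFN B hB A hA
    · obtain ⟨x, hx⟩ := hXne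
      exact ⟨x, mem_inter.2 ⟨(mem_filter.1 hA).2.1 hx, (mem_filter.1 hB).2.1 hx⟩⟩
  · exact (hdef x hx).trans (card_le_card (filter_subset_filter _ subset_union_left))
  · refine (card_le_card fun A hA => ?_).trans hmiss
    obtain ⟨h1, h2⟩ := mem_filter.1 hA
    refine mem_filter.2 ⟨(mem_union.1 h1).resolve_right fun h => ?_, h2⟩
    rw [inter_eq_right.2 (mem_filter.1 h).2.1] at h2
    exact hXne.ne_empty h2
  · refine (card_superset_meet hk hn hXV hX (D := {A ∈ F | A ∩ X = ∅}) (fun A hA => ?_)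
      (fun A hA B hB => hint A (mem_filter.1 hA).1 B (mem_filter.1 hB).1) hmiss).trans
      (card_le_card fun A hA => ?_)
    · obtain ⟨h1, h2⟩ := mem_filter.1 hA
      obtain ⟨h3, h4⟩ := mem_powersetCard.1 (hF h1)
      refine mem_powersetCard.2 ⟨subset_sdiff.2 ⟨h3, disjoint_iff_inter_eq_empty.2 h2⟩, h4⟩
    · exact mem_filter.2 ⟨mem_union_right _ hA, (mem_filter.1 hA).2.1⟩

theorem secondLevelBound_of_defect {V : Finset ℕ} {k : ℕ} {F : Finset (Finset ℕ)} (hk : 4 ≤ k)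
    (hn : 2 * k + 1 ≤ #V) (hF : F ⊆ powersetCard k V)
    (hint : ∀ A ∈ F, ∀ B ∈ F, (A ∩ B).Nonempty) (hdef : ∀ x ∈ V, 3 ≤ #{A ∈ F | x ∉ A})
    (hHM : ∀ i, 3 ≤ i → i < k → HiltonMilnerBound i) : SecondLevelBound V k F := by
  refine shift_induction V (P := fun F => F ⊆ powersetCard k V ∧
    (∀ A ∈ F, ∀ B ∈ F, (A ∩ B).Nonempty) ∧ ∀ x ∈ V, 3 ≤ #{A ∈ F | x ∉ A}) ?_ ?_ F
    ⟨hF, hint, hdef⟩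
  · rintro F ⟨hF, hint, hdef⟩ hsh
    obtain ⟨Y, hYV, hY, hker⟩ := exists_kernel_of_shifted (X := ∅) hk hn (empty_subset _)
      (by simp) hF hint (Or.inl rfl) (by simpa using hsh)
    exact secondLevelBound_of_kernel hk hn hF hYV hY hker hdef hHM
  · rintro F ⟨hF, hint, hdef⟩ i hi j hj hij h
    by_cases hc : ∀ x ∈ V, 3 ≤ #{A ∈ shift i j F | x ∉ A}
    · exact secondLevelBound_of_shift hn hi hj hij.ne hint
        (h ⟨shift_subset_powersetCard hF hi, shift_intersecting hint, hc⟩)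
    push Not at hc
    obtain ⟨x, hx, hlt⟩ := hc
    have hxi : x = i := by
      by_contra hxi
      have hd := hdef x hx
      by_cases hxj : x = j
      · subst hxj
        have : #{A ∈ F | x ∉ A} ≤ #{A ∈ shift i x F | x ∉ A} := by
          refine card_le_card fun A hA => ?_
          obtain ⟨h1, h2⟩ := mem_filter.1 hA
          refine mem_filter.2 ⟨?_, h2⟩
          by_cases hiA : i ∈ A
          · exact (mem_shift_left hiA h2).2 (Or.inl h1)
          · exact (mem_shift_of_iff (by tauto)).2 h1
        omega
      · rw [card_filter_shift F _ fun A => not_congr (mem_compress_of_ne hxi hxj A)] at hlt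
        omega
    subst hxi
    refine secondLevelBound_of_few_missing_pair (X := {x, j}) hk hn hF hint
      (insert_subset hx (singleton_subset_iff.2 hj)) (card_pair hij.ne) ?_ ?_ hHM
    · intro y hy
      simp only [mem_insert, mem_singleton] at hy
      rcases hy with rfl | rfl
      exacts [hdef y hx, hdef y hj]
    · have : #{A ∈ F | A ∩ {x, j} = ∅} ≤ #{A ∈ shift x j F | x ∉ A} := by
        refine card_le_card fun A hA => ?_
        obtain ⟨h1, h2⟩ := mem_filter.1 hA
        have hxA : x ∉ A := fun h => by
          have : x ∈ A ∩ {x, j} := by simp [h]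
          simp [h2] at this
        have hjA : j ∉ A := fun h => by
          have : j ∈ A ∩ {x, j} := by simp [h]
          simp [h2] at this
        exact mem_filter.2 ⟨(mem_shift_of_iff (by tauto)).2 h1, hxA⟩
      omega

theorem choose_three_uniform_eq {n : ℕ} (hn : 7 ≤ n) :
    (n - 1).choose 2 + 9 = (n - 4).choose 2 + 3 * n := by
  obtain ⟨m, rfl⟩ : ∃ m, n = m + 4 := ⟨n - 4, by omega⟩
  have e : m + 4 - 1 = m + 1 + 1 + 1 := by omega
  rw [e, Nat.choose_succ_succ' (m + 1 + 1) 1, Nat.choose_succ_succ' (m + 1) 1,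
    Nat.choose_succ_succ' m 1, Nat.choose_one_right, Nat.choose_one_right, Nat.choose_one_right,
    Nat.add_sub_cancel]
  simp only [Nat.reduceAdd]
  omega

theorem hiltonMilnerBound {k : ℕ} (hk : 3 ≤ k) : HiltonMilnerBound k := by
  induction k using Nat.strong_induction_on with
  | _ k ih =>
    intro V F hn hF hint hdef
    have hpos : 0 < (#V - k - 2).choose (k - 2) := Nat.choose_pos (by omega)
    have e : #V - 1 - k = #V - k - 1 := by omega
    by_cases h3 : ∀ x ∈ V, 3 ≤ #{A ∈ F | x ∉ A}
    · rcases Nat.lt_or_ge 3 k with h4 | h4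
      · have := (secondLevelBound_of_defect h4 hn hF hint h3
          fun i hi hik => ih i hik hi).1
        rw [e]
        omega
      · obtain rfl : k = 3 := by omega
        have hc := choose_three_uniform_eq (n := #V) (by omega)
        have e1 : #V - 1 - 3 = #V - 4 := by omega
        have e2 : 3 - 1 = 2 := rfl
        rw [e1, e2]
        by_cases hT : ∃ T ⊆ V, #T = 3 ∧ ∀ A ∈ F, 2 ≤ #(A ∩ T)
        · obtain ⟨T, hTV, hT, h⟩ := hT
          have h1 : #F ≤ #{A ∈ powersetCard 3 V | 2 ≤ #(A ∩ T)} :=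
            card_le_card fun A hA => mem_filter.2 ⟨hF hA, h A hA⟩
          rw [card_filter_two_le_inter le_rfl hTV hT] at h1
          norm_num at h1
          omega
        · have := card_add_three_le_of_three_uniform (by omega) hF hint h3 hT
          omega
    · push Not at h3
      obtain ⟨x, hx, hlt⟩ := h3
      rcases exists_filter_notMem_eq_pair (hdef x hx) hlt with ⟨B, hB⟩ | ⟨B₁, B₂, hne, hB⟩
      · have hBm : B ∈ {A ∈ F | x ∉ A} := by simp [hB]
        obtain ⟨hBF, hxB⟩ := mem_filter.1 hBm
        have h1 := card_le_card (subset_of_filter_notMem_eq_singleton hF hint hB)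
        have h2 := card_insert_star_meet (by omega) hx (hF hBF) hxB
        omega
      · have := (card_bound_of_filter_notMem_eq_pair (by omega) hn hx hF hint hB hne).1
        rw [e]
        omega

theorem exists_perm_image_eq {U P Q : Finset ℕ} (hP : P ⊆ U) (hQ : Q ⊆ U) (h : #P = #Q) :
    ∃ σ : Equiv.Perm ℕ, (∀ x ∉ U, σ x = x) ∧ P.image σ = Q := by
  induction hm : #(P \ Q) generalizing P with
  | zero =>
    refine ⟨1, fun _ _ => rfl, ?_⟩
    have hPQ : P ⊆ Q := sdiff_eq_empty_iff_subset.1 (card_eq_zero.1 hm)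
    rw [eq_of_subset_of_card_le hPQ h.ge]
    simp
  | succ m ih =>
    obtain ⟨a, ha⟩ : (P \ Q).Nonempty := card_pos.1 (by omega)
    obtain ⟨b, hb⟩ : (Q \ P).Nonempty :=
      card_pos.1 (by rw [card_sdiff_comm h.symm]; omega)
    rw [mem_sdiff] at ha hb
    have he := image_swap_of_left ha.1 hb.2
    have hcard : #(P.image (Equiv.swap a b)) = #P :=
      card_image_of_injective _ (Equiv.injective _)
    obtain ⟨σ, h1, h2⟩ := ih (P := P.image (Equiv.swap a b))
      (by rw [he]; exact insert_subset (hQ hb.1) ((erase_subset _ _).trans hP)) (by omega) (by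
        have : P.image (Equiv.swap a b) \ Q = (P \ Q).erase a := by
          rw [he]
          ext x
          simp only [mem_sdiff, mem_insert, mem_erase]
          have hxb : x = b → x ∈ Q := by rintro rfl; exact hb.1
          tauto
        rw [this, card_erase_of_mem (mem_sdiff.2 ha), hm]
        rfl)
    refine ⟨σ * Equiv.swap a b, fun x hx => ?_, ?_⟩
    · rw [Equiv.Perm.mul_apply, Equiv.swap_apply_of_ne_of_ne
        (by rintro rfl; exact hx (hP ha.1)) (by rintro rfl; exact hx (hQ hb.1)), h1 x hx]
    · rw [← h2, image_image, Equiv.Perm.coe_mul]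

/-- Extending a permutation that already maps `P` onto `Q` so that it also maps `P'` onto `Q'`. -/
theorem exists_perm_extend {U P P' Q Q' : Finset ℕ} {σ : Equiv.Perm ℕ} (hσ : ∀ x ∉ U, σ x = x)
    (hPQ : P.image σ = Q) (hP : P' ⊆ U) (hQ : Q' ⊆ U) (h : #P' = #Q') (hPP : Disjoint P P')
    (hQQ : Disjoint Q Q') :
    ∃ τ : Equiv.Perm ℕ, (∀ x ∉ U, τ x = x) ∧ P'.image τ = Q' ∧ ∀ x ∈ P, τ x = σ x := by
  have hσU : ∀ x ∈ U, σ x ∈ U := fun x hx => by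
    by_contra hc
    exact hc (by rwa [σ.injective (hσ _ hc)])
  obtain ⟨ρ, h1, h2⟩ := exists_perm_image_eq (U := U \ Q) (P := P'.image σ) (Q := Q') (by
      intro y hy
      obtain ⟨x, hx, rfl⟩ := mem_image.1 hy
      refine mem_sdiff.2 ⟨hσU x (hP hx), fun hc => ?_⟩
      rw [← hPQ, mem_image] at hc
      obtain ⟨z, hz, hzx⟩ := hc
      exact disjoint_left.1 hPP hz (σ.injective hzx ▸ hx))
    (subset_sdiff.2 ⟨hQ, hQQ.symm⟩) (by rw [card_image_of_injective _ σ.injective, h])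
  refine ⟨ρ * σ, fun x hx => ?_, ?_, fun x hx => ?_⟩
  · rw [Equiv.Perm.mul_apply, hσ x hx, h1 x fun hc => hx (mem_sdiff.1 hc).1]
  · rw [Equiv.Perm.coe_mul, ← image_image, h2]
  · rw [Equiv.Perm.mul_apply, h1]
    exact fun hc => (mem_sdiff.1 hc).2 (hPQ ▸ mem_image_of_mem _ hx)

theorem mem_of_fixed_outside {U : Finset ℕ} {σ : Equiv.Perm ℕ} (hσ : ∀ x ∉ U, σ x = x) :
    ∀ x ∈ U, σ x ∈ U := fun x hx => by
  by_contra hc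
  exact hc (by rwa [σ.injective (hσ _ hc)])

theorem exists_perm_image_eq_pair {U B B' : Finset ℕ} {x y : ℕ} (hx : x ∈ U) (hy : y ∈ U)
    (hB : B ⊆ U) (hB' : B' ⊆ U) (h : #B = #B') (hxB : x ∉ B) (hyB : y ∉ B') :
    ∃ σ : Equiv.Perm ℕ, (∀ z ∈ U, σ z ∈ U) ∧ σ x = y ∧ B.image σ = B' := by
  obtain ⟨σ, h1, h2⟩ := exists_perm_image_eq hB hB' h
  obtain ⟨τ, h3, h4, h5⟩ := exists_perm_extend h1 h2 (singleton_subset_iff.2 hx)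
    (singleton_subset_iff.2 hy) rfl (disjoint_singleton_right.2 hxB)
    (disjoint_singleton_right.2 hyB)
  refine ⟨τ, mem_of_fixed_outside h3, by simpa using h4, ?_⟩
  rw [← h2]
  exact image_congr fun z hz => h5 z hz

theorem exists_perm_image_eq_sunflower {U B₁ B₂ C : Finset ℕ} {x y b₁ b₂ : ℕ} (hx : x ∈ U)
    (hy : y ∈ U) (hB₁ : B₁ ⊆ U) (hB₂ : B₂ ⊆ U) (hC : C ⊆ U) (hb₁ : b₁ ∈ U) (hb₂ : b₂ ∈ U)
    (hxB₁ : x ∉ B₁) (hxB₂ : x ∉ B₂) (hyC : y ∉ C) (hyb₁ : y ≠ b₁) (hyb₂ : y ≠ b₂) (hbC₁ : b₁ ∉ C)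
    (hbC₂ : b₂ ∉ C) (hb : b₁ ≠ b₂) (hc₁ : #B₁ = #C + 1) (hc₂ : #B₂ = #C + 1)
    (hc : #(B₁ ∩ B₂) = #C) :
    ∃ σ : Equiv.Perm ℕ, (∀ z ∈ U, σ z ∈ U) ∧ σ x = y ∧ B₁.image σ = insert b₁ C ∧
      B₂.image σ = insert b₂ C := by
  obtain ⟨a₁, ha₁⟩ := card_eq_one.1 (show #(B₁ \ B₂) = 1 by
    have := card_sdiff_add_card_inter B₁ B₂; omega)
  obtain ⟨a₂, ha₂⟩ := card_eq_one.1 (show #(B₂ \ B₁) = 1 by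
    have := card_sdiff_add_card_inter B₂ B₁
    rw [inter_comm] at this
    omega)
  have h₁ := mem_sdiff.1 (ha₁ ▸ mem_singleton_self a₁)
  have h₂ := mem_sdiff.1 (ha₂ ▸ mem_singleton_self a₂)
  have e₁ : B₁ = insert a₁ (B₁ ∩ B₂) := by
    rw [insert_eq, ← ha₁, sdiff_union_inter]
  have e₂ : B₂ = insert a₂ (B₁ ∩ B₂) := by
    rw [insert_eq, ← ha₂, inter_comm, sdiff_union_inter]
  obtain ⟨σ, s1, s2⟩ := exists_perm_image_eq (inter_subset_left.trans hB₁) hC hc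
  obtain ⟨τ, t1, t2, t3⟩ := exists_perm_extend s1 s2 (singleton_subset_iff.2 (hB₁ h₁.1))
    (singleton_subset_iff.2 hb₁) rfl (disjoint_singleton_right.2 (by simp [h₁.2]))
    (disjoint_singleton_right.2 hbC₁)
  have t4 : B₁.image τ = insert b₁ C := by
    rw [e₁, image_insert, ← s2, image_congr fun z hz => t3 z hz]
    simp at t2
    rw [t2]
  obtain ⟨ρ, r1, r2, r3⟩ := exists_perm_extend t1 t4 (singleton_subset_iff.2 (hB₂ h₂.1))
    (singleton_subset_iff.2 hb₂) rfl (disjoint_singleton_right.2 h₂.2)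
    (disjoint_singleton_right.2 (by simp [hb.symm, hbC₂]))
  have r4 : B₁.image ρ = insert b₁ C := by
    rw [← t4]
    exact image_congr fun z hz => r3 z hz
  have r5 : B₂.image ρ = insert b₂ C := by
    rw [e₂, image_insert, ← s2, image_congr fun z hz => (r3 z (inter_subset_left hz)).trans (t3 z hz)]
    simp at r2
    rw [r2]
  obtain ⟨π, p1, p2, p3⟩ := exists_perm_extend (P := B₁ ∪ B₂) r1
    (image_union _ _) (singleton_subset_iff.2 hx) (singleton_subset_iff.2 hy) rfl
    (disjoint_singleton_right.2 (by simp [hxB₁, hxB₂]))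
    (disjoint_singleton_right.2 (by rw [r4, r5]; simp [hyb₁, hyb₂, hyC]))
  refine ⟨π, mem_of_fixed_outside p1, by simpa using p2, ?_, ?_⟩
  · rw [← r4]
    exact image_congr fun z hz => p3 z (mem_union_left _ hz)
  · rw [← r5]
    exact image_congr fun z hz => p3 z (mem_union_right _ hz)

theorem image_mem_powersetCard {U A : Finset ℕ} {k : ℕ} {σ : Equiv.Perm ℕ}
    (hσ : ∀ x ∈ U, σ x ∈ U) (hA : A ∈ powersetCard k U) : A.image σ ∈ powersetCard k U := by
  obtain ⟨h1, h2⟩ := mem_powersetCard.1 hA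
  refine mem_powersetCard.2 ⟨fun y hy => ?_, by rw [card_image_of_injective _ σ.injective, h2]⟩
  obtain ⟨x, hx, rfl⟩ := mem_image.1 hy
  exact hσ x (h1 hx)

theorem image_inter_image_nonempty {A B : Finset ℕ} (σ : Equiv.Perm ℕ)
    (h : (A ∩ B).Nonempty) : (A.image σ ∩ B.image σ).Nonempty := by
  rw [← image_inter _ _ σ.injective]
  exact h.image _

theorem card_image_image (F : Finset (Finset ℕ)) (σ : Equiv.Perm ℕ) :
    #(F.image fun s => s.image fun x => σ x) = #F :=
  card_image_of_injective _ (image_injective σ.injective)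

theorem IsoTo.card_eq {n : ℕ} {A B : Finset (Finset ℕ)} (h : IsoTo n A B) : #A = #B := by
  obtain ⟨σ, _, rfl⟩ := h
  rw [card_image_image]

theorem SubIsoTo.isoTo {n : ℕ} {A B : Finset (Finset ℕ)} (h : SubIsoTo n A B) (hc : #A = #B) :
    IsoTo n A B := by
  obtain ⟨σ, h1, h2⟩ := h
  exact ⟨σ, h1, eq_of_subset_of_card_le h2 (by rw [card_image_image, hc])⟩

theorem subIsoTo_HMfam {n k x : ℕ} {F : Finset (Finset ℕ)} {B : Finset ℕ} (hkn : k + 1 ≤ n)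
    (hx : x ∈ Icc 1 n) (hB : B ∈ powersetCard k (Icc 1 n)) (hxB : x ∉ B)
    (hF : F ⊆ insert B {A ∈ powersetCard k (Icc 1 n) | x ∈ A ∧ (A ∩ B).Nonempty}) :
    SubIsoTo n F (HMfam n k) := by
  obtain ⟨hBn, hBk⟩ := mem_powersetCard.1 hB
  obtain ⟨σ, h1, h2, h3⟩ := exists_perm_image_eq_pair (U := Icc 1 n) (B' := Icc 2 (k + 1))
    (y := 1) hx (by simp; omega) hBn (Icc_subset_Icc (by omega) hkn) (by simp [hBk]) hxB (by simp)
  refine ⟨σ, h1, fun T hT => ?_⟩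
  obtain ⟨A, hA, rfl⟩ := mem_image.1 hT
  rcases mem_insert.1 (hF hA) with rfl | hA
  · exact mem_insert.2 (Or.inl h3)
  · obtain ⟨hA1, hA2, hA3⟩ := mem_filter.1 hA
    refine mem_insert_of_mem (mem_filter.2 ⟨image_mem_powersetCard h1 hA1, ?_, ?_⟩)
    · exact h2 ▸ mem_image_of_mem _ hA2
    · rw [← h3]
      exact image_inter_image_nonempty σ hA3

theorem Jfam_two (n k : ℕ) :
    Jfam n k 2 = {A ∈ powersetCard k (Icc 1 n) | 1 ∈ A ∧ (A ∩ insert (k + 1) (Icc 2 k)).Nonempty ∧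
      (A ∩ insert (k + 2) (Icc 2 k)).Nonempty} ∪
        {insert (k + 1) (Icc 2 k), insert (k + 2) (Icc 2 k)} := by
  have h : Icc (k + 1) (k + 2) = {k + 1, k + 2} := by
    ext x
    simp only [mem_Icc, mem_insert, mem_singleton]
    omega
  rw [Jfam, h, image_insert, image_singleton]
  simp only [mem_insert, mem_singleton, forall_eq_or_imp, forall_eq]

theorem subIsoTo_Jfam_two {n k x : ℕ} {F : Finset (Finset ℕ)} {B₁ B₂ : Finset ℕ} (hk : 1 ≤ k)
    (hkn : k + 2 ≤ n) (hx : x ∈ Icc 1 n) (hB₁ : B₁ ∈ powersetCard k (Icc 1 n))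
    (hB₂ : B₂ ∈ powersetCard k (Icc 1 n)) (hxB₁ : x ∉ B₁) (hxB₂ : x ∉ B₂)
    (hc : #(B₁ ∪ B₂) = k + 1)
    (hF : F ⊆ {A ∈ powersetCard k (Icc 1 n) | x ∈ A ∧ (A ∩ B₁).Nonempty ∧ (A ∩ B₂).Nonempty} ∪
      {B₁, B₂}) : SubIsoTo n F (Jfam n k 2) := by
  obtain ⟨hBn₁, hBk₁⟩ := mem_powersetCard.1 hB₁
  obtain ⟨hBn₂, hBk₂⟩ := mem_powersetCard.1 hB₂
  have hci := card_union_add_card_inter B₁ B₂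
  have hC : #(Icc 2 k) = k - 1 := by simp
  obtain ⟨σ, h1, h2, h3, h4⟩ := exists_perm_image_eq_sunflower (U := Icc 1 n) (C := Icc 2 k)
    (y := 1) (b₁ := k + 1) (b₂ := k + 2) hx (by simp; omega) hBn₁ hBn₂
    (Icc_subset_Icc (by omega) (by omega)) (by simp; omega) (by simp; omega) hxB₁ hxB₂ (by simp)
    (by omega) (by omega) (by simp) (by simp) (by omega) (by omega) (by omega) (by omega)
  refine ⟨σ, h1, fun T hT => ?_⟩
  rw [Jfam_two]
  obtain ⟨A, hA, rfl⟩ := mem_image.1 hT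
  rcases mem_union.1 (hF hA) with hA | hA
  · obtain ⟨hA1, hA2, hA3, hA4⟩ := mem_filter.1 hA
    refine mem_union_left _ (mem_filter.2 ⟨image_mem_powersetCard h1 hA1, ?_, ?_, ?_⟩)
    · exact h2 ▸ mem_image_of_mem _ hA2
    · rw [← h3]
      exact image_inter_image_nonempty σ hA3
    · rw [← h4]
      exact image_inter_image_nonempty σ hA4
  · simp only [mem_insert, mem_singleton] at hA
    refine mem_union_right _ ?_
    rcases hA with rfl | rfl
    · exact mem_insert.2 (Or.inl h3)
    · exact mem_insert_of_mem (mem_singleton.2 h4)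

theorem card_Jfam_two {n k : ℕ} (hk : 3 ≤ k) (hn : 2 * k + 1 ≤ n) :
    #(Jfam n k 2) + (n - k - 1).choose (k - 1) + (n - k - 2).choose (k - 2)
      = (n - 1).choose (k - 1) + 2 := by
  have hC : #(Icc 2 k) = k - 1 := by simp
  have hsub : Icc 2 k ⊆ Icc 1 n := Icc_subset_Icc (by omega) (by omega)
  have h1 : k + 1 ∉ Icc 2 k := by simp
  have h2 : k + 2 ∉ insert (k + 1) (Icc 2 k) := by simp
  have hu : insert (k + 1) (Icc 2 k) ∪ insert (k + 2) (Icc 2 k)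
      = insert (k + 2) (insert (k + 1) (Icc 2 k)) := by
    ext x
    simp only [mem_union, mem_insert]
    tauto
  have h := card_star_meet_pair_union (V := Icc 1 n) (x := 1) (k := k)
    (B₁ := insert (k + 1) (Icc 2 k)) (B₂ := insert (k + 2) (Icc 2 k)) (by omega)
    (by simp; omega)
    (mem_powersetCard.2 ⟨insert_subset (by simp; omega) hsub, by
      rw [card_insert_of_notMem h1]; omega⟩)
    (mem_powersetCard.2 ⟨insert_subset (by simp; omega) hsub, by
      rw [card_insert_of_notMem (by simp)]; omega⟩) (by simp; omega) (by simp)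
    (fun he => h2 (he ▸ mem_insert_self _ _))
  rw [← Jfam_two, hu, card_insert_of_notMem h2, card_insert_of_notMem h1, hC, Nat.card_Icc] at h
  have e : (n - k - 1).choose (k - 1) = (n - k - 2).choose (k - 2) + (n - k - 2).choose (k - 1) := by
    obtain ⟨a, ha⟩ : ∃ a, n - k - 1 = a + 1 := ⟨n - k - 2, by omega⟩
    obtain ⟨b, hb⟩ : ∃ b, k - 1 = b + 1 := ⟨k - 2, by omega⟩
    rw [ha, hb, Nat.choose_succ_succ' a b, show n - k - 2 = a by omega, show k - 2 = b by omega]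
  rw [show n + 1 - 1 - 1 - k = n - k - 1 by omega, show n + 1 - 1 - 1 = n - 1 by omega,
    show n - 1 - (k - 1 + 1 + 1) = n - k - 2 by omega] at h
  omega

theorem Gfam_two (n k : ℕ) :
    Gfam n k 2 = {A ∈ powersetCard k (Icc 1 n) | 2 ≤ #(A ∩ {1, 2, 3})} := by
  have h : Icc 1 2 = ({1, 2} : Finset ℕ) := rfl
  ext A
  rw [Gfam, h, mem_union, mem_filter, mem_filter, mem_filter,
    two_le_card_inter_triple (by omega) (by omega) (by omega)]
  have h' : (A ∩ {1, 2}).Nonempty ↔ 1 ∈ A ∨ 2 ∈ A := by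
    simp only [Finset.Nonempty, mem_inter, mem_insert, mem_singleton]
    grind
  simp only [h', insert_subset_iff, singleton_subset_iff]
  tauto

theorem Gfam_three (n k : ℕ) :
    Gfam n k 3 = {A ∈ powersetCard k (Icc 1 n) | Icc 1 3 ⊆ A ∨
      (4 ∈ A ∧ (A ∩ Icc 1 3).Nonempty)} := by
  rw [Gfam, filter_or]

theorem subIsoTo_Gfam_two {n k : ℕ} {F : Finset (Finset ℕ)} {T : Finset ℕ} (hn : 3 ≤ n)
    (hF : F ⊆ powersetCard k (Icc 1 n)) (hTn : T ⊆ Icc 1 n) (hT : #T = 3)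
    (h : ∀ A ∈ F, 2 ≤ #(A ∩ T)) : SubIsoTo n F (Gfam n k 2) := by
  obtain ⟨σ, h1, h2⟩ := exists_perm_image_eq (U := Icc 1 n) (P := T) (Q := {1, 2, 3}) hTn (by
    intro x hx
    simp only [mem_insert, mem_singleton, mem_Icc] at hx ⊢
    omega) hT
  have h3 := mem_of_fixed_outside h1
  refine ⟨σ, h3, fun S hS => ?_⟩
  obtain ⟨A, hA, rfl⟩ := mem_image.1 hS
  rw [Gfam_two, mem_filter, ← h2]
  refine ⟨image_mem_powersetCard h3 (hF hA), ?_⟩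
  rw [← image_inter _ _ σ.injective, card_image_of_injective _ σ.injective]
  exact h A hA

theorem subIsoTo_Gfam_three {n k x : ℕ} {F : Finset (Finset ℕ)} {E : Finset ℕ} (hn : 4 ≤ n)
    (hF : F ⊆ powersetCard k (Icc 1 n)) (hEn : E ⊆ Icc 1 n) (hx : x ∈ Icc 1 n) (hE : #E = 3)
    (hxE : x ∉ E) (h : ∀ A ∈ F, E ⊆ A ∨ (x ∈ A ∧ (A ∩ E).Nonempty)) :
    SubIsoTo n F (Gfam n k 3) := by
  obtain ⟨σ, h1, h2, h3⟩ := exists_perm_image_eq_pair (U := Icc 1 n) (B' := Icc 1 3) (y := 4) hx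
    (by simp; omega) hEn (Icc_subset_Icc le_rfl (by omega)) (by simp [hE]) hxE (by simp)
  refine ⟨σ, h1, fun S hS => ?_⟩
  obtain ⟨A, hA, rfl⟩ := mem_image.1 hS
  rw [Gfam_three, mem_filter, ← h3]
  refine ⟨image_mem_powersetCard h1 (hF hA), (h A hA).imp (fun h => image_subset_image h) ?_⟩
  rintro ⟨h4, h5⟩
  exact ⟨h2 ▸ mem_image_of_mem _ h4, image_inter_image_nonempty σ h5⟩

theorem isTwoOfThree_Gfam_two {n : ℕ} (hn : 3 ≤ n) (k : ℕ) :
    IsTwoOfThree (Icc 1 n) k (Gfam n k 2) := by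
  refine ⟨{1, 2, 3}, fun x hx => ?_, rfl, Gfam_two n k⟩
  simp only [mem_insert, mem_singleton, mem_Icc] at hx ⊢
  omega

theorem isTripleOrStar_Gfam_three {n : ℕ} (hn : 4 ≤ n) (k : ℕ) :
    IsTripleOrStar (Icc 1 n) k (Gfam n k 3) :=
  ⟨Icc 1 3, Icc_subset_Icc le_rfl (by omega), 4, by simp; omega, by simp, by simp, Gfam_three n k⟩

theorem card_bound_and_equality {k n : ℕ} (hk : 3 ≤ k) (hn : 2 * k + 1 ≤ n)
    {F : Finset (Finset ℕ)} (hF : F ⊆ powersetCard k (Icc 1 n))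
    (hint : ∀ A ∈ F, ∀ B ∈ F, (A ∩ B).Nonempty) (hstar : ¬ ∃ x ∈ Icc 1 n, ∀ A ∈ F, x ∈ A)
    (hHM : ¬ SubIsoTo n F (HMfam n k)) (hG23 : k = 3 → ¬ SubIsoTo n F (Gfam n 3 2)) :
    #F + (n - k - 1).choose (k - 1) + (n - k - 2).choose (k - 2) ≤ (n - 1).choose (k - 1) + 2 ∧
      (#F + (n - k - 1).choose (k - 1) + (n - k - 2).choose (k - 2) = (n - 1).choose (k - 1) + 2 →
        SubIsoTo n F (Jfam n k 2) ∨
          k = 4 ∧ (SubIsoTo n F (Gfam n k 2) ∨ SubIsoTo n F (Gfam n k 3))) := by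
  have hV : #(Icc 1 n) = n := by simp
  push Not at hstar
  by_cases h3 : ∀ x ∈ Icc 1 n, 3 ≤ #{A ∈ F | x ∉ A}
  · rcases Nat.lt_or_ge 3 k with h4 | h4
    · have h := secondLevelBound_of_defect h4 (by omega) hF hint h3
        fun i hi _ => hiltonMilnerBound hi
      rw [SecondLevelBound, hV] at h
      refine ⟨h.1, fun he => Or.inr ?_⟩
      obtain ⟨hk4, h5⟩ := h.2 he
      refine ⟨hk4, h5.imp ?_ ?_⟩
      · rintro ⟨T, hTn, hT, h6⟩
        refine subIsoTo_Gfam_two (by omega) hF hTn hT fun A hA => ?_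
        rw [h6] at hA
        exact (mem_filter.1 hA).2
      · rintro ⟨E, hEn, x, hx, hE, hxE, h6⟩
        refine subIsoTo_Gfam_three (by omega) hF hEn hx hE hxE fun A hA => ?_
        rw [h6] at hA
        exact (mem_filter.1 hA).2
    · obtain rfl : k = 3 := by omega
      have h5 : ¬ ∃ T ⊆ Icc 1 n, #T = 3 ∧ ∀ A ∈ F, 2 ≤ #(A ∩ T) := by
        rintro ⟨T, hTn, hT, h⟩
        exact hG23 rfl (subIsoTo_Gfam_two (by omega) hF hTn hT h)
      have h6 := card_add_three_le_of_three_uniform (by omega) hF hint h3 h5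
      have h7 := choose_three_uniform_eq (n := n) (by omega)
      rw [hV] at h6
      norm_num
      rw [show n - 3 - 1 = n - 4 by omega, show n - 3 - 2 = n - 5 by omega]
      constructor <;> omega
  · push Not at h3
    obtain ⟨x, hx, hlt⟩ := h3
    rcases exists_filter_notMem_eq_pair (hstar x hx) hlt with ⟨B, hB⟩ | ⟨B₁, B₂, hne, hB⟩
    · obtain ⟨hBF, hxB⟩ := mem_filter.1 (hB ▸ mem_singleton_self B)
      exact absurd (subIsoTo_HMfam (by omega) hx (hF hBF) hxB
        (subset_of_filter_notMem_eq_singleton hF hint hB)) hHM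
    · obtain ⟨h₁, hx₁⟩ := mem_filter.1 (hB ▸ mem_insert_self B₁ {B₂})
      obtain ⟨h₂, hx₂⟩ := mem_filter.1 (hB ▸ mem_insert_of_mem (mem_singleton_self B₂))
      have h := card_bound_of_filter_notMem_eq_pair (by omega) (by omega) hx hF hint hB hne
      rw [hV] at h
      refine ⟨h.1, fun he => Or.inl ?_⟩
      obtain ⟨h4, h5⟩ := h.2 he
      exact subIsoTo_Jfam_two (by omega) (by omega) hx (hF h₁) (hF h₂) hx₁ hx₂ h4 h5.subset

/-- Han–Kohayakawa theorem. -/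
theorem stmt_5 (k n : ℕ) (hk : 3 ≤ k) (hn : 2 * k + 1 ≤ n)
    (F : Finset (Finset ℕ)) (hF : F ⊆ powersetCard k (Icc 1 n))
    (hint : ∀ A ∈ F, ∀ B ∈ F, (A ∩ B).Nonempty)
    (hstar : ¬ ∃ x ∈ Icc 1 n, ∀ A ∈ F, x ∈ A)
    (hHM : ¬ SubIsoTo n F (HMfam n k))
    (hG23 : k = 3 → ¬ SubIsoTo n F (Gfam n 3 2)) :
    ((F.card : ℤ) ≤ ((n - 1).choose (k - 1) : ℤ) - (n - k - 1).choose (k - 1)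
        - (n - k - 2).choose (k - 2) + 2) ∧
    ((k = 3 ∨ 5 ≤ k) →
      (((F.card : ℤ) = ((n - 1).choose (k - 1) : ℤ) - (n - k - 1).choose (k - 1)
          - (n - k - 2).choose (k - 2) + 2) ↔ IsoTo n F (Jfam n k 2))) ∧
    (k = 4 →
      (((F.card : ℤ) = ((n - 1).choose (k - 1) : ℤ) - (n - k - 1).choose (k - 1)
          - (n - k - 2).choose (k - 2) + 2) ↔
        (IsoTo n F (Jfam n 4 2) ∨ IsoTo n F (Gfam n 4 2) ∨ IsoTo n F (Gfam n 4 3)))) := by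
  have hb := card_bound_and_equality hk hn hF hint hstar hHM hG23
  have hJ := card_Jfam_two hk hn
  have hiff : ((F.card : ℤ) = ((n - 1).choose (k - 1) : ℤ) - (n - k - 1).choose (k - 1)
      - (n - k - 2).choose (k - 2) + 2) ↔
      #F + (n - k - 1).choose (k - 1) + (n - k - 2).choose (k - 2)
        = (n - 1).choose (k - 1) + 2 := by
    omega
  rw [hiff]
  refine ⟨by omega, fun hk' => ⟨fun he => ?_, fun h => ?_⟩, ?_⟩
  · rcases hb.2 he with h | ⟨h4, _⟩
    · exact h.isoTo (by omega)
    · omega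
  · rw [h.card_eq]
    exact hJ
  · rintro rfl
    have hn' : 9 ≤ #(Icc 1 n) := by simpa using hn
    have hG₂ := card_isTwoOfThree hn' (isTwoOfThree_Gfam_two (by omega) 4)
    have hG₃ := card_isTripleOrStar hn' (isTripleOrStar_Gfam_three (by omega) 4)
    rw [Nat.card_Icc, Nat.add_sub_cancel] at hG₂ hG₃
    refine ⟨fun he => ?_, ?_⟩
    · rcases hb.2 he with h | ⟨_, h | h⟩
      · exact Or.inl (h.isoTo (by omega))
      · exact Or.inr (Or.inl (h.isoTo (by omega)))
      · exact Or.inr (Or.inr (h.isoTo (by omega)))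
    · rintro (h | h | h)
      · rw [h.card_eq]
        exact hJ
      · rw [h.card_eq]
        exact hG₂
      · rw [h.card_eq]
        exact hG₃
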